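/- Fix a real number T > 0 and integers n, k ≥ 1. For 1 ≤ i ≤ n let a_i : ℂ^k × [0,T] → ℂ be a finite sum a_i(w,x) = Σ_j c_{ij}(w) e_j(x), where each c_{ij} : ℂ^k → ℂ is entire (holomorphic on all of ℂ^k) and each e_j is an admissible function. Set A(w) := (a_1(w,·),…,a_n(w,·)), 𝒰_A := {w ∈ ℂ^k : I_{i_1,…,i_m}(A(w)) = 0 for every m ≥ 1 and all indices}, and 𝒞_A := {w ∈ ℂ^k : the equation E(A(w)) determines a center}. Then for every compact set K ⊂ ℂ^k there exist an integer N = N(K) ≥ 1, moments m_1,…,m_N (functions of the form w ↦ m^{n_1,…,n_j}_{i_1,…,i_{j+1}}(A(w))) and continuous functions f_1,…,f_N : ℂ^N → ℂ such that 𝒞_A ∩ K = {w ∈ K : f_j(m_1(w),…,m_N(w)) = 0 for all 1 ≤ j ≤ N}; moreover 𝒰_A ∩ K = {w ∈ K : m_j(w) = 0 for all 1 ≤ j ≤ N}. -/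

import Mathlib

open MeasureTheory Set Filter Topology

noncomputable section

/-- Iterated integral over the simplex `0 ≤ s₁ ≤ … ≤ s_m ≤ x`; the head of the
list is attached to the outermost (largest) variable. -/
def simplexInt : List (ℝ → ℂ) → ℝ → ℂ
  | [] => fun _ => 1
  | f :: fs => fun x => ∫ s in (0:ℝ)..x, f s * simplexInt fs s

/-- The basic iterated integral `I_{i₁,…,i_m}(a)`. -/
def iterInt (T : ℝ) {n : ℕ} (a : Fin n → ℝ → ℂ) (l : List (Fin n)) : ℂ :=
  simplexInt ((l.map a).reverse) T

/-- `ã(x) = ∫_0^x a(s) ds`. -/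
def primitive (a : ℝ → ℂ) (x : ℝ) : ℂ := ∫ s in (0:ℝ)..x, a s

/-- The moment `m^{n₁,…,n_j}_{i₁,…,i_{j+1}}(a)`, encoded by the list
`ps = [(i₁,n₁),…,(i_j,n_j)]` of index/exponent pairs and the final index `i`. -/
def moment (T : ℝ) {n : ℕ} (a : Fin n → ℝ → ℂ) (ps : List (Fin n × ℕ)) (i : Fin n) : ℂ :=
  ∫ s in (0:ℝ)..T, (ps.map fun q => primitive (a q.1) s ^ q.2).prod * a i s

/-- A function is admissible if on `[0,T]` it is a polynomial in `x`
or a finite linear combination of the exponentials `e^{2πijx/T}`, `j ∈ ℤ`. -/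
def Admissible (T : ℝ) (f : ℝ → ℂ) : Prop :=
  (∃ p : Polynomial ℂ, ∀ x ∈ Icc (0:ℝ) T, f x = p.eval (x : ℂ)) ∨
  (∃ (s : Finset ℤ) (c : ℤ → ℂ), ∀ x ∈ Icc (0:ℝ) T,
    f x = ∑ j ∈ s, c j * Complex.exp (2 * (Real.pi : ℂ) * Complex.I * (j : ℂ) * (x : ℂ) / (T : ℂ)))

/-- The equation `dv/dx = Σ_{i=1}^n a_i(x) v^{i+1}` determines a center. -/
def DeterminesCenter (T : ℝ) {n : ℕ} (a : Fin n → ℝ → ℂ) : Prop :=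
  ∃ ε > (0:ℝ), ∀ v : ℝ → ℂ,
    (∀ x ∈ Icc (0:ℝ) T, v x = v 0 + ∫ s in (0:ℝ)..x, ∑ i, a i s * v s ^ ((i : ℕ) + 2)) →
    ‖v 0‖ < ε → v T = v 0

section
open MeasureTheory Set Filter Topology
noncomputable section

namespace Ctr
open Polynomial

/-- abstract differential setup -/
structure ASetup {A B : Type} [CommRing A] [Algebra ℂ A] [CommRing B] [IsDomain B] [Algebra ℂ B]
    (D : Derivation ℂ A A) (π : A →ₐ[ℂ] B) (O C : Subalgebra ℂ A) (b : A) : Prop where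
  hOC : O ≤ C
  hb : b ∈ O
  hDO : ∀ g ∈ O, ∃ g1 ∈ O, D g = g1 * D b
  inj : ∀ c ∈ C, π c = 0 → c = 0
  nzd : ∀ c ∈ C, c ≠ 0 → ∀ y : A, c * y = 0 → y = 0
  hDb : ∀ y : A, D b * y = 0 → y = 0
  piD : ∀ y : A, π y = 0 → π (D y) = 0
  hDbπ : π (D b) ≠ 0
  alg : ∀ c ∈ C, ∃ P : A[X], P ≠ 0 ∧ (∀ i, P.coeff i ∈ O) ∧ P.eval c = 0
  wron : ∀ c ∈ C, c ≠ 0 → ∀ h : A, c * D h = h * D c → ∃ κ : A, D κ = 0 ∧ h = κ * c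

/-- `y` has a denominator in `O`. -/
def RR {A : Type} [CommRing A] [Algebra ℂ A] (O C : Subalgebra ℂ A) (y : A) : Prop :=
  ∃ s ∈ O, s ≠ 0 ∧ s * y ∈ C

def XX {A : Type} [CommRing A] [Algebra ℂ A] (D : Derivation ℂ A A) (O C : Subalgebra ℂ A) (b : A)
    (y : A) : Prop :=
  ∃ s ∈ O, s ≠ 0 ∧ ∃ e ∈ C, s * y = e * D b

section
variable {A B : Type} [CommRing A] [Algebra ℂ A] [CommRing B] [IsDomain B] [Algebra ℂ B]
    {D : Derivation ℂ A A} {π : A →ₐ[ℂ] B} {O C : Subalgebra ℂ A} {b : A}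

lemma D_eval (D : Derivation ℂ A A) (P : A[X]) (u : A) (N : ℕ) (hN : P.natDegree < N) :
    D (P.eval u) = ∑ i ∈ Finset.range N, D (P.coeff i) * u ^ i + P.derivative.eval u * D u := by
  have h2 : P.derivative.eval u = ∑ i ∈ Finset.range N, P.coeff i * i * u ^ (i - 1) := by
    rw [derivative_eval, sum_over_range' _ _ N hN]; simp
  rw [h2, eval_eq_sum_range' hN, map_sum, Finset.sum_mul, ← Finset.sum_add_distrib]
  refine Finset.sum_congr rfl fun i _ => ?_
  simp [Derivation.leibniz, Derivation.leibniz_pow]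
  ring

lemma evalmem (S : Subalgebra ℂ A) (P : A[X]) (hP : ∀ i, P.coeff i ∈ S) {u : A} (hu : u ∈ S) :
    P.eval u ∈ S := by
  rw [eval_eq_sum_range]
  exact S.sum_mem fun i _ => S.mul_mem (hP i) (S.pow_mem hu i)

namespace ASetup

lemma mulne (h : ASetup D π O C b) {s t : A} (hs : s ∈ C) (hs0 : s ≠ 0) (ht0 : t ≠ 0) :
    s * t ≠ 0 := fun h0 => ht0 (h.nzd s hs hs0 t h0)

lemma star (h : ASetup D π O C b) {c : A} (hc : c ∈ C) (hc0 : c ≠ 0) :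
    ∃ c' ∈ C, c * c' ∈ O ∧ c * c' ≠ 0 := by
  have key : ∀ N : ℕ, ∀ P : A[X], P.natDegree ≤ N → P ≠ 0 → (∀ i, P.coeff i ∈ O) → P.eval c = 0 →
      ∃ c' ∈ C, c * c' ∈ O ∧ c * c' ≠ 0 := by
    intro N
    induction N with
    | zero =>
      intro P hN hP0 hPO hPc
      rw [eq_C_of_natDegree_le_zero hN] at hPc hP0
      simp at hPc; simp [hPc] at hP0
    | succ N ih =>
      intro P hN hP0 hPO hPc
      have hd := divX_mul_X_add P
      have he : P.divX.eval c * c + P.coeff 0 = 0 := by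
        rw [← hPc]; conv_rhs => rw [← hd]
        simp
      have hdO : ∀ i, P.divX.coeff i ∈ O := fun i => by rw [coeff_divX]; exact hPO _
      by_cases h0 : P.coeff 0 = 0
      · rw [h0, add_zero, mul_comm] at he
        refine ih P.divX ?_ ?_ hdO (h.nzd c hc hc0 _ he)
        · rw [natDegree_divX_eq_natDegree_tsub_one]; omega
        · intro h1; rw [h1, h0] at hd; simp at hd; exact hP0 hd.symm
      · refine ⟨P.divX.eval c, evalmem C _ (fun i => h.hOC (hdO i)) hc, ?_, ?_⟩
        · have : c * P.divX.eval c = - P.coeff 0 := by linear_combination he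
          rw [this]; exact O.neg_mem (hPO 0)
        · have : c * P.divX.eval c = - P.coeff 0 := by linear_combination he
          rw [this]; simpa using h0
  obtain ⟨P, h1, h2, h3⟩ := h.alg c hc
  exact key _ P le_rfl h1 h2 h3

lemma X_add (h : ASetup D π O C b) {x y : A} (hx : XX D O C b x) (hy : XX D O C b y) :
    XX D O C b (x + y) := by
  obtain ⟨s, hs, hs0, e, he, hse⟩ := hx
  obtain ⟨t, ht, ht0, f, hf, htf⟩ := hy
  refine ⟨s * t, O.mul_mem hs ht, h.mulne (h.hOC hs) hs0 ht0, t * e + s * f,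
    C.add_mem (C.mul_mem (h.hOC ht) he) (C.mul_mem (h.hOC hs) hf), ?_⟩
  linear_combination t * hse + s * htf

lemma X_mul (h : ASetup D π O C b) {x y : A} (hx : RR O C x) (hy : XX D O C b y) :
    XX D O C b (x * y) := by
  obtain ⟨s, hs, hs0, he⟩ := hx
  obtain ⟨t, ht, ht0, f, hf, htf⟩ := hy
  refine ⟨s * t, O.mul_mem hs ht, h.mulne (h.hOC hs) hs0 ht0, (s * x) * f, C.mul_mem he hf, ?_⟩
  linear_combination s * x * htf

lemma R_of_C (h : ASetup D π O C b) {x : A} (hx : x ∈ C) : RR O C x := by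
  refine ⟨1, O.one_mem, ?_, by simpa using hx⟩
  intro h1
  apply h.hDbπ
  have : D b = 0 := by rw [← one_mul (D b), h1, zero_mul]
  rw [this, map_zero]

lemma R_add (h : ASetup D π O C b) {x y : A} (hx : RR O C x) (hy : RR O C y) :
    RR O C (x + y) := by
  obtain ⟨s, hs, hs0, he⟩ := hx
  obtain ⟨t, ht, ht0, hf⟩ := hy
  refine ⟨s * t, O.mul_mem hs ht, h.mulne (h.hOC hs) hs0 ht0, ?_⟩
  have : s * t * (x + y) = t * (s * x) + s * (t * y) := by ring
  rw [this]
  exact C.add_mem (C.mul_mem (h.hOC ht) he) (C.mul_mem (h.hOC hs) hf)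

lemma R_mul (h : ASetup D π O C b) {x y : A} (hx : RR O C x) (hy : RR O C y) :
    RR O C (x * y) := by
  obtain ⟨s, hs, hs0, he⟩ := hx
  obtain ⟨t, ht, ht0, hf⟩ := hy
  refine ⟨s * t, O.mul_mem hs ht, h.mulne (h.hOC hs) hs0 ht0, ?_⟩
  have : s * t * (x * y) = (s * x) * (t * y) := by ring
  rw [this]
  exact C.mul_mem he hf

/-- common denominators -/
lemma X_common (h : ASetup D π O C b) (y : ℕ → A) (N : ℕ) (hy : ∀ i < N, XX D O C b (y i)) :
    ∃ s ∈ O, s ≠ 0 ∧ ∀ i < N, ∃ e ∈ C, s * y i = e * D b := by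
  induction N with
  | zero =>
    obtain ⟨s, h1, h2, -⟩ := h.R_of_C C.one_mem
    exact ⟨s, h1, h2, fun i hi => by omega⟩
  | succ N ih =>
    obtain ⟨s, h1, h2, h3⟩ := ih fun i hi => hy i (by omega)
    obtain ⟨t, h4, h5, e, h6, h7⟩ := hy N (by omega)
    refine ⟨s * t, O.mul_mem h1 h4, h.mulne (h.hOC h1) h2 h5, fun i hi => ?_⟩
    rcases Nat.lt_succ_iff_lt_or_eq.1 hi with hi | rfl
    · obtain ⟨e, he, hs⟩ := h3 i hi
      exact ⟨t * e, C.mul_mem (h.hOC h4) he, by linear_combination t * hs⟩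
    · exact ⟨s * e, C.mul_mem (h.hOC h1) h6, by linear_combination s * h7⟩

/-- Lemma A -/
lemma DC (h : ASetup D π O C b) {c : A} (hc : c ∈ C) : XX D O C b (D c) := by
  classical
  have hex : ∃ N, ∃ P : A[X], P.natDegree = N ∧ P ≠ 0 ∧ (∀ i, P.coeff i ∈ O) ∧ P.eval c = 0 := by
    obtain ⟨P, h1⟩ := h.alg c hc; exact ⟨_, P, rfl, h1⟩
  obtain ⟨P, hPN, hP0, hPO, hPc⟩ := Nat.find_spec hex
  have hmin := fun m (hm : m < Nat.find hex) => Nat.find_min hex hm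
  rw [← hPN] at hmin
  have hd : P.natDegree ≠ 0 := by
    intro h0
    rw [eq_C_of_natDegree_eq_zero h0] at hPc hP0
    simp at hPc; simp [hPc] at hP0
  have hQ : P.derivative.eval c ≠ 0 := by
    intro h0
    refine hmin P.derivative.natDegree (natDegree_derivative_lt hd) ⟨P.derivative, rfl, ?_, ?_, h0⟩
    · intro h1
      have h2 : P.derivative.coeff (P.natDegree - 1) = 0 := by rw [h1]; simp
      rw [coeff_derivative, Nat.sub_add_cancel (by omega)] at h2
      have h3 : ((P.natDegree - 1 : ℕ) : A) + 1 = algebraMap ℂ A (P.natDegree : ℂ) := by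
        have : ((P.natDegree - 1 : ℕ) : A) + 1 = ((P.natDegree - 1 + 1 : ℕ) : A) := by push_cast; rfl
        rw [this, Nat.sub_add_cancel (by omega)]; simp
      rw [h3] at h2
      have h4 : P.coeff P.natDegree = 0 := by
        have h5 : algebraMap ℂ A (P.natDegree : ℂ) * algebraMap ℂ A ((P.natDegree : ℂ)⁻¹) = 1 := by
          rw [← map_mul, mul_inv_cancel₀ (by exact_mod_cast hd), map_one]
        calc P.coeff P.natDegree = P.coeff P.natDegree * algebraMap ℂ A (P.natDegree : ℂ) *
              algebraMap ℂ A ((P.natDegree : ℂ)⁻¹) := by rw [mul_assoc, h5, mul_one]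
          _ = 0 := by rw [h2, zero_mul]
      exact hP0 (leadingCoeff_eq_zero.1 h4)
    · intro i; rw [coeff_derivative]
      have : (i : A) + 1 ∈ O := O.add_mem (natCast_mem O i) O.one_mem
      exact O.mul_mem (hPO _) this
  have hQC : P.derivative.eval c ∈ C := by
    refine evalmem C _ (fun i => ?_) hc
    rw [coeff_derivative]
    exact C.mul_mem (h.hOC (hPO _)) (C.add_mem (natCast_mem C i) C.one_mem)
  obtain ⟨q, hq, hqO, hq0⟩ := h.star hQC hQ
  have h1 := D_eval D P c (P.natDegree + 1) (by omega)
  rw [hPc, map_zero] at h1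
  choose g hg hgD using fun i => h.hDO _ (hPO i)
  refine ⟨_, hqO, hq0, - q * ∑ i ∈ Finset.range (P.natDegree + 1), g i * c ^ i, ?_, ?_⟩
  · exact C.mul_mem (C.neg_mem hq) (C.sum_mem fun i _ => C.mul_mem (h.hOC (hg i)) (C.pow_mem hc i))
  · have h2 : ∑ i ∈ Finset.range (P.natDegree + 1), D (P.coeff i) * c ^ i =
      (∑ i ∈ Finset.range (P.natDegree + 1), g i * c ^ i) * D b := by
      rw [Finset.sum_mul]; exact Finset.sum_congr rfl fun i _ => by rw [hgD]; ring
    rw [h2] at h1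
    linear_combination -q * h1

lemma DR (h : ASetup D π O C b) {w : A} (hw : RR O C w) : XX D O C b (D w) := by
  obtain ⟨s, hs, hs0, hC⟩ := hw
  obtain ⟨t, ht, ht0, e, he, hte⟩ := h.DC hC
  obtain ⟨g, hg, hgD⟩ := h.hDO s hs
  rw [Derivation.leibniz, smul_eq_mul, smul_eq_mul, hgD] at hte
  refine ⟨t * s * s, O.mul_mem (O.mul_mem ht hs) hs,
    h.mulne (h.hOC (O.mul_mem ht hs)) (h.mulne (h.hOC ht) ht0 hs0) hs0,
    s * e - t * g * (s * w), ?_, ?_⟩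
  · exact C.sub_mem (C.mul_mem (h.hOC hs) he) (C.mul_mem (C.mul_mem (h.hOC ht) (h.hOC hg)) hC)
  · linear_combination s * hte

/-- Lemma B -/
lemma lemB (h : ASetup D π O C b) {u : A} (hu : XX D O C b (D u))
    (halg : ∃ P : A[X], P ≠ 0 ∧ (∀ i, P.coeff i ∈ C) ∧ π (P.eval u) = 0) :
    ∃ κ : A, D κ = 0 ∧ RR O C (u - κ) := by
  classical
  have hex : ∃ N, ∃ P : A[X], P.natDegree = N ∧ P ≠ 0 ∧ (∀ i, P.coeff i ∈ C) ∧ π (P.eval u) = 0 := by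
    obtain ⟨P, h1⟩ := halg; exact ⟨_, P, rfl, h1⟩
  obtain ⟨P, hPN, hP0, hPC, hPu⟩ := Nat.find_spec hex
  have hmin := fun m (hm : m < Nat.find hex) => Nat.find_min hex hm
  rw [← hPN] at hmin
  have hd : P.natDegree ≠ 0 := by
    intro h0
    rw [eq_C_of_natDegree_eq_zero h0] at hPu hP0
    rw [eval_C] at hPu
    rw [h.inj _ (hPC 0) hPu] at hP0; simp at hP0
  obtain ⟨m, hm⟩ : ∃ m, P.natDegree = m + 1 := ⟨_, (Nat.succ_pred hd).symm⟩
  -- common denominators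
  obtain ⟨s, hs, hs0, hsc⟩ := h.X_common (fun i => if i ≤ m + 1 then D (P.coeff i) else D u) (m + 3)
    (fun i _ => by
      split_ifs
      · exact h.DC (hPC i)
      · exact hu)
  have hsu : ∃ e ∈ C, s * D u = e * D b := by simpa using hsc (m + 2) (by omega)
  obtain ⟨e, he, hse⟩ := hsu
  have hsc' : ∀ i, ∃ f ∈ C, s * D (P.coeff i) = f * D b := by
    intro i
    by_cases hi : i ≤ m + 1
    · simpa [hi] using hsc i (by omega)
    · refine ⟨0, C.zero_mem, ?_⟩
      rw [coeff_eq_zero_of_natDegree_lt (by omega)]; simp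
  choose f hf hfs using hsc'
  set P1 : A[X] := (∑ i ∈ Finset.range (m + 2), Polynomial.C (f i) * X ^ i) +
    Polynomial.C e * P.derivative with hP1
  have hP1c : ∀ i, P1.coeff i = (if i < m + 2 then f i else 0) + e * (P.coeff (i+1) * (i + 1)) := by
    intro i
    rw [hP1, coeff_add, finsetSum_coeff, coeff_C_mul, coeff_derivative]
    simp [coeff_X_pow]
  have hP1u : π (P1.eval u) = 0 := by
    have h1 := D_eval D P u (m + 2) (by omega)
    have h2 : s * D (P.eval u) = P1.eval u * D b := by
      rw [h1, hP1, eval_add, eval_finsetSum, mul_add, Finset.mul_sum, add_mul, Finset.sum_mul]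
      congr 1
      · refine Finset.sum_congr rfl fun i _ => ?_
        simp; linear_combination u ^ i * hfs i
      · simp; linear_combination (P.derivative.eval u) * hse
    have h3 : π (s * D (P.eval u)) = 0 := by
      rw [map_mul, h.piD _ hPu, mul_zero]
    rw [h2, map_mul] at h3
    exact (mul_eq_zero.1 h3).resolve_right h.hDbπ
  set Q : A[X] := Polynomial.C (P.coeff (m+1)) * P1 - Polynomial.C (f (m+1)) * P with hQ
  have hQC : ∀ i, Q.coeff i ∈ C := by
    intro i
    rw [hQ, coeff_sub, coeff_C_mul, coeff_C_mul, hP1c]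
    refine C.sub_mem (C.mul_mem (hPC _) (C.add_mem ?_ (C.mul_mem he (C.mul_mem (hPC _) (C.add_mem (natCast_mem C i) C.one_mem))))) (C.mul_mem (hf _) (hPC _))
    split_ifs
    · exact hf i
    · exact C.zero_mem
  have hQ0 : Q = 0 := by
    by_contra hQ0
    refine hmin Q.natDegree ?_ ⟨Q, rfl, hQ0, hQC, ?_⟩
    · have : Q.natDegree ≤ m := by
        rw [natDegree_le_iff_coeff_eq_zero]
        intro i hi
        rw [hQ, coeff_sub, coeff_C_mul, coeff_C_mul, hP1c]
        have h3 : P.coeff (i + 1) = 0 := coeff_eq_zero_of_natDegree_lt (by omega)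
        rcases Nat.lt_or_ge i (m + 2) with h1 | h1
        · have : i = m + 1 := by omega
          subst this
          simp [h3]; ring
        · have h2 : P.coeff i = 0 := coeff_eq_zero_of_natDegree_lt (by omega)
          simp [h2, h3, not_lt.2 h1]
      omega
    · rw [hQ]; simp [hPu, hP1u]
  have hco : P.coeff (m+1) * (f m + e * (P.coeff (m+1) * (m + 1))) - f (m+1) * P.coeff m = 0 := by
    have : Q.coeff m = 0 := by rw [hQ0]; simp
    rw [hQ, coeff_sub, coeff_C_mul, coeff_C_mul, hP1c] at this
    simpa using this
  set c := P.coeff (m+1) with hc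
  set c1 := P.coeff m with hc1
  have hc0 : c ≠ 0 := by
    rw [hc, ← hm]; exact fun h0 => hP0 (leadingCoeff_eq_zero.1 h0)
  have hw : c * D ((m + 1 : ℂ) • (c * u) + c1) = ((m + 1 : ℂ) • (c * u) + c1) * D c := by
    have h5 : s * (c * (D c1 + (m+1) * c * D u) - c1 * D c) = 0 := by
      linear_combination hco * D b + c * hfs m + (m+1) * c * c * hse - c1 * hfs (m+1)
    have h6 := h.nzd s (h.hOC hs) hs0 _ h5
    have h7 : ∀ y : A, (m + 1 : ℂ) • y = (m + 1 : A) * y := by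
      intro y; rw [Algebra.smul_def]; simp
    rw [map_add, D.map_smul, Derivation.leibniz, smul_eq_mul, smul_eq_mul, h7, h7]
    linear_combination h6
  obtain ⟨κ, hκ, hκc⟩ := h.wron c (hPC _) hc0 _ hw
  refine ⟨(m + 1 : ℂ)⁻¹ • κ, by rw [D.map_smul, hκ, smul_zero], ?_⟩
  obtain ⟨q, hq, hqO, hq0⟩ := h.star (hPC (m+1)) hc0
  refine ⟨_, hqO, hq0, ?_⟩
  have hm0 : (m + 1 : ℂ) ≠ 0 := by exact_mod_cast Nat.succ_ne_zero m
  have : c * q * (u - (m + 1 : ℂ)⁻¹ • κ) = -((m + 1 : ℂ)⁻¹ • (q * c1)) := by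
    have h8 : c * κ = (m + 1 : ℂ) • (c * u) + c1 := by rw [hκc]; ring
    have h9 : c * u = (m + 1 : ℂ)⁻¹ • (c * κ - c1) := by
      rw [h8, add_sub_cancel_right, smul_smul, inv_mul_cancel₀ hm0, one_smul]
    have : c * q * (u - (m + 1 : ℂ)⁻¹ • κ) = q * (c * u) - (m + 1 : ℂ)⁻¹ • (q * (c * κ)) := by
      rw [mul_sub, mul_smul_comm]; congr 1
      · ring
      · congr 1; ring
    rw [this, h9, mul_smul_comm, ← smul_sub, ← smul_neg]; congr 1; ring
  rw [this]
  exact C.neg_mem (C.smul_mem (C.mul_mem hq (hPC m)) _)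

end ASetup

/-- finiteness of `O / s` -/
def FinO {A : Type} [CommRing A] [Algebra ℂ A] (O : Subalgebra ℂ A) : Prop :=
  ∀ s ∈ O, s ≠ 0 → ∃ F : Submodule ℂ A, FiniteDimensional ℂ F ∧
    ∀ g ∈ O, ∃ f ∈ F, ∃ g1 ∈ O, g = f + s * g1

def MM (O : Subalgebra ℂ A) (w : A) (N : ℕ) (y : A) : Prop :=
  ∃ g : ℕ → A, (∀ k, g k ∈ O) ∧ y = ∑ k ∈ Finset.range N, g k * w ^ k

lemma MM_add {w : A} {N : ℕ} {x y : A} (hx : MM O w N x) (hy : MM O w N y) : MM O w N (x + y) := by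
  obtain ⟨g, hg, rfl⟩ := hx
  obtain ⟨f, hf, rfl⟩ := hy
  refine ⟨fun k => g k + f k, fun k => O.add_mem (hg k) (hf k), ?_⟩
  rw [← Finset.sum_add_distrib]; exact Finset.sum_congr rfl fun k _ => by ring

lemma MM_mul {w : A} {N : ℕ} {x y : A} (hx : x ∈ O) (hy : MM O w N y) : MM O w N (x * y) := by
  obtain ⟨f, hf, rfl⟩ := hy
  refine ⟨fun k => x * f k, fun k => O.mul_mem hx (hf k), ?_⟩
  rw [Finset.mul_sum]; exact Finset.sum_congr rfl fun k _ => by ring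

lemma MM_zero {w : A} {N : ℕ} : MM O w N 0 := ⟨fun _ => 0, fun _ => O.zero_mem, by simp⟩

lemma MM_sum {w : A} {N : ℕ} {ι : Type} (s : Finset ι) (y : ι → A) (hy : ∀ i ∈ s, MM O w N (y i)) :
    MM O w N (∑ i ∈ s, y i) := by
  classical
  induction s using Finset.induction_on with
  | empty => simpa using MM_zero
  | insert a s ha ih =>
    rw [Finset.sum_insert ha]
    exact MM_add (hy _ (by simp)) (ih fun i hi => hy i (by simp [hi]))

lemma MM_pow {w : A} {P : A[X]} (hP : P.Monic) (hPO : ∀ i, P.coeff i ∈ O) (hPw : P.eval w = 0)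
    (d : ℕ) : MM O w P.natDegree (w ^ d) := by
  induction d using Nat.strong_induction_on with
  | _ d ih =>
    rcases Nat.lt_or_ge d P.natDegree with hd | hd
    · refine ⟨fun k => if k = d then 1 else 0, fun k => ?_, ?_⟩
      · dsimp only; split_ifs
        · exact O.one_mem
        · exact O.zero_mem
      · simp [hd]
    · have h1 : w ^ P.natDegree = - ∑ k ∈ Finset.range P.natDegree, P.coeff k * w ^ k := by
        rw [eval_eq_sum_range, Finset.sum_range_succ, coeff_natDegree, hP.leadingCoeff, one_mul] at hPw
        linear_combination hPw
      have h2 : w ^ d = ∑ k ∈ Finset.range P.natDegree, (- P.coeff k) * w ^ (k + (d - P.natDegree)) := by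
        conv_lhs => rw [← Nat.add_sub_cancel' hd, pow_add, h1]
        rw [neg_mul, Finset.sum_mul, ← Finset.sum_neg_distrib]
        exact Finset.sum_congr rfl fun k _ => by ring
      rw [h2]
      refine MM_sum _ _ fun k hk => MM_mul (O.neg_mem (hPO k)) (ih _ ?_)
      have := Finset.mem_range.1 hk
      omega

lemma MM_w {w : A} {P : A[X]} (hP : P.Monic) (hPO : ∀ i, P.coeff i ∈ O) (hPw : P.eval w = 0)
    (r : ℂ[X]) {y : A} (hy : MM O w P.natDegree y) : MM O w P.natDegree (y * aeval w r) := by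
  obtain ⟨g, hg, rfl⟩ := hy
  rw [aeval_eq_sum_range, Finset.sum_mul]
  refine MM_sum _ _ fun k _ => ?_
  rw [Finset.mul_sum]
  refine MM_sum _ _ fun j _ => ?_
  have : g k * w ^ k * (r.coeff j • w ^ j) = (r.coeff j • g k) * w ^ (k + j) := by
    rw [mul_smul_comm, smul_mul_assoc, pow_add, mul_assoc]
  rw [this]
  exact MM_mul (O.smul_mem (hg k) _) (MM_pow hP hPO hPw _)

lemma ASetup.closed (h : ASetup D π O C b) (hfin : FinO O) (Λ : A →ₗ[ℂ] ℂ) {s0 : A} (hs0 : s0 ∈ O)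
    (hs00 : s0 ≠ 0) (hΛ : ∀ c ∈ C, Λ (s0 * c * D b) = 0) {w : A} (hw : RR O C w)
    (hint : ∃ P : A[X], P.Monic ∧ (∀ i, P.coeff i ∈ O) ∧ π (P.eval w) = 0) :
    ∃ Q : ℂ[X], Q ≠ 0 ∧ ∀ r : ℂ[X], Λ (aeval w (Q * r) * D w) = 0 := by
  classical
  obtain ⟨P, hP, hPO, hPw⟩ := hint
  obtain ⟨t, ht, ht0, e, he, hte⟩ := h.DR hw
  obtain ⟨s, hs, hs0', hsw⟩ := hw
  have hpow : ∀ N : ℕ, s ^ N ∈ O ∧ s ^ N ≠ 0 := by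
    intro N
    refine ⟨O.pow_mem hs N, ?_⟩
    induction N with
    | zero => obtain ⟨s, h1, h2, -⟩ := h.R_of_C C.one_mem; intro h3; apply h2; rw [← mul_one s, ← pow_zero s]; simp at h3 ⊢; rw [← mul_one s, h3, mul_zero]
    | succ N ih => rw [pow_succ]; exact h.mulne (h.hOC (O.pow_mem hs N)) ih hs0'
  have hMC : ∀ N, ∀ y, MM O w N y → s ^ N * y ∈ C := by
    rintro N y ⟨g, hg, rfl⟩
    rw [Finset.mul_sum]
    refine C.sum_mem fun k hk => ?_
    have hk' := Finset.mem_range.1 hk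
    have : s ^ N * (g k * w ^ k) = s ^ (N - k) * g k * (s * w) ^ k := by
      conv_lhs => rw [← Nat.sub_add_cancel hk'.le, pow_add]
      ring
    rw [this]
    exact C.mul_mem (C.mul_mem (C.pow_mem (h.hOC hs) _) (h.hOC (hg k))) (C.pow_mem hsw k)
  have hPw' : P.eval w = 0 := by
    have h1 : MM O w (P.natDegree + 1) (P.eval w) := ⟨P.coeff, hPO, by rw [eval_eq_sum_range]⟩
    have h2 := hMC _ _ h1
    have h3 := h.inj _ h2 (by rw [map_mul, hPw, mul_zero])
    exact h.nzd _ (h.hOC (hpow _).1) (hpow _).2 _ h3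
  set N := P.natDegree with hN
  set t1 := s0 * s ^ N * t with ht1
  have ht1O : t1 ∈ O := O.mul_mem (O.mul_mem hs0 (hpow N).1) ht
  have ht10 : t1 ≠ 0 := h.mulne (h.hOC (O.mul_mem hs0 (hpow N).1))
    (h.mulne (h.hOC hs0) hs00 (hpow N).2) ht0
  obtain ⟨F, hF, hFO⟩ := hfin t1 ht1O ht10
  set F' : Submodule ℂ A := ⨆ k : Fin N, F.map (LinearMap.mulRight ℂ (w ^ (k : ℕ))) with hF'
  have : FiniteDimensional ℂ F' := Submodule.finiteDimensional_iSup _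
  have hred : ∀ y, MM O w N y → ∃ φ ∈ F', ∃ y', MM O w N y' ∧ y = φ + t1 * y' := by
    rintro y ⟨g, hg, rfl⟩
    choose f hf g1 hg1 hfg using fun k => hFO (g k) (hg k)
    refine ⟨∑ k ∈ Finset.range N, f k * w ^ k, ?_, ∑ k ∈ Finset.range N, g1 k * w ^ k,
      ⟨g1, hg1, rfl⟩, ?_⟩
    · refine F'.sum_mem fun k hk => ?_
      refine Submodule.mem_iSup_of_mem (⟨k, Finset.mem_range.1 hk⟩ : Fin N) ?_
      exact ⟨f k, hf k, rfl⟩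
    · rw [Finset.mul_sum, ← Finset.sum_add_distrib]
      exact Finset.sum_congr rfl fun k _ => by conv_lhs => rw [hfg k]
                                               ring
  choose φ hφ m hm hφm using fun d : ℕ => hred (w ^ d) (MM_pow hP hPO hPw' d)
  have hdep : ¬ LinearIndependent ℂ (fun d : ℕ => (⟨φ d, hφ d⟩ : F')) := by
    intro hli
    have := hli.finite
    exact not_finite ℕ
  rw [not_linearIndependent_iff] at hdep
  obtain ⟨S, q, hq, i0, hi0, hqi0⟩ := hdep
  have hq' : ∑ i ∈ S, q i • φ i = 0 := by
    have := congrArg (Submodule.subtype F') hq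
    simpa using this
  set Q : ℂ[X] := ∑ i ∈ S, Polynomial.C (q i) * X ^ i with hQ
  refine ⟨Q, ?_, fun r => ?_⟩
  · intro h0
    have : Q.coeff i0 = 0 := by rw [h0]; simp
    rw [hQ, finsetSum_coeff] at this
    simp [coeff_X_pow, hi0] at this
    exact hqi0 this
  · have hQw : aeval w Q = t1 * ∑ i ∈ S, q i • m i := by
      rw [hQ, map_sum, Finset.mul_sum]
      calc ∑ i ∈ S, aeval w (Polynomial.C (q i) * X ^ i) = ∑ i ∈ S, (q i • φ i + t1 * (q i • m i)) := by
            refine Finset.sum_congr rfl fun i _ => ?_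
            rw [map_mul, aeval_C, map_pow, aeval_X, hφm i, ← Algebra.smul_def, smul_add, mul_smul_comm]
        _ = _ := by rw [Finset.sum_add_distrib, hq', zero_add]
    have hM : MM O w N (∑ i ∈ S, q i • m i) := by
      refine MM_sum _ _ fun i _ => ?_
      rw [Algebra.smul_def]; exact MM_mul (O.algebraMap_mem _) (hm i)
    have h1 := hMC _ _ (MM_w hP hPO hPw' r hM)
    have h2 := hΛ _ (C.mul_mem h1 he)
    rw [← h2, map_mul (aeval w), hQw]
    congr 1
    rw [ht1]
    linear_combination (s0 * s ^ N * (∑ i ∈ S, q i • m i) * aeval w r) * hte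

end

lemma exists_indicator (Q : ℂ[X]) (hQ : Q ≠ 0) (Y : Finset ℂ) (y0 : ℂ) :
    ∃ S : ℂ[X], Q ∣ derivative S ∧ S.eval y0 = 1 ∧ ∀ y ∈ Y, y ≠ y0 → S.eval y = 0 := by
  classical
  set Q1 : ℂ[X] := Q * ((X - Polynomial.C y0) * ∏ y ∈ Y, (X - Polynomial.C y)) with hQ1
  have hQ10 : Q1 ≠ 0 := mul_ne_zero hQ (mul_ne_zero (X_sub_C_ne_zero _)
    (Finset.prod_ne_zero_iff.2 fun y _ => X_sub_C_ne_zero _))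
  obtain ⟨R, hR, hnd⟩ := exists_eq_pow_rootMultiplicity_mul_and_not_dvd Q1 hQ10 y0
  set k := Q1.rootMultiplicity y0 with hk
  have hk1 : 0 < k := by
    rw [hk, rootMultiplicity_pos hQ10, IsRoot, hQ1]; simp
  have hcop : IsCoprime (X - Polynomial.C y0) R :=
    (irreducible_X_sub_C y0).coprime_iff_not_dvd.2 hnd
  obtain ⟨a, c, hac⟩ := (hcop.pow (m := 2 * k) (n := 2))
  have hcop2 : IsCoprime ((X - Polynomial.C y0) ^ k) R := hcop.pow_left
  refine ⟨c * R ^ 2, ?_, ?_, ?_⟩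
  · refine (Dvd.intro _ rfl : Q ∣ Q1).trans ?_
    rw [hR]
    refine hcop2.mul_dvd ?_ ?_
    · have : c * R ^ 2 = 1 - a * (X - Polynomial.C y0) ^ (2 * k) := by rw [← hac]; ring
      rw [this, pow_mul', derivative_sub, derivative_one, zero_sub, dvd_neg, derivative_mul,
        derivative_pow]
      refine dvd_add ?_ ?_
      · exact (dvd_pow_self _ two_ne_zero).mul_left _
      · refine Dvd.dvd.mul_left ?_ _
        simp only [pow_one, Nat.add_one_sub_one]
        exact Dvd.dvd.mul_right (Dvd.intro_left _ rfl) _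
    · rw [derivative_mul, derivative_pow]
      refine dvd_add ?_ ?_
      · exact (dvd_pow_self _ two_ne_zero).mul_left _
      · refine Dvd.dvd.mul_left ?_ _
        simp only [pow_one, Nat.add_one_sub_one]
        exact Dvd.dvd.mul_right (Dvd.intro_left _ rfl) _
  · have := congrArg (eval y0) hac
    simpa [hk1.ne'] using this
  · intro y hy hne
    have h1 : Q1.eval y = 0 := by
      rw [hQ1, eval_mul, eval_mul, eval_prod, Finset.prod_eq_zero hy (by simp)]; simp
    rw [hR, eval_mul] at h1
    have h2 : R.eval y = 0 := by
      refine (mul_eq_zero.1 h1).resolve_left ?_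
      simp [sub_ne_zero.2 hne]
    simp [h2]

end Ctr
end
end

section
open MeasureTheory Set Filter Topology
noncomputable section
namespace Ctr

/-- analytic functions on an open set -/
def EV (V : TopologicalSpace.Opens ℂ) : Subalgebra ℂ (↥V → ℂ) where
  carrier := {f | ∃ F : ℂ → ℂ, DifferentiableOn ℂ F V ∧ ∀ x : ↥V, f x = F x}
  mul_mem' := by
    rintro f g ⟨F, hF, hf⟩ ⟨G, hG, hg⟩
    exact ⟨fun x => F x * G x, hF.mul hG, fun x => by simp [hf, hg]⟩
  add_mem' := by
    rintro f g ⟨F, hF, hf⟩ ⟨G, hG, hg⟩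
    exact ⟨fun x => F x + G x, hF.add hG, fun x => by simp [hf, hg]⟩
  algebraMap_mem' := fun c => ⟨fun _ => c, differentiableOn_const c, fun x => rfl⟩

namespace EV
variable {V : TopologicalSpace.Opens ℂ}

def mk (F : ℂ → ℂ) (hF : DifferentiableOn ℂ F V) : EV V := ⟨fun x => F x, F, hF, fun _ => rfl⟩
def fn (f : EV V) : ℂ → ℂ := f.2.choose
lemma fn_diff (f : EV V) : DifferentiableOn ℂ (fn f) V := f.2.choose_spec.1
lemma fn_eq (f : EV V) (x : ↥V) : f.1 x = fn f x := f.2.choose_spec.2 x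
lemma ext' {f g : EV V} (h : ∀ x ∈ V, fn f x = fn g x) : f = g := by
  apply Subtype.ext; funext x; rw [fn_eq, fn_eq, h x x.2]
lemma fn_mk (F : ℂ → ℂ) (hF : DifferentiableOn ℂ F V) {x : ℂ} (hx : x ∈ V) :
    fn (mk F hF) x = F x := by
  have := fn_eq (mk F hF) ⟨x, hx⟩
  exact this.symm
lemma fn_add (f g : EV V) {x : ℂ} (hx : x ∈ V) : fn (f + g) x = fn f x + fn g x := by
  rw [← fn_eq f ⟨x, hx⟩, ← fn_eq g ⟨x, hx⟩, ← fn_eq (f + g) ⟨x, hx⟩]; rfl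
lemma fn_mul (f g : EV V) {x : ℂ} (hx : x ∈ V) : fn (f * g) x = fn f x * fn g x := by
  rw [← fn_eq f ⟨x, hx⟩, ← fn_eq g ⟨x, hx⟩, ← fn_eq (f * g) ⟨x, hx⟩]; rfl
lemma fn_smul (c : ℂ) (g : EV V) {x : ℂ} (hx : x ∈ V) : fn (c • g) x = c * fn g x := by
  rw [← fn_eq g ⟨x, hx⟩, ← fn_eq (c • g) ⟨x, hx⟩]; rfl
lemma fn_alg (c : ℂ) {x : ℂ} (hx : x ∈ V) : fn (algebraMap ℂ (EV V) c) x = c := by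
  rw [← fn_eq _ ⟨x, hx⟩]; rfl
lemma fn_zero {x : ℂ} (hx : x ∈ V) : fn (0 : EV V) x = 0 := by
  rw [← fn_eq _ ⟨x, hx⟩]; rfl
lemma fn_one {x : ℂ} (hx : x ∈ V) : fn (1 : EV V) x = 1 := by
  rw [← fn_eq _ ⟨x, hx⟩]; rfl
lemma fn_pow (f : EV V) (k : ℕ) {x : ℂ} (hx : x ∈ V) : fn (f ^ k) x = fn f x ^ k := by
  rw [← fn_eq f ⟨x, hx⟩, ← fn_eq (f ^ k) ⟨x, hx⟩]; rfl
lemma fn_sub (f g : EV V) {x : ℂ} (hx : x ∈ V) : fn (f - g) x = fn f x - fn g x := by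
  rw [← fn_eq f ⟨x, hx⟩, ← fn_eq g ⟨x, hx⟩, ← fn_eq (f - g) ⟨x, hx⟩]; rfl
lemma mk_fn (f : EV V) : mk (fn f) (fn_diff f) = f := ext' fun x hx => fn_mk _ _ hx
lemma deriv_congr' {F G : ℂ → ℂ} (h : ∀ x ∈ V, F x = G x) {x : ℂ} (hx : x ∈ V) :
    deriv F x = deriv G x :=
  Filter.EventuallyEq.deriv_eq (by filter_upwards [V.isOpen.mem_nhds hx] with y hy using h y hy)
lemma dAt (f : EV V) {x : ℂ} (hx : x ∈ V) : DifferentiableAt ℂ (fn f) x :=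
  (fn_diff f).differentiableAt (V.isOpen.mem_nhds hx)

/-- evaluation -/
def ev (x : ℂ) (hx : x ∈ V) : EV V →ₐ[ℂ] ℂ where
  toFun f := fn f x
  map_one' := fn_one hx
  map_mul' f g := fn_mul f g hx
  map_zero' := fn_zero hx
  map_add' f g := fn_add f g hx
  commutes' c := fn_alg c hx

def DV : Derivation ℂ (EV V) (EV V) := Derivation.mk'
  { toFun := fun f => mk (deriv (fn f)) ((fn_diff f).deriv V.isOpen)
    map_add' := fun f g => ext' fun x hx => by
      rw [fn_add _ _ hx, fn_mk _ _ hx, fn_mk _ _ hx, fn_mk _ _ hx,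
        deriv_congr' (fun x hx => fn_add f g hx) hx]
      exact deriv_add (dAt f hx) (dAt g hx)
    map_smul' := fun c f => ext' fun x hx => by
      simp only [RingHom.id_apply]
      rw [fn_smul _ _ hx, fn_mk _ _ hx, fn_mk _ _ hx,
        deriv_congr' (fun x hx => fn_smul c f hx) hx]
      exact deriv_const_mul _ (dAt f hx) }
  (fun f g => ext' fun x hx => by
    simp only [LinearMap.coe_mk, AddHom.coe_mk, smul_eq_mul]
    rw [fn_add _ _ hx, fn_mul _ _ hx, fn_mul _ _ hx, fn_mk _ _ hx, fn_mk _ _ hx, fn_mk _ _ hx,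
        deriv_congr' (fun x hx => fn_mul f g hx) hx]
    have := deriv_fun_mul (dAt f hx) (dAt g hx)
    rw [this]; ring)

lemma fn_DV (f : EV V) {x : ℂ} (hx : x ∈ V) : fn (DV f) x = deriv (fn f) x :=
  fn_mk _ ((fn_diff f).deriv V.isOpen) hx

lemma fn_an (f : EV V) : AnalyticOnNhd ℂ (fn f) V := (fn_diff f).analyticOnNhd V.isOpen

lemma isDomain (hV : IsPreconnected (V : Set ℂ)) (x0 : ℂ) (hx0 : x0 ∈ V) : IsDomain (EV V) := by
  have : Nontrivial (EV V) := ⟨0, 1, fun h => by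
    have h1 := congrArg (fun f => fn f x0) h
    simp only [fn_zero hx0, fn_one hx0] at h1
    exact zero_ne_one h1⟩
  have : NoZeroDivisors (EV V) := ⟨fun {f g} h => by
    have h1 : ∀ x ∈ (V : Set ℂ), (fn f * fn g) x = 0 := fun x hx => by
      have := fn_mul f g hx
      rw [h, fn_zero hx] at this; exact this.symm
    rcases (fn_an f).eq_zero_or_eq_zero_of_mul_eq_zero (fn_an g) h1 hV with h2 | h2
    · exact Or.inl (ext' fun x hx => by rw [h2 x hx, fn_zero hx])
    · exact Or.inr (ext' fun x hx => by rw [h2 x hx, fn_zero hx])⟩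
  exact NoZeroDivisors.to_isDomain _

lemma const_of_DV (hV : IsPreconnected (V : Set ℂ)) (f : EV V) (h : DV f = 0) :
    ∃ c : ℂ, f = algebraMap ℂ _ c := by
  obtain ⟨c, hc⟩ := V.isOpen.exists_is_const_of_deriv_eq_zero hV (fn_diff f) (fun x hx => by
    rw [← fn_DV f hx, h, fn_zero hx]; rfl)
  exact ⟨c, ext' fun x hx => by rw [hc x hx, fn_alg _ hx]⟩

lemma wron (hV : IsPreconnected (V : Set ℂ)) (c h : EV V) (hc : c ≠ 0)
    (hw : c * DV h = h * DV c) : ∃ κ : ℂ, h = algebraMap ℂ _ κ * c := by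
  obtain ⟨x0, hx0, hcx⟩ : ∃ x ∈ V, fn c x ≠ 0 := by
    by_contra! hcon
    exact hc (ext' fun x hx => by rw [hcon x hx, fn_zero hx])
  have hev : ∀ᶠ x in 𝓝 x0, x ∈ V ∧ fn c x ≠ 0 :=
    Filter.Eventually.and (V.isOpen.mem_nhds hx0) ((dAt c hx0).continuousAt.eventually_ne hcx)
  obtain ⟨ε, hε, hball⟩ := Metric.eventually_nhds_iff_ball.1 hev
  have hd : ∀ x ∈ Metric.ball x0 ε, HasDerivAt (fun y => fn h y / fn c y) 0 x := by
    intro x hx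
    obtain ⟨hxV, hne⟩ := hball x hx
    have h1 := (dAt h hxV).hasDerivAt.div (dAt c hxV).hasDerivAt hne
    have h2 := congrArg (fun f => fn f x) hw
    simp only [fn_mul _ _ hxV, fn_DV _ hxV] at h2
    have h3 : (deriv (fn h) x * fn c x - fn h x * deriv (fn c) x) / fn c x ^ 2 = 0 := by
      rw [div_eq_zero_iff]; left; linear_combination h2
    rw [h3] at h1
    exact h1
  have hconst : ∀ x ∈ Metric.ball x0 ε, fn h x / fn c x = fn h x0 / fn c x0 := by
    intro x hx
    exact Metric.isOpen_ball.is_const_of_deriv_eq_zero (convex_ball x0 ε).isPreconnected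
      (fun y hy => (hd y hy).differentiableAt.differentiableWithinAt)
      (fun y hy => (hd y hy).deriv) hx (Metric.mem_ball_self hε)
  refine ⟨fn h x0 / fn c x0, ext' fun x hx => ?_⟩
  have := (fn_an h).eqOn_of_preconnected_of_eventuallyEq (fn_an (algebraMap ℂ _ (fn h x0 / fn c x0) * c))
    hV hx0 (by
      filter_upwards [Metric.ball_mem_nhds x0 hε] with y hy
      obtain ⟨hyV, hne⟩ := hball y hy
      rw [fn_mul _ _ hyV, fn_alg _ hyV, ← hconst y hy, div_mul_cancel₀ _ hne])
  exact this hx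

end EV

def DVV (V : TopologicalSpace.Opens ℂ) : Derivation ℂ (EV V × EV V) (EV V × EV V) := Derivation.mk'
  { toFun := fun f => (EV.DV f.1, EV.DV f.2)
    map_add' := fun f g => by simp
    map_smul' := fun c f => by simp }
  (fun f g => by
    ext1 <;> simp)

/-- factor out zeros on a compact preconnected set -/
lemma factor_zeros {U : Set ℂ} (hU : IsCompact U) (hUc : IsPreconnected U) {f : ℂ → ℂ}
    (hf : AnalyticOnNhd ℂ f U) (hne : ∃ x ∈ U, f x ≠ 0) :
    ∃ (l : List ℂ) (g : ℂ → ℂ), (∀ y ∈ l, y ∈ U) ∧ AnalyticOnNhd ℂ g U ∧ (∀ x ∈ U, g x ≠ 0) ∧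
      ∀ x, f x = (l.map fun y => x - y).prod * g x := by
  classical
  have key : ∀ N : ℕ, ∀ (f : ℂ → ℂ) (Z : Finset ℂ), AnalyticOnNhd ℂ f U →
      (∀ z ∈ U, f z = 0 → z ∈ Z) → (∀ z ∈ Z, z ∈ U) → (∀ z ∈ U, analyticOrderAt f z ≠ ⊤) →
      ∑ z ∈ Z, analyticOrderNatAt f z = N →
      ∃ (l : List ℂ) (g : ℂ → ℂ), (∀ y ∈ l, y ∈ U) ∧ AnalyticOnNhd ℂ g U ∧ (∀ x ∈ U, g x ≠ 0) ∧
      ∀ x, f x = (l.map fun y => x - y).prod * g x := by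
    intro N
    induction N with
    | zero =>
      intro f Z hf hZ hZU hord hsum
      refine ⟨[], f, by simp, hf, fun x hx h0 => ?_, by simp⟩
      have h1 := (Finset.sum_eq_zero_iff.1 hsum) x (hZ x hx h0)
      have h2 : analyticOrderAt f x = 0 := by
        rw [← Nat.cast_analyticOrderNatAt (hord x hx), h1]; rfl
      rw [(hf x hx).analyticOrderAt_eq_zero] at h2
      exact h2 h0
    | succ N ih =>
      intro f Z hf hZ hZU hord hsum
      obtain ⟨z, hz, hz0⟩ : ∃ z ∈ Z, analyticOrderNatAt f z ≠ 0 := by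
        by_contra! hcon
        rw [Finset.sum_eq_zero hcon] at hsum; omega
      have hzU := hZU z hz
      have hfz : f z = 0 := by
        by_contra h0
        apply hz0
        have := (hf z hzU).analyticOrderAt_eq_zero.2 h0
        rw [analyticOrderNatAt, this]; rfl
      set g := dslope f z with hg
      have hfg : ∀ x, f x = (x - z) * g x := by
        intro x
        have := sub_smul_dslope f z x
        rw [hfz, sub_zero, smul_eq_mul] at this
        exact this.symm
      have hga : AnalyticOnNhd ℂ g U := by
        intro x hx
        by_cases hxz : x = z
        · subst hxz
          have := (hf x hx)
          obtain ⟨p, hp⟩ := this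
          exact ⟨_, hp.has_fpower_series_dslope_fslope⟩
        · have h1 : g =ᶠ[𝓝 x] fun y => (y - z)⁻¹ * f y := by
            filter_upwards [isOpen_ne.mem_nhds hxz] with y hy
            rw [hfg y, inv_mul_cancel_left₀ (sub_ne_zero.2 hy)]
          refine AnalyticAt.congr ?_ h1.symm
          exact ((analyticAt_id.sub analyticAt_const).inv (sub_ne_zero.2 hxz)).mul (hf x hx)
      have hmul : ∀ x ∈ U, analyticOrderAt f x = analyticOrderAt (fun y => y - z) x + analyticOrderAt g x := by
        intro x hx
        have : f = (fun y => y - z) * g := by funext y; exact hfg y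
        conv_lhs => rw [this]
        exact analyticOrderAt_mul (analyticAt_id.sub analyticAt_const) (hga x hx)
      have hgo : ∀ x ∈ U, analyticOrderAt g x ≠ ⊤ := by
        intro x hx htop
        apply hord x hx
        rw [hmul x hx, htop, add_top]
      have h1 : ∀ x ∈ U, analyticOrderNatAt f x = (if x = z then 1 else 0) + analyticOrderNatAt g x := by
        intro x hx
        have h2 := hmul x hx
        rw [← Nat.cast_analyticOrderNatAt (hord x hx), ← Nat.cast_analyticOrderNatAt (hgo x hx)] at h2
        split_ifs with hxz
        · subst hxz
          have : analyticOrderAt (fun y => y - x) x = 1 := by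
            have := (AnalyticAt.analyticOrderAt_eq_natCast (f := fun y => y - x) (z₀ := x) (n := 1)
              (analyticAt_id.sub analyticAt_const)).2 ⟨fun _ => 1, analyticAt_const, one_ne_zero, by simp⟩
            simpa using this
          rw [this] at h2
          exact_mod_cast h2
        · have : analyticOrderAt (fun y => y - z) x = 0 :=
            ((analyticAt_id.sub analyticAt_const).analyticOrderAt_eq_zero).2 (sub_ne_zero.2 hxz)
          rw [this] at h2
          exact_mod_cast h2
      obtain ⟨l, k, hl, hk, hk0, hlk⟩ := ih g Z hga (fun x hx h0 => hZ x hx (by rw [hfg, h0, mul_zero]))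
        hZU hgo (by
          have : ∑ z ∈ Z, analyticOrderNatAt f z = ∑ x ∈ Z, ((if x = z then 1 else 0) + analyticOrderNatAt g x) :=
            Finset.sum_congr rfl fun x hx => h1 x (hZU x hx)
          rw [hsum, Finset.sum_add_distrib] at this
          simp [hz] at this
          omega)
      refine ⟨z :: l, k, ?_, hk, hk0, fun x => ?_⟩
      · intro y hy
        rcases List.mem_cons.1 hy with rfl | hy
        · exact hzU
        · exact hl y hy
      · rw [hfg, hlk]; simp [mul_assoc]
  obtain ⟨x0, hx0, hfx0⟩ := hne
  have hord : ∀ z ∈ U, analyticOrderAt f z ≠ ⊤ := by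
    intro z hz htop
    rw [analyticOrderAt_eq_top] at htop
    exact hfx0 (hf.eqOn_zero_of_preconnected_of_eventuallyEq_zero hUc hz htop hx0)
  have hfin : (U ∩ {z | f z = 0}).Finite := by
    by_contra hinf
    obtain ⟨z, hz, hacc⟩ := (Set.Infinite.exists_accPt_of_subset_isCompact hinf hU Set.inter_subset_left)
    refine hfx0 (hf.eqOn_zero_of_preconnected_of_frequently_eq_zero hUc hz ?_ hx0)
    rw [accPt_iff_frequently_nhdsNE] at hacc
    exact hacc.mono fun y hy => hy.2
  exact key _ f hfin.toFinset hf (fun z hz h0 => by simp [hz, h0])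
    (fun z hz => by simp at hz; exact hz.1) hord rfl

end Ctr
end
end

section
open MeasureTheory Set Filter Topology
noncomputable section
namespace Ctr
set_option linter.unusedVariables false
open Polynomial

abbrev E2 (V : TopologicalSpace.Opens ℂ) := EV V × EV V

lemma DVV_fst {V : TopologicalSpace.Opens ℂ} (y : E2 V) : (DVV V y).1 = EV.DV y.1 := rfl
lemma DVV_snd {V : TopologicalSpace.Opens ℂ} (y : E2 V) : (DVV V y).2 = EV.DV y.2 := rfl

/-- restriction of an entire function -/
def Ent {V : TopologicalSpace.Opens ℂ} (f : EV V) : Prop :=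
  ∃ F : ℂ → ℂ, Differentiable ℂ F ∧ ∀ x ∈ V, EV.fn f x = F x

namespace Ent
variable {V : TopologicalSpace.Opens ℂ} {f g : EV V}
lemma add (hf : Ent f) (hg : Ent g) : Ent (f + g) := by
  obtain ⟨F, hF, h⟩ := hf; obtain ⟨G, hG, h'⟩ := hg
  exact ⟨fun x => F x + G x, hF.add hG, fun x hx => by rw [EV.fn_add _ _ hx, h x hx, h' x hx]⟩
lemma mul (hf : Ent f) (hg : Ent g) : Ent (f * g) := by
  obtain ⟨F, hF, h⟩ := hf; obtain ⟨G, hG, h'⟩ := hg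
  exact ⟨fun x => F x * G x, hF.mul hG, fun x hx => by rw [EV.fn_mul _ _ hx, h x hx, h' x hx]⟩
lemma alg (c : ℂ) : Ent (algebraMap ℂ (EV V) c) :=
  ⟨fun _ => c, differentiable_const c, fun x hx => EV.fn_alg c hx⟩
lemma smul (c : ℂ) (hf : Ent f) : Ent (c • f) := by
  rw [Algebra.smul_def]; exact (alg c).mul hf
lemma sub (hf : Ent f) (hg : Ent g) : Ent (f - g) := by
  have := hf.add (hg.smul (-1)); rw [neg_one_smul, ← sub_eq_add_neg] at this; exact this
lemma DV (hf : Ent f) : Ent (EV.DV f) := by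
  obtain ⟨F, hF, h⟩ := hf
  exact ⟨deriv F, hF.deriv, fun x hx => by rw [EV.fn_DV _ hx, EV.deriv_congr' h hx]⟩
lemma prim (hf : Ent f) : ∃ g : EV V, EV.DV g = f ∧ Ent g ∧ ∀ h : (0 : ℂ) ∈ V, EV.fn g 0 = 0 := by
  obtain ⟨F, hF, h⟩ := hf
  obtain ⟨G, hG0, hG⟩ := (hF.isExactOn_univ).with_val_at 0 0
  have hGd : Differentiable ℂ G := fun x => (hG x (mem_univ x)).differentiableAt
  refine ⟨EV.mk G hGd.differentiableOn, EV.ext' fun x hx => ?_, ⟨G, hGd, fun x hx => EV.fn_mk _ _ hx⟩,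
    fun h0 => by rw [EV.fn_mk _ _ h0, hG0]⟩
  rw [EV.fn_DV _ hx, EV.deriv_congr' (fun x hx => EV.fn_mk G _ hx) hx, h x hx, (hG x (mem_univ x)).deriv]
end Ent

/-- the ring of analytic functions of `b` -/
def Oh {V : TopologicalSpace.Opens ℂ} (b : E2 V) (r : ℝ) : Subalgebra ℂ (E2 V) where
  carrier := {y | ∃ g : ℂ → ℂ, AnalyticOnNhd ℂ g (Metric.closedBall 0 r) ∧
    ∀ x ∈ V, EV.fn y.1 x = g (EV.fn b.1 x) ∧ EV.fn y.2 x = g (EV.fn b.2 x)}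
  mul_mem' := by
    rintro y z ⟨g, hg, h⟩ ⟨k, hk, h'⟩
    exact ⟨fun x => g x * k x, hg.mul hk, fun x hx => by
      rw [Prod.fst_mul, Prod.snd_mul, EV.fn_mul _ _ hx, EV.fn_mul _ _ hx]
      simp [h x hx, h' x hx]⟩
  add_mem' := by
    rintro y z ⟨g, hg, h⟩ ⟨k, hk, h'⟩
    exact ⟨fun x => g x + k x, hg.add hk, fun x hx => by
      rw [Prod.fst_add, Prod.snd_add, EV.fn_add _ _ hx, EV.fn_add _ _ hx]
      simp [h x hx, h' x hx]⟩
  algebraMap_mem' := fun c => ⟨fun _ => c, analyticOnNhd_const, fun x hx =>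
    ⟨EV.fn_alg c hx, EV.fn_alg c hx⟩⟩

/-- adjoin the `α i` -/
def Ch {V : TopologicalSpace.Opens ℂ} {n : ℕ} (b : E2 V) (r : ℝ) (α : Fin n → E2 V) :
    Subalgebra ℂ (E2 V) :=
  (MvPolynomial.aeval (R := Oh b r) α : MvPolynomial (Fin n) (Oh b r) →ₐ[Oh b r] E2 V).range.restrictScalars ℂ

lemma mem_Ch {V : TopologicalSpace.Opens ℂ} {n : ℕ} {b : E2 V} {r : ℝ} {α : Fin n → E2 V} {y : E2 V} :
    y ∈ Ch b r α ↔ ∃ Q : MvPolynomial (Fin n) (Oh b r), MvPolynomial.aeval α Q = y := Iff.rfl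

/-- approximating by polynomials -/
lemma approx {g : ℂ → ℂ} {r r' : ℝ} (h0 : 0 ≤ r') (hr : r' < r)
    (hg : AnalyticOnNhd ℂ g (Metric.closedBall 0 r)) {ε : ℝ} (hε : 0 < ε) :
    ∃ p : ℂ[X], ∀ z : ℂ, ‖z‖ ≤ r' → ‖g z - p.eval z‖ < ε := by
  obtain ⟨m, hm1, hm2⟩ := exists_between hr
  lift r to NNReal using by linarith
  lift m to NNReal using by linarith
  have hp := (hg.differentiableOn).hasFPowerSeriesOnBall (R := r) (c := 0) (by
    have : (0:ℝ) < r := by linarith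
    exact_mod_cast this)
  have h := hp.tendstoUniformlyOn' (r' := m) (by
    rw [ENNReal.coe_lt_coe]; exact_mod_cast hm2)
  rw [Metric.tendstoUniformlyOn_iff] at h
  obtain ⟨N, hN⟩ := (h ε hε).exists
  refine ⟨∑ i ∈ Finset.range N, Polynomial.C ((cauchyPowerSeries g 0 r).coeff i) * X ^ i, fun z hz => ?_⟩
  have h1 := hN z (by simp only [Metric.mem_ball, dist_zero_right]; exact lt_of_le_of_lt hz hm1)
  rw [dist_eq_norm] at h1
  have h2 : (∑ i ∈ Finset.range N, Polynomial.C ((cauchyPowerSeries g 0 r).coeff i) * X ^ i).eval z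
      = (cauchyPowerSeries g 0 r).partialSum N (z - 0) := by
    rw [sub_zero, FormalMultilinearSeries.partialSum, eval_finsetSum]
    refine Finset.sum_congr rfl fun i _ => ?_
    rw [FormalMultilinearSeries.apply_eq_pow_smul_coeff, eval_mul, eval_C, eval_pow, eval_X,
      smul_eq_mul, mul_comm]
  rw [h2]; exact h1

/-- finiteness -/
lemma divList (r : ℝ) (l : List ℂ) (hl : ∀ y ∈ l, y ∈ Metric.closedBall (0:ℂ) r) : ∀ G : ℂ → ℂ,
    AnalyticOnNhd ℂ G (Metric.closedBall 0 r) →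
    ∃ (p : ℂ[X]) (G1 : ℂ → ℂ), p ∈ degreeLT ℂ l.length ∧ AnalyticOnNhd ℂ G1 (Metric.closedBall 0 r) ∧
      ∀ x, G x = p.eval x + (l.map fun y => x - y).prod * G1 x := by
  induction l with
  | nil => exact fun G hG => ⟨0, G, by simp, hG, by simp⟩
  | cons z l ih =>
    intro G hG
    have hz := hl z (by simp)
    have hdef : ∀ x, G x = G z + (x - z) * dslope G z x := by
      intro x
      have := sub_smul_dslope G z x
      rw [smul_eq_mul] at this
      rw [this]; ring
    have hga : AnalyticOnNhd ℂ (dslope G z) (Metric.closedBall 0 r) := by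
      intro x hx
      by_cases hxz : x = z
      · subst hxz
        obtain ⟨p, hp⟩ := hG x hx
        exact ⟨_, hp.has_fpower_series_dslope_fslope⟩
      · have h1 : dslope G z =ᶠ[𝓝 x] fun y => (y - z)⁻¹ * (G y - G z) := by
          filter_upwards [isOpen_ne.mem_nhds hxz] with y hy
          rw [hdef y, add_sub_cancel_left, inv_mul_cancel_left₀ (sub_ne_zero.2 hy)]
        refine AnalyticAt.congr ?_ h1.symm
        exact ((analyticAt_id.sub analyticAt_const).inv (sub_ne_zero.2 hxz)).mul
          ((hG x hx).sub analyticAt_const)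
    obtain ⟨p, G1, hp, hG1, h⟩ := ih (fun y hy => hl y (by simp [hy])) _ hga
    refine ⟨Polynomial.C (G z) + (X - Polynomial.C z) * p, G1, ?_, hG1, fun x => ?_⟩
    · rw [mem_degreeLT] at hp ⊢
      refine lt_of_le_of_lt (degree_add_le _ _) (max_lt ?_ ?_)
      · refine lt_of_le_of_lt degree_C_le ?_
        simp only [List.length_cons]; exact_mod_cast Nat.succ_pos _
      · by_cases hp0 : p = 0
        · simp only [hp0, mul_zero, degree_zero, List.length_cons]; exact WithBot.bot_lt_coe _
        · rw [degree_mul, degree_X_sub_C, degree_eq_natDegree hp0] at *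
          simp only [List.length_cons]
          have : p.natDegree < l.length := by exact_mod_cast hp
          rw [add_comm]
          exact_mod_cast Nat.succ_lt_succ this
    · rw [hdef x, h x]; simp; ring

lemma Oh_ext {V : TopologicalSpace.Opens ℂ} {b : E2 V} {r : ℝ} {y z : E2 V}
    (h : ∀ x ∈ V, EV.fn y.1 x = EV.fn z.1 x ∧ EV.fn y.2 x = EV.fn z.2 x) : y = z :=
  Prod.ext (EV.ext' fun x hx => (h x hx).1) (EV.ext' fun x hx => (h x hx).2)

lemma fn_aeval {V : TopologicalSpace.Opens ℂ} (f : EV V) (p : ℂ[X]) {x : ℂ} (hx : x ∈ V) :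
    EV.fn (aeval f p) x = p.eval (EV.fn f x) := by
  have h1 := Polynomial.aeval_algHom_apply (EV.ev x hx) f p
  have h2 : (EV.ev x hx) (aeval f p) = EV.fn (aeval f p) x := rfl
  rw [← h2, ← h1, Polynomial.coe_aeval_eq_eval]; rfl

lemma aeval_fst {V : TopologicalSpace.Opens ℂ} (b : E2 V) (p : ℂ[X]) : (aeval b p).1 = aeval b.1 p :=
  (Polynomial.aeval_algHom_apply (AlgHom.fst ℂ (EV V) (EV V)) b p).symm
lemma aeval_snd {V : TopologicalSpace.Opens ℂ} (b : E2 V) (p : ℂ[X]) : (aeval b p).2 = aeval b.2 p :=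
  (Polynomial.aeval_algHom_apply (AlgHom.snd ℂ (EV V) (EV V)) b p).symm

def BB {V : TopologicalSpace.Opens ℂ} (b : E2 V) (r : ℝ) : Prop :=
  ∀ x ∈ V, ‖EV.fn b.1 x‖ ≤ r ∧ ‖EV.fn b.2 x‖ ≤ r

def Omk {V : TopologicalSpace.Opens ℂ} {b : E2 V} {r : ℝ} (hb : BB b r) (g : ℂ → ℂ)
    (hg : AnalyticOnNhd ℂ g (Metric.closedBall 0 r)) : E2 V :=
  (EV.mk (g ∘ EV.fn b.1) (hg.differentiableOn.comp (EV.fn_diff b.1) fun x hx => by simpa using (hb x hx).1),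
   EV.mk (g ∘ EV.fn b.2) (hg.differentiableOn.comp (EV.fn_diff b.2) fun x hx => by simpa using (hb x hx).2))

lemma Omk_fst {V : TopologicalSpace.Opens ℂ} {b : E2 V} {r : ℝ} (hb : BB b r) (g : ℂ → ℂ)
    (hg : AnalyticOnNhd ℂ g (Metric.closedBall 0 r)) {x : ℂ} (hx : x ∈ V) :
    EV.fn (Omk hb g hg).1 x = g (EV.fn b.1 x) := by
  unfold Omk; exact EV.fn_mk (g ∘ EV.fn b.1) (hg.differentiableOn.comp (EV.fn_diff b.1) fun x hx => by simpa using (hb x hx).1) hx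
lemma Omk_snd {V : TopologicalSpace.Opens ℂ} {b : E2 V} {r : ℝ} (hb : BB b r) (g : ℂ → ℂ)
    (hg : AnalyticOnNhd ℂ g (Metric.closedBall 0 r)) {x : ℂ} (hx : x ∈ V) :
    EV.fn (Omk hb g hg).2 x = g (EV.fn b.2 x) := by
  unfold Omk; exact EV.fn_mk (g ∘ EV.fn b.2) (hg.differentiableOn.comp (EV.fn_diff b.2) fun x hx => by simpa using (hb x hx).2) hx
lemma Omk_mem {V : TopologicalSpace.Opens ℂ} {b : E2 V} {r : ℝ} (hb : BB b r) (g : ℂ → ℂ)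
    (hg : AnalyticOnNhd ℂ g (Metric.closedBall 0 r)) : Omk hb g hg ∈ Oh b r :=
  ⟨g, hg, fun x hx => ⟨Omk_fst hb g hg hx, Omk_snd hb g hg hx⟩⟩

lemma finO {V : TopologicalSpace.Opens ℂ} {b : E2 V} {r : ℝ}
    (hb : BB b r) : FinO (Oh b r) := by
  rintro s ⟨g, hg, hs⟩ hs0
  have hmem : ∀ x ∈ V, EV.fn b.1 x ∈ Metric.closedBall (0:ℂ) r ∧ EV.fn b.2 x ∈ Metric.closedBall (0:ℂ) r := by
    intro x hx; simpa using hb x hx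
  have hne : ∃ x ∈ Metric.closedBall (0:ℂ) r, g x ≠ 0 := by
    by_contra! hcon
    apply hs0
    refine Oh_ext (b := b) (r := r) fun x hx => ?_
    rw [(hs x hx).1, (hs x hx).2, hcon _ (hmem x hx).1, hcon _ (hmem x hx).2]
    exact ⟨(EV.fn_zero hx).symm, (EV.fn_zero hx).symm⟩
  obtain ⟨l, k, hl, hk, hk0, hlk⟩ := factor_zeros (isCompact_closedBall 0 r)
    (convex_closedBall (0:ℂ) r).isPreconnected hg hne
  refine ⟨(degreeLT ℂ l.length).map (aeval b : ℂ[X] →ₐ[ℂ] E2 V).toLinearMap, ?_, ?_⟩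
  · have : FiniteDimensional ℂ (degreeLT ℂ l.length) :=
      LinearEquiv.finiteDimensional (degreeLTEquiv ℂ l.length).symm
    infer_instance
  · rintro y ⟨G, hG, hy⟩
    obtain ⟨p, G1, hp, hG1, hpG⟩ := divList r l hl G hG
    have han : AnalyticOnNhd ℂ (fun x => G1 x * (k x)⁻¹) (Metric.closedBall 0 r) := hG1.mul (hk.inv hk0)
    refine ⟨aeval b p, ⟨p, hp, rfl⟩, Omk hb _ han, Omk_mem hb _ han, ?_⟩
    refine Oh_ext (b := b) (r := r) fun x hx => ?_
    have k1 := hk0 _ (hmem x hx).1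
    have k2 := hk0 _ (hmem x hx).2
    simp only [Prod.fst_add, Prod.snd_add, Prod.fst_mul, Prod.snd_mul, EV.fn_add _ _ hx, EV.fn_mul _ _ hx,
      Omk_fst hb _ han hx, Omk_snd hb _ han hx, aeval_fst, aeval_snd, fn_aeval _ _ hx, (hy x hx).1, (hy x hx).2, (hs x hx).1,
      (hs x hx).2]
    rw [hpG, hpG (EV.fn b.2 x), hlk, hlk (EV.fn b.2 x)]
    constructor <;> field_simp
  
end Ctr
end
end

section
open MeasureTheory Set Filter Topology
noncomputable section
namespace Ctr
set_option linter.unusedVariables false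
open Polynomial

/-- every entire function is integral over functions of `b` -/
def IntF (V : Set ℂ) (b : ℂ → ℂ) (r : ℝ) : Prop :=
  ∀ F : ℂ → ℂ, Differentiable ℂ F → ∃ (N : ℕ) (χ : ℕ → ℂ → ℂ),
    (∀ k, AnalyticOnNhd ℂ (χ k) (Metric.closedBall 0 r)) ∧
    ∀ x ∈ V, F x ^ N + ∑ k ∈ Finset.range N, χ k (b x) * F x ^ k = 0

/-- algebraicity -/
def AlgF (V : Set ℂ) (b : ℂ → ℂ) (r : ℝ) (F : ℂ → ℂ) : Prop :=
  ∃ (N : ℕ) (χ : ℕ → ℂ → ℂ), (∀ k, AnalyticOnNhd ℂ (χ k) (Metric.closedBall 0 r)) ∧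
    (∃ k < N, ∃ x ∈ V, χ k (b x) ≠ 0) ∧
    ∀ x ∈ V, ∑ k ∈ Finset.range N, χ k (b x) * F x ^ k = 0

structure PD {n : ℕ} {V : TopologicalSpace.Opens ℂ} (T : ℝ) (α : Fin n → E2 V) (b : E2 V) (r : ℝ) : Prop where
  hT : 0 ≤ T
  conn : IsPreconnected (V : Set ℂ)
  mem : ∀ x ∈ Icc (0:ℝ) T, (x : ℂ) ∈ V
  hr : ∃ r', 0 ≤ r' ∧ r' < r ∧ BB b r'
  hb : ∃ ξ : Fin n → ℂ, b = ∑ i, ξ i • α i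
  nc : EV.DV b.1 ≠ 0
  ent : ∀ i, Ent (α i).1 ∧ Ent (α i).2
  int1 : IntF V (EV.fn b.1) r

variable {n : ℕ} {V : TopologicalSpace.Opens ℂ} {T : ℝ} {α : Fin n → E2 V} {b : E2 V} {r : ℝ}

lemma cont_fn (hm : ∀ x ∈ Icc (0:ℝ) T, (x : ℂ) ∈ V) (f : EV V) :
    ContinuousOn (fun x : ℝ => EV.fn f x) (Icc 0 T) :=
  (EV.fn_diff f).continuousOn.comp Complex.continuous_ofReal.continuousOn (fun x hx => hm x hx)

lemma ii_fn (hT : 0 ≤ T) (hm : ∀ x ∈ Icc (0:ℝ) T, (x : ℂ) ∈ V) (f : EV V) :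
    IntervalIntegrable (fun x : ℝ => EV.fn f x) volume 0 T := by
  apply ContinuousOn.intervalIntegrable
  rw [uIcc_of_le hT]; exact cont_fn hm f

lemma int_congr (hT : 0 ≤ T) {f g : ℝ → ℂ} (h : ∀ x ∈ Icc (0:ℝ) T, f x = g x) :
    ∫ x in (0:ℝ)..T, f x = ∫ x in (0:ℝ)..T, g x :=
  intervalIntegral.integral_congr (by rw [uIcc_of_le hT]; exact h)

def Lam1 (hT : 0 ≤ T) (hm : ∀ x ∈ Icc (0:ℝ) T, (x : ℂ) ∈ V) : EV V →ₗ[ℂ] ℂ where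
  toFun f := ∫ x in (0:ℝ)..T, EV.fn f x
  map_add' f g := by
    rw [← intervalIntegral.integral_add (ii_fn hT hm f) (ii_fn hT hm g)]
    exact int_congr hT fun x hx => EV.fn_add f g (hm x hx)
  map_smul' c f := by
    rw [RingHom.id_apply, smul_eq_mul, ← intervalIntegral.integral_const_mul]
    exact int_congr hT fun x hx => EV.fn_smul c f (hm x hx)

lemma Lam1_D (hT : 0 ≤ T) (hm : ∀ x ∈ Icc (0:ℝ) T, (x : ℂ) ∈ V) (f : EV V) :
    Lam1 hT hm (EV.DV f) = EV.fn f T - EV.fn f 0 := by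
  have h := intervalIntegral.integral_eq_sub_of_hasDerivAt (a := 0) (b := T)
    (f := fun x : ℝ => EV.fn f x) (f' := fun x : ℝ => EV.fn (EV.DV f) x) (fun x hx => by
      rw [uIcc_of_le hT] at hx
      rw [EV.fn_DV f (hm x hx)]
      exact (EV.dAt f (hm x hx)).hasDerivAt.comp_ofReal) (ii_fn hT hm _)
  simp only [Complex.ofReal_zero] at h
  exact h

def Lam (hT : 0 ≤ T) (hm : ∀ x ∈ Icc (0:ℝ) T, (x : ℂ) ∈ V) (σ τ : ℂ) : E2 V →ₗ[ℂ] ℂ :=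
  σ • (Lam1 hT hm).comp (LinearMap.fst ℂ _ _) + τ • (Lam1 hT hm).comp (LinearMap.snd ℂ _ _)

lemma Lam_apply (hT : 0 ≤ T) (hm : ∀ x ∈ Icc (0:ℝ) T, (x : ℂ) ∈ V) (σ τ : ℂ) (y : E2 V) :
    Lam hT hm σ τ y = σ * Lam1 hT hm y.1 + τ * Lam1 hT hm y.2 := rfl

lemma Lam1_bound (hT : 0 ≤ T) (hm : ∀ x ∈ Icc (0:ℝ) T, (x : ℂ) ∈ V) (f : EV V) :
    ∃ C : ℝ, 0 ≤ C ∧ ∀ g : EV V, ∀ ε : ℝ, 0 ≤ ε → (∀ x ∈ Icc (0:ℝ) T, ‖EV.fn g x‖ ≤ ε) →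
      ‖Lam1 hT hm (g * f)‖ ≤ ε * C := by
  obtain ⟨M, hM⟩ := (isCompact_Icc (a := (0:ℝ)) (b := T)).exists_bound_of_continuousOn (cont_fn hm f)
  have hM0 : 0 ≤ M := (norm_nonneg _).trans (hM 0 ⟨le_rfl, hT⟩)
  refine ⟨M * T, by positivity, fun g ε hε hg => ?_⟩
  have := intervalIntegral.norm_integral_le_of_norm_le_const (a := 0) (b := T)
    (f := fun x : ℝ => EV.fn (g * f) x) (C := ε * M) (fun x hx => by
      rw [uIoc_of_le hT] at hx
      have hx' : x ∈ Icc (0:ℝ) T := ⟨hx.1.le, hx.2⟩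
      rw [EV.fn_mul _ _ (hm x hx'), norm_mul]
      exact mul_le_mul (hg x hx') (hM x hx') (norm_nonneg _) hε)
  rw [sub_zero, abs_of_nonneg hT] at this
  calc ‖Lam1 hT hm (g * f)‖ ≤ ε * M * T := this
    _ = ε * (M * T) := by ring

namespace PD

lemma BBr (h : PD T α b r) : BB b r := by
  obtain ⟨r', h0, h1, h2⟩ := h.hr
  exact fun x hx => ⟨(h2 x hx).1.trans h1.le, (h2 x hx).2.trans h1.le⟩

lemma O_le_C : Oh b r ≤ Ch b r α := fun y hy => mem_Ch.2 ⟨MvPolynomial.C ⟨y, hy⟩, by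
  rw [MvPolynomial.aeval_C]; rfl⟩
lemma b_mem : b ∈ Oh b r := ⟨fun x => x, analyticOnNhd_id, fun x hx => ⟨rfl, rfl⟩⟩
lemma α_mem (i : Fin n) : α i ∈ Ch b r α := mem_Ch.2 ⟨MvPolynomial.X i, by simp⟩

lemma aevalC_mem (P : MvPolynomial (Fin n) ℂ) : MvPolynomial.aeval α P ∈ Ch b r α := by
  induction P using MvPolynomial.induction_on with
  | C a => rw [MvPolynomial.aeval_C]; exact (Ch b r α).algebraMap_mem a
  | add p q hp hq => rw [map_add]; exact (Ch b r α).add_mem hp hq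
  | mul_X p i hp => rw [map_mul, MvPolynomial.aeval_X]; exact (Ch b r α).mul_mem hp (α_mem i)

/-- moments vanish on all of C -/
lemma hLam (h : PD T α b r) (σ τ : ℂ)
    (hmom : ∀ (P : MvPolynomial (Fin n) ℂ) (i : Fin n),
      Lam h.hT h.mem σ τ (MvPolynomial.aeval α P * DVV V (α i)) = 0) :
    ∀ c ∈ Ch b r α, ∀ i, Lam h.hT h.mem σ τ (c * DVV V (α i)) = 0 := by
  have key : ∀ Q : MvPolynomial (Fin n) (Oh b r), ∀ (P : MvPolynomial (Fin n) ℂ) (i : Fin n),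
      Lam h.hT h.mem σ τ (MvPolynomial.aeval α Q * MvPolynomial.aeval α P * DVV V (α i)) = 0 := by
    intro Q
    induction Q using MvPolynomial.induction_on with
    | C a =>
      intro P i
      obtain ⟨⟨a, ⟨g, hg, hga⟩⟩⟩ : ∃ x : Oh b r, x = a := ⟨a, rfl⟩
      subst_vars
      rw [MvPolynomial.aeval_C]
      change Lam h.hT h.mem σ τ (a * _ * _) = 0
      obtain ⟨r', hr0, hr', hBB⟩ := h.hr
      set y := MvPolynomial.aeval α P * DVV V (α i) with hy
      obtain ⟨C1, hC1, hb1⟩ := Lam1_bound h.hT h.mem y.1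
      obtain ⟨C2, hC2, hb2⟩ := Lam1_bound h.hT h.mem y.2
      have hbd : ∀ ε > (0:ℝ), ‖Lam h.hT h.mem σ τ (a * y)‖ ≤ (‖σ‖ * C1 + ‖τ‖ * C2) * ε := by
        intro ε hε
        obtain ⟨p, hp⟩ := approx hr0 hr' hg hε
        obtain ⟨ξ, hξ⟩ := h.hb
        have h1 : Lam h.hT h.mem σ τ (aeval b p * y) = 0 := by
          have : aeval b p = MvPolynomial.aeval α (aeval (∑ i, ξ i • (MvPolynomial.X i : MvPolynomial (Fin n) ℂ)) p) := by
            rw [← Polynomial.aeval_algHom_apply, map_sum]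
            congr 1
            rw [hξ]; congr 2; funext i; simp
          rw [hy, this, ← mul_assoc, ← map_mul]
          exact hmom _ _
        have h2 : Lam h.hT h.mem σ τ (a * y) = Lam h.hT h.mem σ τ ((a - aeval b p) * y) := by
          rw [sub_mul, map_sub, h1, sub_zero]
        rw [h2, Lam_apply, Prod.fst_mul, Prod.snd_mul]
        have e1 := hb1 (a - aeval b p).1 ε hε.le (fun x hx => by
          have hxV := h.mem x hx
          rw [Prod.fst_sub, EV.fn_sub _ _ hxV, aeval_fst, fn_aeval _ _ hxV, (hga _ hxV).1]
          exact (hp _ (hBB _ hxV).1).le)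
        have e2 := hb2 (a - aeval b p).2 ε hε.le (fun x hx => by
          have hxV := h.mem x hx
          rw [Prod.snd_sub, EV.fn_sub _ _ hxV, aeval_snd, fn_aeval _ _ hxV, (hga _ hxV).2]
          exact (hp _ (hBB _ hxV).2).le)
        refine (norm_add_le _ _).trans ?_
        rw [norm_mul, norm_mul]
        have := mul_le_mul_of_nonneg_left e1 (norm_nonneg σ)
        have := mul_le_mul_of_nonneg_left e2 (norm_nonneg τ)
        nlinarith
      rw [mul_assoc, ← norm_le_zero_iff]
      refine le_of_forall_pos_le_add fun δ hδ => ?_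
      have hK : 0 ≤ ‖σ‖ * C1 + ‖τ‖ * C2 := by positivity
      have := hbd (δ / (‖σ‖ * C1 + ‖τ‖ * C2 + 1)) (by positivity)
      refine this.trans ?_
      rw [zero_add, mul_div_assoc', div_le_iff₀ (by positivity)]
      nlinarith
    | add p q hp hq =>
      intro P i
      rw [map_add, add_mul, add_mul, map_add, hp, hq, add_zero]
    | mul_X p j hp =>
      intro P i
      have := hp (MvPolynomial.X j * P) i
      rw [map_mul (MvPolynomial.aeval α), MvPolynomial.aeval_X] at this
      rw [map_mul (MvPolynomial.aeval α), MvPolynomial.aeval_X, ← this]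
      congr 1; ring
  intro c hc i
  obtain ⟨Q, rfl⟩ := mem_Ch.1 hc
  have := key Q 1 i
  rwa [map_one, mul_one] at this

lemma D_b (h : PD T α b r) : ∃ ξ : Fin n → ℂ, DVV V b = ∑ i, ξ i • DVV V (α i) := by
  obtain ⟨ξ, hξ⟩ := h.hb
  exact ⟨ξ, by rw [hξ, map_sum]; exact Finset.sum_congr rfl fun i _ => (DVV V).map_smul _ _⟩

lemma hLam_b (h : PD T α b r) (Λ : E2 V →ₗ[ℂ] ℂ) (z : E2 V)
    (hl : ∀ i, Λ (z * DVV V (α i)) = 0) : Λ (z * DVV V b) = 0 := by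
  obtain ⟨ξ, hξ⟩ := h.D_b
  rw [hξ, Finset.mul_sum, map_sum]
  refine Finset.sum_eq_zero fun i _ => ?_
  rw [mul_smul_comm, map_smul, hl, smul_zero]

/-- integrality relation for the first coordinate -/
lemma intP (h : PD T α b r) (y : E2 V) (hy : Ent y.1) :
    ∃ P : (Oh b r)[X], P.Monic ∧ (aeval y P).1 = 0 := by
  obtain ⟨F, hF, hFy⟩ := hy
  obtain ⟨N, χ, hχ, hrel⟩ := h.int1 F hF
  let o : ℕ → Oh b r := fun k => ⟨Omk h.BBr (χ k) (hχ k), Omk_mem h.BBr (χ k) (hχ k)⟩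
  refine ⟨X ^ N + ∑ k : Fin N, Polynomial.C (o k) * X ^ (k : ℕ), ?_, ?_⟩
  · refine monic_X_pow_add (degree_sum_fin_lt _)
  · refine EV.ext' fun x hx => ?_
    have e : (aeval y (X ^ N + ∑ k : Fin N, Polynomial.C (o k) * X ^ (k : ℕ))).1
        = y.1 ^ N + ∑ k ∈ Finset.range N, (o k).1.1 * y.1 ^ k := by
      rw [aeval_def, eval₂_add, eval₂_X_pow, eval₂_finsetSum, Prod.fst_add, Prod.pow_fst, Prod.fst_sum,
        ← Fin.sum_univ_eq_sum_range (fun k => (o k).1.1 * y.1 ^ k)]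
      congr 1
      refine Finset.sum_congr rfl fun k _ => ?_
      rw [eval₂_mul, eval₂_C, eval₂_X_pow]; rfl
    rw [e, EV.fn_zero hx]
    have := hrel x hx
    rw [← hFy x hx] at this
    rw [← this]
    change (EV.ev x hx) _ = _
    rw [map_add, map_pow, map_sum]
    congr 1
    refine Finset.sum_congr rfl fun k _ => ?_
    rw [map_mul, map_pow]
    change EV.fn (Omk h.BBr (χ k) (hχ k)).1 x * _ = _
    rw [Omk_fst h.BBr (χ k) (hχ k) hx]; rfl

lemma C_int (h : PD T α b r) (inj : ∀ c ∈ Ch b r α, c.1 = 0 → c = 0) {c : E2 V} (hc : c ∈ Ch b r α) :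
    IsIntegral (Oh b r) c := by
  have hα : ∀ i, IsIntegral (Oh b r) (α i) := by
    intro i
    obtain ⟨P, hP, hP0⟩ := h.intP (α i) (h.ent i).1
    refine ⟨P, hP, ?_⟩
    change aeval (α i) P = 0
    refine inj _ (mem_Ch.2 ⟨aeval (MvPolynomial.X i) P, ?_⟩) hP0
    rw [← Polynomial.aeval_algHom_apply, MvPolynomial.aeval_X]
  obtain ⟨Q, rfl⟩ := mem_Ch.1 hc
  clear hc
  induction Q using MvPolynomial.induction_on with
  | C a => rw [MvPolynomial.aeval_C]; exact isIntegral_algebraMap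
  | add p q hp hq => rw [map_add]; exact hp.add hq
  | mul_X p i hp => rw [map_mul, MvPolynomial.aeval_X]; exact hp.mul (hα i)

end PD
end Ctr
end
end

section
open MeasureTheory Set Filter Topology
noncomputable section
namespace Ctr
set_option linter.unusedVariables false
open Polynomial

variable {n : ℕ} {V : TopologicalSpace.Opens ℂ} {T : ℝ} {α : Fin n → E2 V} {b : E2 V} {r : ℝ}

namespace PD
lemma dom (h : PD T α b r) : IsDomain (EV V) :=
  EV.isDomain h.conn (0:ℝ) (h.mem 0 ⟨le_rfl, h.hT⟩)

def Inj (b : E2 V) (r : ℝ) (α : Fin n → E2 V) : Prop :=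
  (∀ c ∈ Ch b r α, c.1 = 0 → c = 0) ∧ (∀ c ∈ Ch b r α, c.2 = 0 → c = 0)

lemma polyA (P : (Oh b r)[X]) (y : E2 V) : (∀ i, (P.map (algebraMap (Oh b r) (E2 V))).coeff i ∈ Oh b r) ∧
    (P.map (algebraMap (Oh b r) (E2 V))).eval y = aeval y P :=
  ⟨fun i => by rw [coeff_map]; exact (P.coeff i).2, by rw [eval_map, aeval_def]⟩

lemma setup (h : PD T α b r) (hi : Inj b r α) :
    @ASetup (E2 V) (EV V) _ _ _ h.dom _ (DVV V) (AlgHom.fst ℂ (EV V) (EV V)) (Oh b r) (Ch b r α) b := by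
  have := h.dom
  have hne : ∀ c ∈ Ch b r α, c ≠ 0 → c.1 ≠ 0 ∧ c.2 ≠ 0 := fun c hc h0 =>
    ⟨fun h1 => h0 (hi.1 c hc h1), fun h1 => h0 (hi.2 c hc h1)⟩
  have hb2 : EV.DV b.2 ≠ 0 := by
    intro h0
    obtain ⟨c, hc⟩ := EV.const_of_DV h.conn _ h0
    have h1 : b - algebraMap ℂ (E2 V) c = 0 := by
      refine hi.2 _ ((Ch b r α).sub_mem (O_le_C b_mem) ((Ch b r α).algebraMap_mem c)) ?_
      rw [Prod.snd_sub, hc]; exact sub_self _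
    have h2 : b.1 = algebraMap ℂ _ c := congrArg Prod.fst (sub_eq_zero.1 h1)
    apply h.nc
    rw [h2]; exact EV.DV.map_algebraMap c
  refine ⟨O_le_C, b_mem, ?_, fun c hc h1 => hi.1 c hc h1, ?_, ?_, ?_, h.nc, ?_, ?_⟩
  · rintro g ⟨G, hG, hg⟩
    refine ⟨Omk h.BBr (deriv G) hG.deriv, Omk_mem _ _ _, Oh_ext (b := b) (r := r) fun x hx => ?_⟩
    have key : ∀ (f1 f2 : EV V), (∀ x ∈ V, EV.fn f1 x = G (EV.fn f2 x)) → ‖EV.fn f2 x‖ ≤ r →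
        EV.fn (EV.DV f1) x = deriv G (EV.fn f2 x) * EV.fn (EV.DV f2) x := by
      intro f1 f2 hf hr
      rw [EV.fn_DV _ hx, EV.fn_DV _ hx, EV.deriv_congr' hf hx]
      exact deriv_comp x (hG _ (by simpa using hr)).differentiableAt (EV.dAt f2 hx)
    rw [Prod.fst_mul, Prod.snd_mul, DVV_fst, DVV_snd, EV.fn_mul _ _ hx, EV.fn_mul _ _ hx,
      Omk_fst _ _ _ hx, Omk_snd _ _ _ hx, DVV_fst, DVV_snd]
    exact ⟨key _ _ (fun x hx => (hg x hx).1) (h.BBr x hx).1, key _ _ (fun x hx => (hg x hx).2) (h.BBr x hx).2⟩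
  · intro c hc h0 y hy
    have h1 := congrArg Prod.fst hy
    have h2 := congrArg Prod.snd hy
    exact Prod.ext ((mul_eq_zero.1 h1).resolve_left (hne c hc h0).1)
      ((mul_eq_zero.1 h2).resolve_left (hne c hc h0).2)
  · intro y hy
    have h1 := congrArg Prod.fst hy
    have h2 := congrArg Prod.snd hy
    exact Prod.ext ((mul_eq_zero.1 h1).resolve_left h.nc) ((mul_eq_zero.1 h2).resolve_left hb2)
  · intro y hy
    change EV.DV y.1 = 0
    rw [show y.1 = 0 from hy, map_zero]
  · intro c hc
    obtain ⟨P, hP, hP0⟩ := h.C_int hi.1 hc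
    exact ⟨P.map (algebraMap _ _), (hP.map _).ne_zero, (polyA P c).1, by rw [(polyA P c).2]; exact hP0⟩
  · intro c hc h0 y hy
    have h1 := congrArg Prod.fst hy
    have h2 := congrArg Prod.snd hy
    obtain ⟨k1, hk1⟩ := EV.wron h.conn c.1 y.1 (hne c hc h0).1 h1
    obtain ⟨k2, hk2⟩ := EV.wron h.conn c.2 y.2 (hne c hc h0).2 h2
    refine ⟨(algebraMap ℂ _ k1, algebraMap ℂ _ k2), ?_, Prod.ext hk1 hk2⟩
    exact Prod.ext (EV.DV.map_algebraMap k1) (EV.DV.map_algebraMap k2)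

lemma endp (h : PD T α b r) (hi : Inj b r α) (σ τ : ℂ) {s0 : E2 V} (hs0 : s0 ∈ Oh b r) (hs00 : s0 ≠ 0)
    (hΛ : ∀ c ∈ Ch b r α, ∀ i, Lam h.hT h.mem σ τ (s0 * c * DVV V (α i)) = 0)
    {w : E2 V} (hw : RR (Oh b r) (Ch b r α) w) (hwe : Ent w.1) (S : ℂ → ℂ) (y0 : ℂ)
    (hS1 : S y0 = 1) (hS0 : ∀ y, y ≠ y0 → S y = 0) :
    σ * (S (EV.fn w.1 T) - S (EV.fn w.1 0)) + τ * (S (EV.fn w.2 T) - S (EV.fn w.2 0)) = 0 := by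
  classical
  have := h.dom
  obtain ⟨P, hP, hP0⟩ := h.intP w hwe
  obtain ⟨Q, hQ, hQr⟩ := (h.setup hi).closed (finO h.BBr) (Lam h.hT h.mem σ τ) hs0 hs00
    (fun c hc => h.hLam_b _ _ (hΛ c hc)) hw
    ⟨P.map (algebraMap _ _), hP.map _, (polyA P w).1, by rw [(polyA P w).2]; exact hP0⟩
  obtain ⟨S', ⟨R, hR⟩, hS1', hS0'⟩ := exists_indicator Q hQ {EV.fn w.1 T, EV.fn w.1 0, EV.fn w.2 T, EV.fn w.2 0} y0
  have h1 := hQr R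
  rw [← hR, ← smul_eq_mul, ← Derivation.map_aeval, Lam_apply, DVV_fst, DVV_snd, Lam1_D, Lam1_D,
    aeval_fst, aeval_snd] at h1
  have mT := h.mem T ⟨h.hT, le_rfl⟩
  have m0 := h.mem 0 ⟨le_rfl, h.hT⟩
  rw [Complex.ofReal_zero] at m0
  rw [fn_aeval _ _ mT, fn_aeval _ _ mT, fn_aeval _ _ m0, fn_aeval _ _ m0] at h1
  have e : ∀ y ∈ ({EV.fn w.1 T, EV.fn w.1 0, EV.fn w.2 T, EV.fn w.2 0} : Finset ℂ), S'.eval y = S y := by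
    intro y hy
    by_cases hyy : y = y0
    · rw [hyy, hS1', hS1]
    · rw [hS0' y hy hyy, hS0 y hyy]
  rw [e _ (by simp), e _ (by simp), e _ (by simp), e _ (by simp)] at h1
  exact h1

lemma closed1 (h : PD T α b r) (hi : Inj b r α) {s0 : E2 V} (hs0 : s0 ∈ Oh b r) (hs00 : s0 ≠ 0)
    (hΛ : ∀ c ∈ Ch b r α, ∀ i, Lam h.hT h.mem 1 0 (s0 * c * DVV V (α i)) = 0)
    {w : E2 V} (hw : RR (Oh b r) (Ch b r α) w) (hwe : Ent w.1) : EV.fn w.1 T = EV.fn w.1 0 := by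
  classical
  by_contra hne
  have := h.endp hi 1 0 hs0 hs00 hΛ hw hwe (fun y => if y = EV.fn w.1 T then 1 else 0) (EV.fn w.1 T)
    (by simp) (by intro y hy; simp [hy])
  simp [Ne.symm hne] at this

lemma closed2 (h : PD T α b r) (hi : Inj b r α)
    (hΛ : ∀ c ∈ Ch b r α, ∀ i, Lam h.hT h.mem 1 (-1) (c * DVV V (α i)) = 0)
    {w : E2 V} (hw : RR (Oh b r) (Ch b r α) w) (hwe : Ent w.1) :
    (EV.fn w.1 T = EV.fn w.1 0 ∧ EV.fn w.2 T = EV.fn w.2 0) ∨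
    (EV.fn w.1 T = EV.fn w.2 T ∧ EV.fn w.1 0 = EV.fn w.2 0) := by
  classical
  have := h.dom
  have key := fun y0 => h.endp hi 1 (-1) (Oh b r).one_mem one_ne_zero (by simpa using hΛ) hw hwe
    (fun y => if y = y0 then 1 else 0) y0 (by simp) (by intro y hy; simp [hy])
  have k1 := key (EV.fn w.1 T)
  have k2 := key (EV.fn w.1 0)
  have k3 := key (EV.fn w.2 T)
  have k4 := key (EV.fn w.2 0)
  generalize EV.fn w.1 T = a1 at *
  generalize EV.fn w.1 0 = a2 at *
  generalize EV.fn w.2 T = a3 at *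
  generalize EV.fn w.2 0 = a4 at *
  by_cases h12 : a1 = a2
  · subst h12
    left
    refine ⟨rfl, ?_⟩
    by_contra h34
    simp [Ne.symm h34] at k3
  · right
    simp only [if_true, h12, Ne.symm h12, if_false, sub_zero] at k1 k2
    constructor
    · by_contra h13
      rw [if_neg (Ne.symm h13)] at k1
      split_ifs at k1 <;> norm_num at k1
    · by_contra h24
      rw [if_neg (Ne.symm h24)] at k2
      split_ifs at k2 <;> norm_num at k2

end PD

/-- iterated primitives -/
structure Words (α : Fin n → E2 V) (u : List (Fin n) → E2 V) : Prop where
  nil : u [] = 1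
  cons : ∀ i l, DVV V (u (i :: l)) = DVV V (α i) * u l
  z1 : ∀ i l, EV.fn (u (i :: l)).1 0 = 0
  z2 : ∀ i l, EV.fn (u (i :: l)).2 0 = 0
  ent : ∀ l, Ent (u l).1 ∧ Ent (u l).2

lemma const2 (hc : IsPreconnected (V : Set ℂ)) {κ : E2 V} (h : DVV V κ = 0) :
    ∃ k1 k2 : ℂ, κ = (algebraMap ℂ _ k1, algebraMap ℂ _ k2) := by
  obtain ⟨k1, h1⟩ := EV.const_of_DV hc κ.1 (congrArg Prod.fst h)
  obtain ⟨k2, h2⟩ := EV.const_of_DV hc κ.2 (congrArg Prod.snd h)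
  exact ⟨k1, k2, Prod.ext h1 h2⟩

lemma lemB' (h : PD T α b r) (hi : PD.Inj b r α) {u : E2 V} (hu : XX (DVV V) (Oh b r) (Ch b r α) b (DVV V u))
    (he : Ent u.1) : ∃ k1 k2 : ℂ, RR (Oh b r) (Ch b r α) (u - (algebraMap ℂ _ k1, algebraMap ℂ _ k2)) := by
  have := h.dom
  obtain ⟨P, hP, hP0⟩ := h.intP u he
  obtain ⟨κ, hκ, hR⟩ := (h.setup hi).lemB hu ⟨P.map (algebraMap _ _), (hP.map _).ne_zero,
    fun i => PD.O_le_C ((PD.polyA P u).1 i), by rw [(PD.polyA P u).2]; exact hP0⟩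
  obtain ⟨k1, k2, rfl⟩ := const2 h.conn hκ
  exact ⟨k1, k2, hR⟩

theorem single (h : PD T α b r) (hd : ∀ i, (α i).1 = (α i).2) (hbd : b.1 = b.2)
    {s0 : E2 V} (hs0 : s0 ∈ Oh b r) (hs00 : s0 ≠ 0)
    (hΛ : ∀ c ∈ Ch b r α, ∀ i, Lam h.hT h.mem 1 0 (s0 * c * DVV V (α i)) = 0)
    {u : List (Fin n) → E2 V} (hu : Words α u) (hud : ∀ l, (u l).1 = (u l).2) :
    ∀ l, l ≠ [] → EV.fn (u l).1 T = 0 := by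
  have := h.dom
  have hOd : ∀ c ∈ Oh b r, c.1 = c.2 := by
    rintro c ⟨g, hg, hc⟩
    refine EV.ext' fun x hx => by rw [(hc x hx).1, (hc x hx).2, hbd]
  have hCd : ∀ c ∈ Ch b r α, c.1 = c.2 := by
    intro c hc
    obtain ⟨Q, rfl⟩ := mem_Ch.1 hc
    clear hc
    induction Q using MvPolynomial.induction_on with
    | C a => rw [MvPolynomial.aeval_C]; exact hOd _ a.2
    | add p q hp hq => rw [map_add, Prod.fst_add, Prod.snd_add, hp, hq]
    | mul_X p i hp => rw [map_mul, MvPolynomial.aeval_X, Prod.fst_mul, Prod.snd_mul, hp, hd]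
  have hi : PD.Inj b r α := ⟨fun c hc h1 => Prod.ext h1 (by rw [← hCd c hc, h1]; rfl),
    fun c hc h1 => Prod.ext (by rw [hCd c hc, h1]; rfl) h1⟩
  have A := h.setup hi
  have key : ∀ l, RR (Oh b r) (Ch b r α) (u l) ∧ (l ≠ [] → EV.fn (u l).1 T = 0) := by
    intro l
    induction l with
    | nil => exact ⟨by rw [hu.nil]; exact A.R_of_C (Ch b r α).one_mem, fun h => absurd rfl h⟩
    | cons i l ih =>
      have hX : XX (DVV V) (Oh b r) (Ch b r α) b (DVV V (u (i :: l))) := by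
        rw [hu.cons, mul_comm]
        exact A.X_mul ih.1 (A.DC (PD.α_mem i))
      obtain ⟨k1, k2, hR⟩ := lemB' h hi hX (hu.ent _).1
      have hk : k1 = k2 := by
        obtain ⟨s, hs, hs0, hsC⟩ := hR
        have h1 := hCd _ hsC
        simp only [Prod.fst_mul, Prod.snd_mul, Prod.fst_sub, Prod.snd_sub, ← hud, ← hOd s hs] at h1
        have hs1 : s.1 ≠ 0 := fun h0 => hs0 (hi.1 s (PD.O_le_C hs) h0)
        have h2 := mul_left_cancel₀ hs1 h1
        have h3 := sub_right_injective h2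
        exact (algebraMap ℂ (EV V)).injective h3
      subst hk
      have hc := h.closed1 hi hs0 hs00 hΛ hR ((hu.ent _).1.sub (Ent.alg _))
      have mT := h.mem T ⟨h.hT, le_rfl⟩
      have m0 := h.mem 0 ⟨le_rfl, h.hT⟩
      rw [Complex.ofReal_zero] at m0
      rw [Prod.fst_sub, EV.fn_sub _ _ mT, EV.fn_sub _ _ m0, EV.fn_alg _ mT, EV.fn_alg _ m0, hu.z1] at hc
      refine ⟨?_, fun _ => by linear_combination hc⟩
      have := A.R_add hR (A.R_of_C ((Ch b r α).algebraMap_mem k1))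
      convert this using 1
      exact (sub_add_cancel _ _).symm
  exact fun l hl => (key l).2 hl

end Ctr
end
end

section
open MeasureTheory Set Filter Topology
noncomputable section
namespace Ctr
set_option linter.unusedVariables false
open Polynomial

variable {n : ℕ} {V : TopologicalSpace.Opens ℂ} {T : ℝ} {α : Fin n → E2 V} {b : E2 V} {r : ℝ}

def dl (V : TopologicalSpace.Opens ℂ) : E2 V →ₐ[ℂ] E2 V :=
  (AlgHom.fst ℂ (EV V) (EV V)).prod (AlgHom.fst ℂ (EV V) (EV V))
lemma dl_apply (y : E2 V) : dl V y = (y.1, y.1) := rfl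
lemma dl_D (y : E2 V) : DVV V (dl V y) = dl V (DVV V y) := rfl

lemma PD.diag (h : PD T α b r) : PD T (fun i => dl V (α i)) (dl V b) r := by
  refine ⟨h.hT, h.conn, h.mem, ?_, ?_, h.nc, fun i => ⟨(h.ent i).1, (h.ent i).1⟩, h.int1⟩
  · obtain ⟨r', h0, h1, h2⟩ := h.hr
    exact ⟨r', h0, h1, fun x hx => ⟨(h2 x hx).1, (h2 x hx).1⟩⟩
  · obtain ⟨ξ, hξ⟩ := h.hb
    refine ⟨ξ, ?_⟩
    conv_lhs => rw [hξ]
    rw [map_sum]; exact Finset.sum_congr rfl fun i _ => map_smul _ _ _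

lemma Words.diag {u : List (Fin n) → E2 V} (hu : Words α u) :
    Words (fun i => dl V (α i)) (fun l => dl V (u l)) where
  nil := by rw [hu.nil, map_one]
  cons i l := by rw [dl_D, dl_D, hu.cons, map_mul]
  z1 i l := hu.z1 i l
  z2 i l := hu.z1 i l
  ent l := ⟨(hu.ent l).1, (hu.ent l).1⟩

lemma dl_aeval (P : MvPolynomial (Fin n) ℂ) :
    MvPolynomial.aeval (fun i => dl V (α i)) P = dl V (MvPolynomial.aeval α P) := by
  have := MvPolynomial.comp_aeval_apply (φ := dl V) (f := α) P
  exact this.symm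

theorem single1 (h : PD T α b r)
    (hm : ∀ (P : MvPolynomial (Fin n) ℂ) i, Lam1 h.hT h.mem ((MvPolynomial.aeval α P).1 * EV.DV (α i).1) = 0)
    {u : List (Fin n) → E2 V} (hu : Words α u) : ∀ l, l ≠ [] → EV.fn (u l).1 T = 0 := by
  have := h.dom
  refine single (u := fun l => dl V (u l)) h.diag (fun i => rfl) rfl (Oh _ r).one_mem one_ne_zero ?_ hu.diag (fun l => rfl)
  have := h.diag.hLam 1 0 (fun P i => by
    rw [Lam_apply, zero_mul, add_zero, one_mul, dl_aeval]
    exact hm P i)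
  intro c hc i
  rw [one_mul]; exact this c hc i

lemma dl_O {y : E2 V} (hy : y ∈ Oh b r) : dl V y ∈ Oh (dl V b) r := by
  obtain ⟨g, hg, h⟩ := hy
  exact ⟨g, hg, fun x hx => ⟨(h x hx).1, (h x hx).1⟩⟩

lemma dl_C {y : E2 V} (hy : y ∈ Ch b r α) : dl V y ∈ Ch (dl V b) r (fun i => dl V (α i)) := by
  obtain ⟨Q, rfl⟩ := mem_Ch.1 hy
  clear hy
  induction Q using MvPolynomial.induction_on with
  | C a => rw [MvPolynomial.aeval_C]; exact PD.O_le_C (dl_O a.2)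
  | add p q hp hq => rw [map_add, map_add]; exact (Ch _ _ _).add_mem hp hq
  | mul_X p i hp =>
    rw [map_mul, MvPolynomial.aeval_X, map_mul]
    exact (Ch _ _ _).mul_mem hp (PD.α_mem (α := fun i => dl V (α i)) i)

lemma dl_C_surj (h : PD T α b r) {y : E2 V} (hy : y ∈ Ch (dl V b) r (fun i => dl V (α i))) :
    ∃ z ∈ Ch b r α, dl V z = y := by
  obtain ⟨Q, rfl⟩ := mem_Ch.1 hy
  clear hy
  induction Q using MvPolynomial.induction_on with
  | C a =>
    rw [MvPolynomial.aeval_C]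
    obtain ⟨g, hg, hga⟩ := a.2
    refine ⟨Omk h.BBr g hg, PD.O_le_C (Omk_mem _ _ _), Oh_ext (b := b) (r := r) fun x hx => ?_⟩
    rw [dl_apply]
    dsimp only
    rw [Omk_fst _ _ _ hx]
    exact ⟨(hga x hx).1.symm, (hga x hx).2.symm⟩
  | add p q hp hq =>
    obtain ⟨z1, h1, e1⟩ := hp
    obtain ⟨z2, h2, e2⟩ := hq
    exact ⟨z1 + z2, (Ch _ _ _).add_mem h1 h2, by rw [map_add, map_add, e1, e2]⟩
  | mul_X p i hp =>
    obtain ⟨z1, h1, e1⟩ := hp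
    exact ⟨z1 * α i, (Ch _ _ _).mul_mem h1 (PD.α_mem i), by rw [map_mul, map_mul, e1, MvPolynomial.aeval_X]⟩

lemma case1 (h : PD T α b r)
    (hΛ : ∀ c ∈ Ch b r α, ∀ i, Lam h.hT h.mem 1 (-1) (c * DVV V (α i)) = 0)
    {F : E2 V} (hF : F ∈ Ch b r α) (hF1 : F.1 ≠ 0) (hF2 : F.2 = 0)
    {u : List (Fin n) → E2 V} (hu : Words α u) : ∀ l, l ≠ [] → EV.fn (u l).1 T = 0 := by
  have := h.dom
  have hCd : ∀ c ∈ Ch (dl V b) r (fun i => dl V (α i)), c.1 = c.2 := by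
    intro c hc
    obtain ⟨z, hz, rfl⟩ := dl_C_surj h hc
    rfl
  have hi : PD.Inj (dl V b) r (fun i => dl V (α i)) :=
    ⟨fun c hc h1 => Prod.ext h1 (by rw [← hCd c hc, h1]; rfl),
    fun c hc h1 => Prod.ext (by rw [hCd c hc, h1]; rfl) h1⟩
  obtain ⟨c', hc', hO, h0⟩ := (h.diag.setup hi).star (dl_C hF) (fun h0 => hF1 (congrArg Prod.fst h0))
  refine single (u := fun l => dl V (u l)) h.diag (fun i => rfl) rfl hO h0 ?_ hu.diag (fun l => rfl)
  intro c hc i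
  obtain ⟨z, hz, hzz⟩ := dl_C_surj h ((Ch _ _ _).mul_mem hc' hc)
  rw [mul_assoc (dl V F), ← hzz, Lam_apply, zero_mul, add_zero, one_mul]
  have h3 := hΛ (F * z) ((Ch _ _ _).mul_mem hF hz) i
  rw [Lam_apply, Prod.snd_mul, Prod.snd_mul, hF2, zero_mul, zero_mul, map_zero, mul_zero, add_zero, one_mul] at h3
  exact h3

lemma zero_of_comp (h : PD T α b r) {g : ℂ → ℂ} (hg : AnalyticOnNhd ℂ g (Metric.closedBall 0 r))
    (h0 : ∀ x ∈ V, g (EV.fn b.1 x) = 0) : ∀ y ∈ Metric.closedBall (0:ℂ) r, g y = 0 := by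
  have m0 := h.mem 0 ⟨le_rfl, h.hT⟩
  rcases (EV.fn_an b.1).is_constant_or_isOpen h.conn with ⟨c, hc⟩ | ho
  · exfalso
    apply h.nc
    have : b.1 = algebraMap ℂ _ c := EV.ext' fun x hx => by rw [hc x hx, EV.fn_alg _ hx]
    rw [this]; exact EV.DV.map_algebraMap c
  · have h1 := ho V subset_rfl V.isOpen
    have hm : EV.fn b.1 (0:ℝ) ∈ EV.fn b.1 '' V := ⟨_, m0, rfl⟩
    refine hg.eqOn_zero_of_preconnected_of_eventuallyEq_zero (convex_closedBall (0:ℂ) r).isPreconnected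
      (z₀ := EV.fn b.1 (0:ℝ)) (by simpa using (h.BBr _ m0).1) ?_
    filter_upwards [h1.mem_nhds hm] with y hy
    obtain ⟨x, hx, rfl⟩ := hy
    exact h0 x hx

lemma case2 (h : PD T α b r) (hinj : ∀ c ∈ Ch b r α, c.2 = 0 → c.1 = 0)
    (halg2 : EV.DV b.2 ≠ 0 → ∀ i, AlgF V (EV.fn b.2) r (EV.fn (α i).2))
    {F : E2 V} (hF : F ∈ Ch b r α) (hF1 : F.1 = 0) : F.2 = 0 := by
  have := h.dom
  by_contra hF2
  have hb2 : EV.DV b.2 ≠ 0 := by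
    intro h0
    obtain ⟨c, hc⟩ := EV.const_of_DV h.conn _ h0
    have h1 : (b - algebraMap ℂ (E2 V) c).1 = 0 := by
      refine hinj _ ((Ch b r α).sub_mem (PD.O_le_C PD.b_mem) ((Ch b r α).algebraMap_mem c)) ?_
      rw [Prod.snd_sub, hc]; exact sub_self _
    have h2 : b.1 = algebraMap ℂ _ c := sub_eq_zero.1 h1
    apply h.nc
    rw [h2]; exact EV.DV.map_algebraMap c
  set O2 : Subalgebra ℂ (EV V) := (Oh b r).map (AlgHom.snd ℂ (EV V) (EV V)) with hO2
  have hα : ∀ i, IsAlgebraic O2 (α i).2 := by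
    intro i
    obtain ⟨N, χ, hχ, ⟨k, hkN, x0, hx0, hk⟩, hrel⟩ := halg2 hb2 i
    let o : ℕ → O2 := fun k => ⟨(Omk h.BBr (χ k) (hχ k)).2, ⟨_, Omk_mem h.BBr (χ k) (hχ k), rfl⟩⟩
    refine ⟨∑ k ∈ Finset.range N, Polynomial.C (o k) * X ^ k, ?_, ?_⟩
    · intro h0
      have h1 := congrArg (fun p => coeff p k) h0
      simp only [finsetSum_coeff, coeff_C_mul_X_pow, coeff_zero] at h1
      rw [Finset.sum_ite_eq, if_pos (Finset.mem_range.2 hkN)] at h1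
      apply hk
      have h2 := congrArg (fun z : O2 => EV.fn z.1 x0) h1
      change EV.fn (Omk h.BBr (χ k) (hχ k)).2 x0 = EV.fn 0 x0 at h2
      rw [Omk_snd _ _ _ hx0, EV.fn_zero hx0] at h2
      exact h2
    · refine EV.ext' fun x hx => ?_
      have e : aeval (α i).2 (∑ k ∈ Finset.range N, Polynomial.C (o k) * X ^ k) =
          ∑ k ∈ Finset.range N, (o k).1 * (α i).2 ^ k := by
        rw [aeval_def, eval₂_finsetSum]
        refine Finset.sum_congr rfl fun k _ => ?_
        rw [eval₂_mul, eval₂_C, eval₂_X_pow]; rfl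
      rw [e, EV.fn_zero hx, ← hrel x hx]
      change (EV.ev x hx) _ = _
      rw [map_sum]
      refine Finset.sum_congr rfl fun k _ => ?_
      rw [map_mul, map_pow]
      change EV.fn (Omk h.BBr (χ k) (hχ k)).2 x * _ = _
      rw [Omk_snd _ _ _ hx]; rfl
  have hFalg : IsAlgebraic O2 F.2 := by
    obtain ⟨Q, rfl⟩ := mem_Ch.1 hF
    clear hF hF1 hF2
    induction Q using MvPolynomial.induction_on with
    | C a =>
      rw [MvPolynomial.aeval_C]
      exact isAlgebraic_algebraMap (⟨a.1.2, ⟨_, a.2, rfl⟩⟩ : O2)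
    | add p q hp hq => rw [map_add]; exact hp.add hq
    | mul_X p i hp => rw [map_mul, MvPolynomial.aeval_X]; exact hp.mul (hα i)
  obtain ⟨q, hq0, hq⟩ := hFalg.exists_nonzero_coeff_and_aeval_eq_zero (mem_nonZeroDivisors_of_ne_zero hF2)
  have hl : ∀ k, ∃ o ∈ Oh b r, o.2 = (q.coeff k).1 := fun k => by
    obtain ⟨o, ho, e⟩ := (q.coeff k).2
    exact ⟨o, ho, e⟩
  choose o ho hoe using hl
  have hz := hinj (∑ k ∈ Finset.range (q.natDegree + 1), o k * F ^ k)
    ((Ch b r α).sum_mem fun k _ => (Ch b r α).mul_mem (PD.O_le_C (ho k)) ((Ch b r α).pow_mem hF k)) (by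
      rw [← hq, aeval_def, eval₂_eq_sum_range, Prod.snd_sum]
      refine Finset.sum_congr rfl fun k _ => ?_
      rw [Prod.snd_mul, Prod.pow_snd, hoe]; rfl)
  rw [Finset.sum_range_succ', Prod.fst_add, Prod.fst_sum, Finset.sum_eq_zero, zero_add, pow_zero, mul_one] at hz
  · obtain ⟨g, hg, hgo⟩ := ho 0
    have h1 := zero_of_comp h hg (fun x hx => by rw [← (hgo x hx).1, hz, EV.fn_zero hx])
    apply hq0
    apply Subtype.ext
    rw [← hoe 0]
    refine EV.ext' fun x hx => ?_
    rw [(hgo x hx).2, h1 _ (by simpa using (h.BBr x hx).2)]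
    exact (EV.fn_zero hx).symm
  · intro k _
    rw [Prod.fst_mul, Prod.pow_fst, hF1, zero_pow (Nat.succ_ne_zero k), mul_zero]

lemma Ent_aeval (hα : ∀ i, Ent (α i).1 ∧ Ent (α i).2) (P : MvPolynomial (Fin n) ℂ) :
    Ent (MvPolynomial.aeval α P).1 ∧ Ent (MvPolynomial.aeval α P).2 := by
  induction P using MvPolynomial.induction_on with
  | C a => rw [MvPolynomial.aeval_C]; exact ⟨Ent.alg a, Ent.alg a⟩
  | add p q hp hq => rw [map_add]; exact ⟨hp.1.add hq.1, hp.2.add hq.2⟩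
  | mul_X p i hp =>
    rw [map_mul, MvPolynomial.aeval_X]; exact ⟨hp.1.mul (hα i).1, hp.2.mul (hα i).2⟩

set_option maxHeartbeats 1000000 in
theorem pair (h : PD T α b r)
    (hmom : ∀ (P : MvPolynomial (Fin n) ℂ) (i : Fin n),
      Lam h.hT h.mem 1 (-1) (MvPolynomial.aeval α P * DVV V (α i)) = 0)
    (halg2 : EV.DV b.2 ≠ 0 → ∀ i, AlgF V (EV.fn b.2) r (EV.fn (α i).2))
    {u : List (Fin n) → E2 V} (hu : Words α u) :
    (∀ l, l ≠ [] → EV.fn (u l).1 T = 0) ∨ (∀ l, EV.fn (u l).1 T = EV.fn (u l).2 T) := by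
  have := h.dom
  have hΛ := h.hLam 1 (-1) hmom
  have mT := h.mem T ⟨h.hT, le_rfl⟩
  have m0 := h.mem 0 ⟨le_rfl, h.hT⟩
  rw [Complex.ofReal_zero] at m0
  by_cases hc1 : ∃ F ∈ Ch b r α, F.1 ≠ 0 ∧ F.2 = 0
  · obtain ⟨F, hF, h1, h2⟩ := hc1
    exact Or.inl (case1 h hΛ hF h1 h2 hu)
  have hinj : ∀ c ∈ Ch b r α, c.2 = 0 → c.1 = 0 := fun c hc h2 => by
    by_contra h1; exact hc1 ⟨c, hc, h1, h2⟩
  have hi : PD.Inj b r α := ⟨fun c hc h1 => Prod.ext h1 (case2 h hinj halg2 hc h1),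
    fun c hc h2 => Prod.ext (hinj c hc h2) h2⟩
  have A := h.setup hi
  by_cases hI : ∀ w : E2 V, RR (Oh b r) (Ch b r α) w → Ent w.1 →
      (EV.fn w.1 T = EV.fn w.1 0 ∧ EV.fn w.2 T = EV.fn w.2 0)
  · left
    refine single1 h (fun P i => ?_) hu
    obtain ⟨hP1, hP2⟩ := Ent_aeval h.ent P
    obtain ⟨y1, hy1, ye1, -⟩ := (hP1.mul (h.ent i).1.DV).prim
    obtain ⟨y2, hy2, ye2, -⟩ := (hP2.mul (h.ent i).2.DV).prim
    have hD : DVV V (y1, y2) = MvPolynomial.aeval α P * DVV V (α i) := Prod.ext hy1 hy2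
    obtain ⟨k1, k2, hR⟩ := lemB' h hi (u := (y1, y2)) (by
      rw [hD]; exact A.X_mul (A.R_of_C (PD.aevalC_mem P)) (A.DC (PD.α_mem i))) ye1
    have h1 := (hI _ hR (ye1.sub (Ent.alg _))).1
    rw [Prod.fst_sub, EV.fn_sub _ _ mT, EV.fn_sub _ _ m0, EV.fn_alg _ mT, EV.fn_alg _ m0] at h1
    dsimp only at h1
    rw [← hy1, Lam1_D]
    linear_combination h1
  · right
    push Not at hI
    obtain ⟨w0, hw0, hw0e, hw0n⟩ := hI
    have hII : ∀ w : E2 V, RR (Oh b r) (Ch b r α) w → Ent w.1 →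
        (EV.fn w.1 T = EV.fn w.2 T ∧ EV.fn w.1 0 = EV.fn w.2 0) := by
      have hw02 := (h.closed2 hi hΛ hw0 hw0e).resolve_left (fun h1 => hw0n h1.1 h1.2)
      intro w hw hwe
      rcases h.closed2 hi hΛ hw hwe with h1 | h1
      · rcases h.closed2 hi hΛ (A.R_add hw hw0) (hwe.add hw0e) with h2 | h2
        · exfalso
          simp only [Prod.fst_add, Prod.snd_add, EV.fn_add _ _ mT, EV.fn_add _ _ m0] at h2
          refine hw0n ?_ ?_
          · linear_combination h2.1 - h1.1
          · linear_combination h2.2 - h1.2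
        · simp only [Prod.fst_add, Prod.snd_add, EV.fn_add _ _ mT, EV.fn_add _ _ m0] at h2
          exact ⟨by linear_combination h2.1 - hw02.1, by linear_combination h2.2 - hw02.2⟩
      · exact h1
    have key : ∀ l, RR (Oh b r) (Ch b r α) (u l) ∧ EV.fn (u l).1 T = EV.fn (u l).2 T := by
      intro l
      induction l with
      | nil =>
        rw [hu.nil]
        have h1C : (1 : E2 V) ∈ Ch b r α := Subalgebra.one_mem (Ch b r α)
        refine ⟨A.R_of_C h1C, ?_⟩
        exact (by rw [Prod.fst_one, Prod.snd_one, ])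
      | cons i l ih =>
        obtain ⟨k1, k2, hR⟩ := lemB' h hi (u := u (i :: l)) (by
          rw [hu.cons, mul_comm]; exact A.X_mul ih.1 (A.DC (PD.α_mem i))) (hu.ent _).1
        obtain ⟨h1, h2⟩ := hII _ hR ((hu.ent _).1.sub (Ent.alg _))
        simp only [Prod.fst_sub, Prod.snd_sub, EV.fn_sub _ _ mT, EV.fn_sub _ _ m0, EV.fn_alg _ mT,
          EV.fn_alg _ m0, hu.z1, hu.z2] at h1 h2
        have hk : k1 = k2 := by linear_combination -h2
        subst hk
        refine ⟨?_, by linear_combination h1⟩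
        have := A.R_add hR (A.R_of_C ((Ch b r α).algebraMap_mem k1))
        convert this using 1
        exact (sub_add_cancel _ _).symm
    exact fun l => (key l).2

end Ctr
end
end

section
open MeasureTheory Set Filter Topology
noncomputable section
namespace Ctr
set_option linter.unusedVariables false

def eN (p : ℕ → ℂ → ℂ) : ℕ → ℂ → ℂ
  | 0 => fun _ => 1
  | (k+1) => fun z => (1 / ((k:ℂ)+1)) * ((-1)^(k+2) * ∑ a : Fin (k+1), (-1)^(a:ℕ) * eN p a z * p (k+1-a) z)
decreasing_by exact a.2

lemma eN_an {p : ℕ → ℂ → ℂ} {S : Set ℂ} (hp : ∀ k, AnalyticOnNhd ℂ (p k) S) (k : ℕ) :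
    AnalyticOnNhd ℂ (eN p k) S := by
  induction k using Nat.strong_induction_on with
  | _ k ih =>
  cases k with
  | zero => rw [eN]; exact analyticOnNhd_const
  | succ k =>
    rw [eN]
    refine analyticOnNhd_const.mul (analyticOnNhd_const.mul ?_)
    refine Finset.analyticOnNhd_fun_sum _ fun a _ => ?_
    exact (analyticOnNhd_const.mul (ih _ a.2)).mul (hp _)

lemma eN_eq {p : ℕ → ℂ → ℂ} {z : ℂ} (l : List ℂ) (hp : ∀ k, p k z = (l.map (· ^ k)).sum) (k : ℕ) :
    eN p k z = (l : Multiset ℂ).esymm k := by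
  have hl : (Finset.univ.val.map (fun i : Fin l.length => l.get i)) = (l : Multiset ℂ) := by
    have : (Finset.univ.val.map (fun i : Fin l.length => l.get i)) = ((List.ofFn l.get : List ℂ) : Multiset ℂ) := by
      rw [Fin.univ_val_map]
    rw [this, List.ofFn_get]
  have he : ∀ k, (l : Multiset ℂ).esymm k = MvPolynomial.aeval (fun i : Fin l.length => l.get i) (MvPolynomial.esymm (Fin l.length) ℂ k) := by
    intro k
    rw [MvPolynomial.aeval_esymm_eq_multiset_esymm, hl]
  have hps : ∀ k, p k z = MvPolynomial.aeval (fun i : Fin l.length => l.get i) (MvPolynomial.psum (Fin l.length) ℂ k) := by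
    intro k
    rw [hp, MvPolynomial.psum, map_sum]
    simp only [map_pow, MvPolynomial.aeval_X]
    rw [← List.sum_ofFn]
    congr 1
    conv_lhs => rw [← List.ofFn_get l, List.map_ofFn]
    rfl
  induction k using Nat.strong_induction_on with
  | _ k ih =>
  cases k with
  | zero => rw [eN, he]; simp
  | succ k =>
    have h1 := congrArg (MvPolynomial.aeval (fun i : Fin l.length => l.get i)) (MvPolynomial.mul_esymm_eq_sum (Fin l.length) ℂ (k+1))
    rw [map_mul, map_mul, ← he, map_sum] at h1
    simp only [map_mul, map_pow, map_neg, map_one, map_natCast, ← he, ← hps] at h1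
    rw [eN]
    have hk : ((k:ℂ)+1) ≠ 0 := by exact_mod_cast Nat.succ_ne_zero k
    have h2 : ∑ a : Fin (k+1), (-1 : ℂ)^(a:ℕ) * eN p a z * p (k+1-a) z
      = ∑ a ∈ Finset.HasAntidiagonal.antidiagonal (k+1) with a.1 < k+1, (-1:ℂ)^a.1 * (l : Multiset ℂ).esymm a.1 * p a.2 z := by
      rw [Finset.sum_filter, Finset.Nat.sum_antidiagonal_eq_sum_range_succ_mk, Finset.sum_range_succ, if_neg (lt_irrefl _), add_zero, Finset.sum_range]
      refine Finset.sum_congr rfl fun a _ => ?_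
      rw [if_pos a.2, ih _ a.2]
    dsimp only
    rw [h2]
    rw [← h1]
    push_cast
    field_simp

lemma eN_root {p : ℕ → ℂ → ℂ} {z : ℂ} (l : List ℂ) (hp : ∀ k, p k z = (l.map (· ^ k)).sum) {M : ℕ}
    (hM : l.length ≤ M) {y : ℂ} (hy : y ∈ l) :
    ∑ k ∈ Finset.range (M+1), (-1)^k * eN p k z * y ^ (M - k) = 0 := by
  have h1 := congrArg (Polynomial.eval y) (Multiset.prod_X_sub_X_eq_sum_esymm (l : Multiset ℂ))
  rw [Polynomial.eval_multiset_prod, Polynomial.eval_finsetSum] at h1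
  have h0 : (Multiset.map (Polynomial.eval y) (Multiset.map (fun t => Polynomial.X - Polynomial.C t) (l : Multiset ℂ))).prod = 0 := by
    rw [Multiset.prod_eq_zero_iff, Multiset.map_map, Multiset.mem_map]
    exact ⟨y, hy, by simp⟩
  rw [h0] at h1
  simp only [Multiset.coe_card] at h1
  obtain ⟨m, rfl⟩ := Nat.exists_eq_add_of_le hM
  rw [show l.length + m + 1 = (l.length + 1) + m by ring, Finset.sum_range_add]
  have h3 : ∑ x ∈ Finset.range m, (-1 : ℂ) ^ (l.length + 1 + x) * eN p (l.length + 1 + x) z * y ^ (l.length + m - (l.length + 1 + x)) = 0 := by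
    refine Finset.sum_eq_zero fun x _ => ?_
    rw [eN_eq l hp, Multiset.esymm, Multiset.powersetCard_eq_empty _ (by simp; omega)]
    simp
  rw [h3, add_zero]
  have : ∑ k ∈ Finset.range (l.length + 1), (-1:ℂ)^k * eN p k z * y ^ (l.length + m - k) = y ^ m * ∑ k ∈ Finset.range (l.length + 1), (-1:ℂ)^k * eN p k z * y ^ (l.length - k) := by
    rw [Finset.mul_sum]
    refine Finset.sum_congr rfl fun k hk => ?_
    have : l.length + m - k = m + (l.length - k) := by have := Finset.mem_range.1 hk; omega
    rw [this, pow_add]; ring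
  rw [this]
  convert mul_zero _
  rw [h1]
  refine Finset.sum_congr rfl fun k hk => ?_
  rw [eN_eq l hp]
  simp [mul_assoc]

/-- contour power sums -/
def PS (F b : ℂ → ℂ) (ρ : ℝ) (k : ℕ) (z : ℂ) : ℂ :=
  (2 * Real.pi * Complex.I)⁻¹ * ∮ x in C(0, ρ), F x ^ k * deriv b x / (b x - z)

lemma PS_an {F b : ℂ → ℂ} (hF : Differentiable ℂ F) (hb : Differentiable ℂ b) {ρ r : ℝ} (hρ : 0 < ρ)
    (h : ∀ x, ‖x‖ = ρ → r < ‖b x‖) (k : ℕ) : AnalyticOnNhd ℂ (PS F b ρ k) (Metric.closedBall 0 r) := by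
  obtain ⟨r', hr', h'⟩ : ∃ r', r < r' ∧ ∀ x, ‖x‖ = ρ → r' < ‖b x‖ := by
    have hc : IsCompact (Metric.sphere (0:ℂ) ρ) := isCompact_sphere _ _
    have hne : (Metric.sphere (0:ℂ) ρ).Nonempty := NormedSpace.sphere_nonempty.2 hρ.le
    obtain ⟨x0, hx0, hmin⟩ := hc.exists_isMinOn hne (hb.continuous.norm.continuousOn)
    have h0 : r < ‖b x0‖ := h x0 (by simpa using hx0)
    obtain ⟨r', h1, h2⟩ := exists_between h0
    exact ⟨r', h1, fun x hx => h2.trans_le (hmin (by simpa using hx))⟩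
  have hd : DifferentiableOn ℂ (PS F b ρ k) (Metric.ball 0 r') := by
    intro z hz
    refine DifferentiableAt.differentiableWithinAt ?_
    unfold PS
    refine DifferentiableAt.const_mul ?_ _
    simp only [circleIntegral]
    have hbc : Continuous (fun t : ℝ => b (circleMap 0 ρ t)) := hb.continuous.comp (continuous_circleMap 0 ρ)
    have hb2 : ∀ t, r' < ‖b (circleMap 0 ρ t)‖ := fun t => h' _ (by rw [norm_circleMap_zero, abs_of_pos hρ])
    have hdb : Differentiable ℂ (deriv b) := hb.contDiff.differentiable_deriv_two
    set H : ℝ → ℂ := fun t => deriv (circleMap 0 ρ) t * (F (circleMap 0 ρ t) ^ k * deriv b (circleMap 0 ρ t)) with hH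
    have hHc : Continuous H := by
      have := continuous_circleMap 0 ρ
      simp only [hH, deriv_circleMap]
      exact (this.mul continuous_const).mul (((hF.continuous.comp this).pow k).mul (hdb.continuous.comp this))
    have hz' : ‖z‖ < r' := by simpa using hz
    obtain ⟨r2, h1, h2⟩ := exists_between hz'
    have hsub : ∀ w ∈ Metric.ball (0:ℂ) r2, ∀ t, r' - r2 ≤ ‖b (circleMap 0 ρ t) - w‖ := by
      intro w hw t
      have := norm_sub_norm_le (b (circleMap 0 ρ t)) w
      have h3 : ‖w‖ < r2 := by simpa using hw
      linarith [hb2 t]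
    have hne : ∀ w ∈ Metric.ball (0:ℂ) r2, ∀ t, b (circleMap 0 ρ t) - w ≠ 0 := by
      intro w hw t h0
      have := hsub w hw t
      rw [h0, norm_zero] at this; linarith
    have hz2 : Metric.ball (0:ℂ) r2 ∈ 𝓝 z := Metric.isOpen_ball.mem_nhds (by simpa using h1)
    have hcont : ∀ w ∈ Metric.ball (0:ℂ) r2, Continuous (fun t => H t / (b (circleMap 0 ρ t) - w)) :=
      fun w hw => hHc.div (hbc.sub continuous_const) (hne w hw)
    have hcont' : ∀ w ∈ Metric.ball (0:ℂ) r2, Continuous (fun t => H t / (b (circleMap 0 ρ t) - w)^2) :=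
      fun w hw => hHc.div ((hbc.sub continuous_const).pow 2) (fun t => pow_ne_zero 2 (hne w hw t))
    have := (intervalIntegral.hasDerivAt_integral_of_dominated_loc_of_deriv_le (μ := volume) (a := 0) (b := 2 * Real.pi)
      (F := fun w t => H t / (b (circleMap 0 ρ t) - w)) (F' := fun w t => H t / (b (circleMap 0 ρ t) - w)^2)
      (x₀ := z) (bound := fun t => ‖H t‖ / (r' - r2)^2) hz2
      (by filter_upwards [hz2] with w hw using (hcont w hw).aestronglyMeasurable)
      ((hcont z (mem_of_mem_nhds hz2)).intervalIntegrable _ _)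
      ((hcont' z (mem_of_mem_nhds hz2)).aestronglyMeasurable)
      (ae_of_all _ fun t _ w hw => by
        rw [norm_div, norm_pow]
        have := hsub w hw t
        have h4 : 0 < r' - r2 := by linarith
        gcongr)
      ((hHc.norm.div_const _).intervalIntegrable _ _)
      (ae_of_all _ fun t _ w hw => by
        have h5 := ((hasDerivAt_id w).const_sub (b (circleMap 0 ρ t)))
        have h6 := (h5.inv (hne w hw t)).const_mul (H t)
        simp only [div_eq_mul_inv]
        refine h6.congr_deriv ?_
        simp [div_eq_mul_inv])).2
    refine this.differentiableAt.congr_of_eventuallyEq (Eventually.of_forall fun w => ?_)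
    refine intervalIntegral.integral_congr fun t _ => ?_
    simp only [hH, smul_eq_mul]; ring
  have := hd.analyticOnNhd Metric.isOpen_ball
  exact this.mono (Metric.closedBall_subset_ball hr')

lemma PS_eq {F b : ℂ → ℂ} (hF : Differentiable ℂ F) (hb : Differentiable ℂ b) {ρ r : ℝ} (hρ : 0 < ρ)
    (h : ∀ x, ‖x‖ = ρ → r < ‖b x‖) {z : ℂ} (hz : z ∈ Metric.closedBall (0:ℂ) r) :
    ∃ l : List ℂ, (∀ k, PS F b ρ k z = (l.map (fun y => F y ^ k)).sum) ∧
      ∀ x ∈ Metric.closedBall (0:ℂ) ρ, b x = z → x ∈ l := by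
  have hz' : ‖z‖ ≤ r := by simpa using hz
  have hnz : ∀ x, ‖x‖ = ρ → b x - z ≠ 0 := by
    intro x hx h0
    have := h x hx
    rw [sub_eq_zero.1 h0] at this; linarith
  have hbz : Differentiable ℂ (fun x => b x - z) := hb.sub_const z
  obtain ⟨l, g, hl, hg, hg0, hfac⟩ := factor_zeros (U := Metric.closedBall (0:ℂ) ρ) (isCompact_closedBall _ _)
    (convex_closedBall _ _).isPreconnected (f := fun x => b x - z)
    (fun x _ => (hbz.analyticAt x))
    ⟨(ρ:ℂ), by simp [abs_of_pos hρ], hnz _ (by simp [abs_of_pos hρ])⟩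
  have hlb : ∀ y ∈ l, y ∈ Metric.ball (0:ℂ) ρ := by
    intro y hy
    have h1 := hl y hy
    rw [mem_closedBall_zero_iff] at h1
    rw [mem_ball_zero_iff]
    refine lt_of_le_of_ne h1 fun h2 => hnz y h2 ?_
    rw [hfac y]
    have : (l.map fun t => y - t).prod = 0 := by
      rw [List.prod_eq_zero_iff, List.mem_map]; exact ⟨y, hy, sub_self _⟩
    rw [this, zero_mul]
  refine ⟨l, fun k => ?_, fun x hx hbx => ?_⟩
  swap
  · have h1 := hfac x
    simp only [hbx, sub_self] at h1
    have h2 := (mul_eq_zero.1 h1.symm).resolve_right (hg0 x hx)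
    rw [List.prod_eq_zero_iff, List.mem_map] at h2
    obtain ⟨y, hy, h3⟩ := h2
    rwa [sub_eq_zero.1 h3]
  -- log derivative
  have hld : ∀ x, ‖x‖ = ρ → deriv b x / (b x - z) = (l.map fun y => (x - y)⁻¹).sum + deriv g x / g x := by
    intro x hx
    have hxm : x ∈ Metric.closedBall (0:ℂ) ρ := by rw [mem_closedBall_zero_iff, hx]
    have hprod : ∀ m : List ℂ, (∀ y ∈ m, x - y ≠ 0) →
        (m.map fun y => x - y).prod ≠ 0 ∧ HasDerivAt (fun x => (m.map fun y => x - y).prod) ((m.map fun y => x - y).prod * (m.map fun y => (x - y)⁻¹).sum) x := by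
      intro m
      induction m with
      | nil => intro _; simp only [List.map_nil, List.prod_nil, List.sum_nil, mul_zero]; exact ⟨one_ne_zero, hasDerivAt_const _ _⟩
      | cons y m ih =>
        intro hm
        obtain ⟨h1, h2⟩ := ih (fun t ht => hm t (List.mem_cons_of_mem _ ht))
        have h3 := hm y List.mem_cons_self
        simp only [List.map_cons, List.prod_cons, List.sum_cons]
        refine ⟨mul_ne_zero h3 h1, ?_⟩
        refine (((hasDerivAt_id x).sub_const y).mul h2).congr_deriv ?_
        simp only [id]
        field_simp
    obtain ⟨h1, h2⟩ := hprod l (fun y hy h0 => by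
      have := hlb y hy
      rw [← sub_eq_zero.1 h0, mem_ball_zero_iff, hx] at this
      exact lt_irrefl _ this)
    have h3 := h2.mul (hg x hxm).differentiableAt.hasDerivAt
    have h4 : HasDerivAt (fun x => b x - z) (deriv b x) x := (hb x).hasDerivAt.sub_const z
    have h5 : (fun x => b x - z) = (fun x => (l.map fun y => x - y).prod * g x) := funext hfac
    rw [h5] at h4
    rw [h4.unique h3, hfac x]
    have := hg0 x hxm
    field_simp
  have hFk : Differentiable ℂ (fun x => F x ^ k) := hF.pow k
  have hint : (∮ x in C(0, ρ), F x ^ k * deriv b x / (b x - z)) = ∮ x in C(0, ρ), ((l.map fun y => (x - y)⁻¹ * F x ^ k).sum + F x ^ k * (deriv g x / g x)) := by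
    refine circleIntegral.integral_congr hρ.le fun x hx => ?_
    rw [mul_div_assoc, hld x (by simpa using hx), mul_add, List.sum_map_mul_right]; ring
  have hI2 : ContinuousOn (fun x => F x ^ k * (deriv g x / g x)) (Metric.closedBall 0 ρ) :=
    hFk.continuous.continuousOn.mul (ContinuousOn.div (fun x hx => (hg x hx).deriv.continuousAt.continuousWithinAt) (fun x hx => (hg x hx).continuousAt.continuousWithinAt) hg0)
  have hI2z : (∮ x in C(0, ρ), F x ^ k * (deriv g x / g x)) = 0 := by
    refine Complex.circleIntegral_eq_zero_of_differentiable_on_off_countable hρ.le countable_empty hI2 fun x hx => ?_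
    have hx' := Metric.ball_subset_closedBall hx.1
    exact (hFk x).mul (((hg x hx').deriv.differentiableAt).div (hg x hx').differentiableAt (hg0 x hx'))
  have hlist : ∀ m : List ℂ, (∀ y ∈ m, y ∈ Metric.ball (0:ℂ) ρ) →
      CircleIntegrable (fun x => (m.map fun y => (x - y)⁻¹ * F x ^ k).sum) 0 ρ ∧
      (∮ x in C(0, ρ), (m.map fun y => (x - y)⁻¹ * F x ^ k).sum) = (2 * Real.pi * Complex.I) * (m.map fun y => F y ^ k).sum := by
    intro m
    induction m with
    | nil => intro _; simp only [List.map_nil, List.sum_nil]; exact ⟨circleIntegrable_const _ _ _, by simp [circleIntegral]⟩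
    | cons y m ih =>
      intro hm
      obtain ⟨h1, h2⟩ := ih (fun t ht => hm t (List.mem_cons_of_mem _ ht))
      have hy := hm y List.mem_cons_self
      have hc : CircleIntegrable (fun x => (x - y)⁻¹ * F x ^ k) 0 ρ := by
        refine ContinuousOn.circleIntegrable hρ.le ?_
        refine ContinuousOn.mul (ContinuousOn.inv₀ (continuous_id.sub continuous_const).continuousOn ?_) hFk.continuous.continuousOn
        intro x hx h0
        have h0' : x = y := sub_eq_zero.1 h0
        rw [h0', mem_sphere_zero_iff_norm] at hx
        rw [mem_ball_zero_iff, hx] at hy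
        exact lt_irrefl _ hy
      simp only [List.map_cons, List.sum_cons]
      refine ⟨hc.add h1, ?_⟩
      rw [circleIntegral.integral_add hc h1, h2]
      have := (hFk.differentiableOn (s := Metric.closedBall 0 ρ)).circleIntegral_sub_inv_smul hy
      simp only [smul_eq_mul] at this
      rw [this]; ring
  obtain ⟨h1, h2⟩ := hlist l hlb
  unfold PS
  rw [hint, circleIntegral.integral_add h1 ((hI2.mono Metric.sphere_subset_closedBall).circleIntegrable hρ.le), h2, hI2z, add_zero, inv_mul_cancel_left₀ Complex.two_pi_I_ne_zero]

theorem intF_of_circle {b : ℂ → ℂ} (hb : Differentiable ℂ b) {R r ρ : ℝ} (hρ : 0 < ρ) (hR : R ≤ ρ)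
    (hr : ∀ x ∈ Metric.ball (0:ℂ) R, ‖b x‖ ≤ r) (h : ∀ x, ‖x‖ = ρ → r < ‖b x‖) :
    IntF (Metric.ball 0 R) b r := by
  intro F hF
  have han := PS_an hF hb hρ h
  obtain ⟨C, hC⟩ := (isCompact_closedBall (0:ℂ) r).exists_bound_of_continuousOn (han 0).continuousOn
  obtain ⟨M, hM⟩ := exists_nat_ge C
  refine ⟨M, fun k z => (-1)^(M-k) * eN (PS F b ρ) (M-k) z, fun k => analyticOnNhd_const.mul (eN_an han _), ?_⟩
  intro x hx
  have hz : b x ∈ Metric.closedBall (0:ℂ) r := by simpa using hr x hx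
  obtain ⟨l, hl, hl2⟩ := PS_eq hF hb hρ h hz
  have hlen : l.length ≤ M := by
    have h1 := hC _ hz
    rw [hl 0] at h1
    simp at h1
    exact_mod_cast h1.trans hM
  have hxl := hl2 x (Metric.ball_subset_closedBall (Metric.ball_subset_ball hR hx)) rfl
  have := eN_root (p := PS F b ρ) (z := b x) (l.map F) (fun k => by rw [hl, List.map_map]; rfl) (M := M) (by simpa using hlen) (y := F x) (List.mem_map_of_mem hxl)
  rw [← Finset.sum_range_reflect, Finset.sum_range_succ] at this
  rw [← this, add_comm]
  congr 1
  · refine Finset.sum_congr rfl fun k hk => ?_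
    have hk := Finset.mem_range.1 hk
    have h1 : M + 1 - 1 - k = M - k := by omega
    have h2 : M - (M - k) = k := by omega
    rw [h1, h2]
  · simp [eN]

end Ctr
end
end

section
open MeasureTheory Set Filter Topology
noncomputable section
namespace Ctr
set_option linter.unusedVariables false
open Polynomial

lemma lead_ratio {p : ℂ[X]} {x : ℕ → ℂ} (hx : Tendsto (fun n => ‖x n‖) atTop atTop) :
    Tendsto (fun n => p.eval (x n) / x n ^ p.natDegree) atTop (𝓝 p.leadingCoeff) := by
  have h1 : Tendsto (fun n => (x n)⁻¹) atTop (𝓝 0) := by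
    rw [tendsto_zero_iff_norm_tendsto_zero]
    simp only [norm_inv]
    exact tendsto_inv_atTop_zero.comp hx
  have h2 : Tendsto (fun n => p.reverse.eval (x n)⁻¹) atTop (𝓝 (p.reverse.eval 0)) :=
    (p.reverse.continuous.tendsto 0).comp h1
  rw [← coeff_zero_eq_eval_zero, coeff_zero_reverse] at h2
  refine h2.congr' ?_
  filter_upwards [hx.eventually_gt_atTop 0] with n hn
  have h0 : x n ≠ 0 := norm_pos_iff.1 hn
  have : Invertible (x n) := invertibleOfNonzero h0
  have h3 := eval₂_reverse_mul_pow (RingHom.id ℂ) (x n) p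
  rw [invOf_eq_inv] at h3
  rw [eq_div_iff (pow_ne_zero _ h0)]
  exact h3

def good (c : ℝ) (d k : ℕ) (G : ℂ) (θ : ℝ) : Prop :=
  ∀ ε : ℝ, (ε = 1 ∨ ε = -1) → Complex.exp (-((c * k * ε * θ : ℝ) * Complex.I)) ≠ (ε:ℂ)^d * G

lemma not_good_countable (c : ℝ) (hc : 0 < c) (d k : ℕ) (hk : k ≠ 0) (G : ℂ) : {θ | ¬ good c d k G θ}.Countable := by
  have key : ∀ ε : ℝ, ε ≠ 0 → ∀ w : ℂ, {θ : ℝ | Complex.exp (-((c * k * ε * θ : ℝ) * Complex.I)) = w}.Countable := by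
    intro ε hε w
    by_cases hne : {θ : ℝ | Complex.exp (-((c * k * ε * θ : ℝ) * Complex.I)) = w}.Nonempty
    · obtain ⟨t0, ht0⟩ := hne
      refine (countable_range (fun m : ℤ => t0 - m * (2 * Real.pi) / (c * k * ε))).mono ?_
      intro t ht
      have h1 : Complex.exp _ = Complex.exp _ := (Eq.trans ht ht0.symm)
      rw [Complex.exp_eq_exp_iff_exists_int] at h1
      obtain ⟨m, hm⟩ := h1
      refine ⟨m, ?_⟩
      have h2 := congrArg Complex.im hm
      simp at h2
      have h3 : c * k * ε ≠ 0 := by positivity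
      dsimp only
      field_simp
      linear_combination h2
    · rw [Set.not_nonempty_iff_eq_empty.1 hne]; exact countable_empty
  refine ((key 1 one_ne_zero ((1:ℝ)^d * G)).union (key (-1) (by norm_num) (((-1:ℝ):ℂ)^d * G))).mono ?_
  intro t ht
  simp only [good, mem_ofPred_eq, not_forall, not_not] at ht
  obtain ⟨ε, he | he, h⟩ := ht
  · left; subst he; simpa using h
  · right; subst he; exact h

lemma half {c : ℝ} (hc : 0 < c) {p Q : ℂ[X]} (hp : 0 < p.natDegree) {θ : ℝ}
    (hθ : Q.natDegree = 0 ∨ good c p.natDegree Q.natDegree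
      (-(p.leadingCoeff / Q.leadingCoeff) / ‖-(p.leadingCoeff / Q.leadingCoeff)‖) θ) (M : ℝ) :
    ∀ᶠ j : ℕ in atTop, ∀ x : ℂ, ‖x‖ = θ + j * (2 * Real.pi / c) → 0 ≤ x.im →
      M < ‖p.eval x + Q.eval (Complex.exp (-(c * Complex.I * x)))‖ := by
  by_contra hcon
  rw [Filter.not_eventually] at hcon
  obtain ⟨ns, hns, hx⟩ := exists_seq_forall_of_frequently hcon
  push Not at hx
  choose x hxn him hxM using hx
  set ρ : ℕ → ℝ := fun j => ‖x j‖ with hρdef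
  have hρ : Tendsto (fun j => ‖x j‖) atTop atTop := by
    simp only [hxn]
    refine tendsto_atTop_add_const_left _ _ ?_
    exact Tendsto.atTop_mul_const (by positivity) (tendsto_natCast_atTop_atTop.comp hns)
  set y : ℕ → ℂ := fun j => Complex.exp (-(c * Complex.I * x j)) with hy
  have hyn : ∀ j, ‖y j‖ = Real.exp (c * (x j).im) := by
    intro j; rw [hy]; simp only [Complex.norm_exp]; congr 1; simp
  have hpx : Tendsto (fun j => ‖p.eval (x j)‖) atTop atTop :=
    p.tendsto_norm_atTop (natDegree_pos_iff_degree_pos.1 hp) hρ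
  have hQy : Tendsto (fun j => ‖Q.eval (y j)‖) atTop atTop := by
    refine tendsto_atTop_mono (fun j => ?_) (tendsto_atTop_add_const_right _ (-M) hpx)
    have h1 := norm_sub_norm_le (p.eval (x j)) (-(Q.eval (y j)))
    rw [norm_neg, sub_neg_eq_add] at h1
    linarith [hxM j]
  rcases hθ with hQ0 | hθ
  · rw [natDegree_eq_zero] at hQ0
    obtain ⟨q, rfl⟩ := hQ0
    simp only [eval_C] at hQy
    exact not_tendsto_const_atTop _ _ hQy
  set k := Q.natDegree with hk
  set d := p.natDegree with hd
  have hy1 : ∀ j, 1 ≤ ‖y j‖ := fun j => by rw [hyn]; exact Real.one_le_exp (mul_nonneg hc.le (him j))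
  obtain ⟨A, hA0, hA⟩ : ∃ A : ℝ, 0 < A ∧ ∀ j, ‖Q.eval (y j)‖ ≤ A * ‖y j‖ ^ k := by
    refine ⟨∑ i ∈ Finset.range (k+1), ‖Q.coeff i‖ + 1, by positivity, fun j => ?_⟩
    rw [eval_eq_sum_range]
    refine (norm_sum_le _ _).trans ?_
    rw [add_mul, Finset.sum_mul]
    refine le_add_of_le_of_nonneg ?_ (by positivity)
    refine Finset.sum_le_sum fun i hi => ?_
    rw [norm_mul, norm_pow]
    exact mul_le_mul_of_nonneg_left (pow_le_pow_right₀ (hy1 j) (by have := Finset.mem_range.1 hi; omega)) (norm_nonneg _)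
  have hyinf : Tendsto (fun j => ‖y j‖) atTop atTop := by
    rw [tendsto_atTop]
    intro B
    filter_upwards [hQy.eventually_gt_atTop (A * |B| ^ k)] with j hj
    have h1 : |B| ^ k < ‖y j‖ ^ k := lt_of_mul_lt_mul_left (hj.trans_le (hA j)) hA0.le
    exact (le_abs_self B).trans (lt_of_pow_lt_pow_left₀ k (norm_nonneg _) h1).le
  have hQ0 : Q.leadingCoeff ≠ 0 := by
    intro h0
    rw [leadingCoeff_eq_zero] at h0
    subst h0
    simp only [eval_zero, norm_zero] at hQy
    exact not_tendsto_const_atTop _ _ hQy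
  have hP0 : p.leadingCoeff ≠ 0 := by
    intro h0
    rw [leadingCoeff_eq_zero] at h0
    have h1 : p.natDegree = 0 := by rw [h0, natDegree_zero]
    omega
  have hs := lead_ratio (p := Q) hyinf
  have ht := lead_ratio (p := p) hρ
  have hρd : Tendsto (fun j => ‖x j‖ ^ d) atTop atTop := (tendsto_pow_atTop hp.ne').comp hρ
  have hsum : Tendsto (fun j => (p.eval (x j) + Q.eval (y j)) / x j ^ d) atTop (𝓝 0) := by
    rw [tendsto_zero_iff_norm_tendsto_zero]
    have hM0 : Tendsto (fun j => M / ‖x j‖ ^ d) atTop (𝓝 0) := hρd.const_div_atTop M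
    refine squeeze_zero (fun _ => norm_nonneg _) (fun j => ?_) hM0
    rw [norm_div, norm_pow]
    exact div_le_div_of_nonneg_right (hxM j) (by positivity)
  set g : ℂ := -(p.leadingCoeff / Q.leadingCoeff) with hg
  have hg0 : g ≠ 0 := neg_ne_zero.2 (div_ne_zero hP0 hQ0)
  have hratio : Tendsto (fun j => y j ^ k / x j ^ d) atTop (𝓝 g) := by
    have h1 := (hsum.sub ht).div hs hQ0
    have : (0 - p.leadingCoeff) / Q.leadingCoeff = g := by rw [hg]; ring
    rw [this] at h1
    refine h1.congr' ?_
    filter_upwards [hs.eventually_ne hQ0] with j hj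
    have hy0 : y j ≠ 0 := Complex.exp_ne_zero _
    have hQn : Q.eval (y j) ≠ 0 := by
      intro h0; apply hj; rw [h0, zero_div]
    simp only [Pi.div_apply, ← hk]
    rw [← sub_div, add_sub_cancel_left]
    field_simp
  have hnr : Tendsto (fun j => ‖y j‖ ^ k / ‖x j‖ ^ d) atTop (𝓝 ‖g‖) := by
    refine hratio.norm.congr fun j => ?_
    rw [norm_div, norm_pow, norm_pow]
  -- growth of im
  have him2 : Tendsto (fun j => (x j).im ^ 2 / ‖x j‖) atTop (𝓝 0) := by
    have hkpos : 0 < k := by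
      rcases Nat.eq_zero_or_pos k with h | h
      · exfalso
        have : Tendsto (fun j => (1:ℝ) / ‖x j‖ ^ d) atTop (𝓝 0) := hρd.const_div_atTop 1
        simp only [h, pow_zero] at hnr
        exact hg0 (norm_eq_zero.1 (tendsto_nhds_unique hnr this))
      · exact h
    set a : ℝ := Real.log (‖g‖ + 1) with ha
    have hlim : Tendsto (fun t : ℝ => (a^2 * (Real.log t ^ 0 / t) + 2 * a * d * (Real.log t ^ 1 / t) + d^2 * (Real.log t ^ 2 / t)) / (k * c)^2) atTop (𝓝 0) := by
      have h0 := (Real.isLittleO_pow_log_id_atTop (n := 0)).tendsto_div_nhds_zero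
      have h1 := (Real.isLittleO_pow_log_id_atTop (n := 1)).tendsto_div_nhds_zero
      have h2 := (Real.isLittleO_pow_log_id_atTop (n := 2)).tendsto_div_nhds_zero
      have := (((h0.const_mul (a^2)).add (h1.const_mul (2 * a * d))).add (h2.const_mul ((d:ℝ)^2))).div_const ((k * c)^2)
      simpa using this
    refine squeeze_zero' (Eventually.of_forall fun j => by positivity) ?_ (hlim.comp hρ)
    filter_upwards [hnr.eventually_lt_const (lt_add_one ‖g‖), hρ.eventually_gt_atTop 0] with j h1 h2
    rw [div_lt_iff₀ (by positivity), hyn, ← Real.exp_nat_mul] at h1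
    have h3 := (Real.log_lt_log (Real.exp_pos _) h1)
    rw [Real.log_exp, Real.log_mul (by positivity) (by positivity), Real.log_pow] at h3
    have h4 : (k * c * (x j).im)^2 ≤ (a + d * Real.log ‖x j‖)^2 := by
      have h5 : 0 ≤ k * (c * (x j).im) := mul_nonneg (Nat.cast_nonneg _) (mul_nonneg hc.le (him j))
      rw [mul_assoc]
      exact pow_le_pow_left₀ h5 h3.le 2
    simp only [Function.comp]
    rw [le_div_iff₀ (by positivity), div_mul_eq_mul_div, div_le_iff₀ h2]
    have h6 : (a ^ 2 * (Real.log ‖x j‖ ^ 0 / ‖x j‖) + 2 * a * d * (Real.log ‖x j‖ ^ 1 / ‖x j‖) + d ^ 2 * (Real.log ‖x j‖ ^ 2 / ‖x j‖)) * ‖x j‖ = (a + d * Real.log ‖x j‖)^2 := by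
      field_simp; ring
    rw [h6]
    linarith
  set ε : ℕ → ℝ := fun j => if 0 ≤ (x j).re then 1 else -1 with hε
  have hε1 : ∀ j, ε j = 1 ∨ ε j = -1 := fun j => by
    simp only [hε]; split_ifs <;> simp
  have hεsq : ∀ j, ε j * ε j = 1 := fun j => by rcases hε1 j with h | h <;> rw [h] <;> norm_num
  have hεre : ∀ j, ε j * (x j).re = |(x j).re| := fun j => by
    simp only [hε]; split_ifs with h
    · rw [one_mul, abs_of_nonneg h]
    · rw [abs_of_neg (not_le.1 h)]; ring
  set δ : ℕ → ℝ := fun j => ‖x j‖ - |(x j).re| with hδ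
  have hδ0 : Tendsto δ atTop (𝓝 0) := by
    refine squeeze_zero' (Eventually.of_forall fun j => sub_nonneg.2 (Complex.abs_re_le_norm _)) ?_ him2
    filter_upwards [hρ.eventually_gt_atTop 0] with j h2
    rw [le_div_iff₀ h2]
    have h3 := Complex.sq_norm (x j)
    rw [Complex.normSq_apply] at h3
    have h4 := abs_mul_abs_self (x j).re
    have h5 := Complex.abs_re_le_norm (x j)
    simp only [hδ]
    nlinarith [abs_nonneg (x j).re]
  have hux : Tendsto (fun j => x j / ‖x j‖ - ε j) atTop (𝓝 0) := by
    have hinv : Tendsto (fun j => (‖x j‖)⁻¹) atTop (𝓝 0) := tendsto_inv_atTop_zero.comp hρ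
    have hb : Tendsto (fun j => δ j * (‖x j‖)⁻¹ + ((x j).im ^ 2 / ‖x j‖ + (‖x j‖)⁻¹)) atTop (𝓝 0) := by
      simpa using (hδ0.mul hinv).add (him2.add hinv)
    refine squeeze_zero_norm' ?_ hb
    filter_upwards [hρ.eventually_gt_atTop 0] with j h2
    have h2c : (‖x j‖ : ℂ) ≠ 0 := by exact_mod_cast h2.ne'
    have h3 : x j / ‖x j‖ - ε j = ((-(ε j * δ j) / ‖x j‖ : ℝ) : ℂ) + (((x j).im / ‖x j‖ : ℝ) : ℂ) * Complex.I := by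
      have h4 : (x j).re = ε j * (‖x j‖ - δ j) := by
        simp only [hδ]; rw [sub_sub_cancel, ← hεre, ← mul_assoc, hεsq, one_mul]
      have h5 : x j = ((ε j * (‖x j‖ - δ j) : ℝ) : ℂ) + ((x j).im : ℂ) * Complex.I := by
        rw [← h4]; exact (Complex.re_add_im _).symm
      push_cast at h5 ⊢
      field_simp
      linear_combination h5
    rw [h3]
    have hδn : 0 ≤ δ j := sub_nonneg.2 (Complex.abs_re_le_norm _)
    have hεn : |ε j| = 1 := by rcases hε1 j with h | h <;> rw [h] <;> norm_num
    refine (norm_add_le _ _).trans (add_le_add ?_ ?_)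
    · rw [Complex.norm_real, Real.norm_eq_abs, abs_div, abs_neg, abs_mul, hεn, one_mul, abs_of_nonneg hδn, abs_of_pos h2]
      rfl
    · rw [norm_mul, Complex.norm_I, mul_one, Complex.norm_real, Real.norm_eq_abs, abs_div, abs_of_pos h2, abs_of_nonneg (him j),
        ← one_div, ← add_div]
      refine div_le_div_of_nonneg_right ?_ h2.le
      nlinarith [sq_nonneg ((x j).im - 1)]
  set U : ℝ → ℂ := fun e => Complex.exp (-((c * k * e * θ : ℝ) * Complex.I)) with hU
  have huy : Tendsto (fun j => y j ^ k / (‖y j‖ : ℂ) ^ k - U (ε j)) atTop (𝓝 0) := by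
    have h1 : Tendsto (fun j => Complex.exp (((c * k * (ε j * δ j) : ℝ) : ℂ) * Complex.I) - 1) atTop (𝓝 0) := by
      have h2 : Tendsto (fun j => ε j * δ j) atTop (𝓝 0) := by
        rw [tendsto_zero_iff_norm_tendsto_zero] at hδ0 ⊢
        refine hδ0.congr fun j => ?_
        rw [norm_mul]
        rcases hε1 j with h | h <;> rw [h] <;> norm_num
      have h3 : Continuous (fun t : ℝ => Complex.exp (((c * k * t : ℝ) : ℂ) * Complex.I) - 1) := by fun_prop
      have h4 := (h3.tendsto 0).comp h2
      simpa [Function.comp_def] using h4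
    rw [tendsto_zero_iff_norm_tendsto_zero] at h1 ⊢
    refine h1.congr fun j => ?_
    have hUn : ‖U (ε j)‖ = 1 := by
      simp only [hU]; rw [← neg_mul, ← Complex.ofReal_neg]; exact Complex.norm_exp_ofReal_mul_I _
    have h5 : y j ^ k / (‖y j‖ : ℂ) ^ k = U (ε j) * Complex.exp (((c * k * (ε j * δ j) : ℝ) : ℂ) * Complex.I) := by
      rw [hyn]
      simp only [hy, hU]
      rw [Complex.ofReal_exp, ← Complex.exp_nat_mul, ← Complex.exp_nat_mul, ← Complex.exp_sub, ← Complex.exp_add]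
      have h4 : (x j).re = ε j * (θ + ns j * (2 * Real.pi / c) - δ j) := by
        simp only [hδ, ← hxn j]; rw [sub_sub_cancel, ← hεre, ← mul_assoc, hεsq, one_mul]
      rw [Complex.exp_eq_exp_iff_exists_int]
      have hxj : x j = ((ε j * (θ + ns j * (2 * Real.pi / c) - δ j) : ℝ) : ℂ) + ((x j).im : ℂ) * Complex.I := by
        rw [← h4]; exact (Complex.re_add_im _).symm
      generalize (x j).im = w at hxj ⊢
      have hcc : (c:ℂ) ≠ 0 := by exact_mod_cast hc.ne'
      rcases hε1 j with h | h
      · refine ⟨-(k * ns j), ?_⟩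
        rw [hxj, h]
        push_cast
        field_simp
        ring_nf
        rw [Complex.I_sq]; ring
      · refine ⟨(k * ns j), ?_⟩
        rw [hxj, h]
        push_cast
        field_simp
        ring_nf
        rw [Complex.I_sq]; ring
    rw [h5, ← mul_sub_one, norm_mul, hUn, one_mul]
  have huxd : Tendsto (fun j => x j ^ d / (‖x j‖ : ℂ) ^ d - (ε j : ℂ) ^ d) atTop (𝓝 0) := by
    rw [tendsto_zero_iff_norm_tendsto_zero]
    have h1 := (tendsto_zero_iff_norm_tendsto_zero.1 hux).const_mul (d : ℝ)
    rw [mul_zero] at h1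
    refine squeeze_zero' (Eventually.of_forall fun _ => norm_nonneg _) ?_ h1
    filter_upwards [hρ.eventually_gt_atTop 0] with j h2
    have hA : ‖x j / ‖x j‖‖ = 1 := by
      rw [norm_div, Complex.norm_real, norm_norm, div_self h2.ne']
    have hB : ‖(ε j : ℂ)‖ = 1 := by
      rw [Complex.norm_real]; rcases hε1 j with h | h <;> rw [h] <;> norm_num
    rw [← div_pow]
    generalize x j / ‖x j‖ = A at hA ⊢
    generalize (ε j : ℂ) = B at hB ⊢
    clear_value d
    clear * - hA hB
    induction d with
    | zero => simp
    | succ d ih =>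
      have : A ^ (d+1) - B ^ (d+1) = (A ^ d - B ^ d) * A + B ^ d * (A - B) := by ring
      rw [this]
      refine (norm_add_le _ _).trans ?_
      rw [norm_mul, norm_mul, norm_pow, hA, hB]
      push_cast
      simp only [one_pow, one_mul, mul_one]
      linarith
  have hun : Tendsto (fun j => (y j ^ k / (‖y j‖ : ℂ) ^ k) / (x j ^ d / (‖x j‖ : ℂ) ^ d)) atTop (𝓝 (g / ‖g‖)) := by
    have h1 : Tendsto (fun j => ((‖y j‖ ^ k / ‖x j‖ ^ d : ℝ) : ℂ)) atTop (𝓝 (‖g‖ : ℂ)) :=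
      (Complex.continuous_ofReal.tendsto _).comp hnr
    have h2 := hratio.div h1 (by exact_mod_cast norm_ne_zero_iff.2 hg0)
    refine h2.congr fun j => ?_
    simp only [Pi.div_apply]
    push_cast
    rw [div_div_div_eq, div_div_div_eq]
    ring
  have hfin : Tendsto (fun j => U (ε j) - (ε j : ℂ) ^ d * (g / ‖g‖)) atTop (𝓝 0) := by
    have hb : Tendsto (fun j => ‖y j ^ k / (‖y j‖ : ℂ) ^ k - U (ε j)‖ + (‖(y j ^ k / (‖y j‖ : ℂ) ^ k) / (x j ^ d / (‖x j‖ : ℂ) ^ d) - g / ‖g‖‖ + ‖x j ^ d / (‖x j‖ : ℂ) ^ d - (ε j : ℂ) ^ d‖)) atTop (𝓝 0) := by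
      have h2 := hun.sub_const (g / ‖g‖)
      rw [sub_self] at h2
      simpa using (tendsto_zero_iff_norm_tendsto_zero.1 huy).add ((tendsto_zero_iff_norm_tendsto_zero.1 h2).add (tendsto_zero_iff_norm_tendsto_zero.1 huxd))
    refine squeeze_zero_norm' ?_ hb
    filter_upwards [hρ.eventually_gt_atTop 0] with j h2
    have hx0 : x j ≠ 0 := norm_pos_iff.1 h2
    have hX : ‖x j ^ d / (‖x j‖ : ℂ) ^ d‖ = 1 := by
      rw [norm_div, norm_pow, norm_pow, Complex.norm_real, norm_norm, div_self (by positivity)]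
    have hG : ‖g / ‖g‖‖ = 1 := by
      rw [norm_div, Complex.norm_real, norm_norm, div_self (norm_ne_zero_iff.2 hg0)]
    generalize x j ^ d / (‖x j‖ : ℂ) ^ d = X at hX ⊢
    generalize g / (‖g‖ : ℂ) = G at hG ⊢
    generalize y j ^ k / (‖y j‖ : ℂ) ^ k = Y
    have hX0 : X ≠ 0 := by rintro rfl; simp at hX
    have : U (ε j) - (ε j : ℂ) ^ d * G = -(Y - U (ε j)) + ((Y / X - G) * X + (X - (ε j : ℂ) ^ d) * G) := by
      field_simp; ring
    rw [this]
    refine (norm_add_le _ _).trans (add_le_add (norm_neg _).le ((norm_add_le _ _).trans (add_le_add ?_ ?_)))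
    · rw [norm_mul, hX, mul_one]
    · rw [norm_mul, hG, mul_one]
  have hm1 := hθ 1 (Or.inl rfl)
  have hm2 := hθ (-1) (Or.inr rfl)
  have hp1 : 0 < ‖U 1 - ((1:ℝ):ℂ)^d * (g / ‖g‖)‖ := norm_pos_iff.2 (sub_ne_zero.2 hm1)
  have hp2 : 0 < ‖U (-1) - ((-1:ℝ):ℂ)^d * (g / ‖g‖)‖ := norm_pos_iff.2 (sub_ne_zero.2 hm2)
  have hev := (tendsto_zero_iff_norm_tendsto_zero.1 hfin).eventually_lt_const (lt_min hp1 hp2)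
  obtain ⟨j, hj⟩ := hev.exists
  rcases hε1 j with h | h
  · rw [h] at hj; exact absurd hj (not_lt.2 (min_le_left _ _))
  · rw [h] at hj; exact absurd hj (not_lt.2 (min_le_right _ _))

theorem region {c : ℝ} (hc : 0 < c) {p Q1 Q2 : ℂ[X]} (hp : 0 < p.natDegree) (R r : ℝ) :
    ∃ ρ : ℝ, R ≤ ρ ∧ 0 < ρ ∧ ∀ x : ℂ, ‖x‖ = ρ →
      r < ‖p.eval x + Q1.eval (Complex.exp (c * Complex.I * x)) + Q2.eval (Complex.exp (-(c * Complex.I * x)))‖ := by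
  set p' := p.comp (-X) with hp'
  have hd' : p'.natDegree = p.natDegree := by rw [hp', natDegree_comp]; simp
  have hbd : ∀ Q : ℂ[X], ∃ B : ℝ, ∀ w : ℂ, ‖w‖ ≤ 1 → ‖Q.eval w‖ ≤ B := by
    intro Q
    obtain ⟨B, hB⟩ := (isCompact_closedBall (0:ℂ) 1).exists_bound_of_continuousOn Q.continuous.continuousOn
    exact ⟨B, fun w hw => hB w (by simpa using hw)⟩
  obtain ⟨B1, hB1⟩ := hbd Q1
  obtain ⟨B2, hB2⟩ := hbd Q2
  have hex : ∀ (p Q : ℂ[X]), {θ | ¬ (Q.natDegree = 0 ∨ good c p.natDegree Q.natDegree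
      (-(p.leadingCoeff / Q.leadingCoeff) / ‖-(p.leadingCoeff / Q.leadingCoeff)‖) θ)}.Countable := by
    intro p Q
    by_cases h : Q.natDegree = 0
    · simp [h]
    · refine (not_good_countable c hc p.natDegree Q.natDegree h
        (-(p.leadingCoeff / Q.leadingCoeff) / ‖-(p.leadingCoeff / Q.leadingCoeff)‖)).mono fun t ht => ?_
      exact fun h' => ht (Or.inr h')
  obtain ⟨θ, hθ⟩ := (((hex p Q2).union (hex p' Q1)).dense_compl ℝ).nonempty
  rw [mem_compl_iff, mem_union, not_or, mem_ofPred_eq, mem_ofPred_eq, not_not, not_not] at hθ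
  have e1 := half hc hp hθ.1 (r + B1)
  have e2 := half hc (hd' ▸ hp) hθ.2 (r + B2)
  have hlim : Tendsto (fun j : ℕ => θ + j * (2 * Real.pi / c)) atTop atTop := by
    refine tendsto_atTop_add_const_left _ _ ?_
    exact Tendsto.atTop_mul_const (by positivity) tendsto_natCast_atTop_atTop
  obtain ⟨j, h1, h2, h3, h4⟩ := (e1.and (e2.and ((hlim.eventually_ge_atTop R).and (hlim.eventually_gt_atTop 0)))).exists
  refine ⟨_, h3, h4, fun x hx => ?_⟩
  rcases le_total 0 x.im with him | him
  · have h5 := h1 x hx him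
    have h6 := hB1 (Complex.exp (c * Complex.I * x)) (by rw [Complex.norm_exp]; simp; positivity)
    have h7 := norm_sub_norm_le (p.eval x + Q2.eval (Complex.exp (-(c * Complex.I * x)))) (-(Q1.eval (Complex.exp (c * Complex.I * x))))
    rw [norm_neg, sub_neg_eq_add] at h7
    rw [add_right_comm]
    linarith
  · have h5 := h2 (-x) (by rwa [norm_neg]) (by simpa using him)
    have h6 := hB2 (Complex.exp (-(c * Complex.I * x))) (by rw [Complex.norm_exp]; simp; exact mul_nonpos_of_nonneg_of_nonpos hc.le him)
    rw [hp', eval_comp] at h5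
    simp only [eval_neg, eval_X, neg_neg, mul_neg] at h5
    have h7 := norm_sub_norm_le (p.eval x + Q1.eval (Complex.exp (c * Complex.I * x))) (-(Q2.eval (Complex.exp (-(c * Complex.I * x)))))
    rw [norm_neg, sub_neg_eq_add] at h7
    linarith

end Ctr
end
end

section
open MeasureTheory Set Filter Topology
noncomputable section
namespace Ctr
set_option linter.unusedVariables false
open Polynomial

abbrev KK := RatFunc ℂ
abbrev zX : KK := RatFunc.X
abbrev pK (p : ℂ[X]) : KK := algebraMap ℂ[X] KK p

lemma zX_ne : zX ≠ 0 := RatFunc.X_ne_zero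
lemma pK_inj {p q : ℂ[X]} (h : pK p = pK q) : p = q := RatFunc.algebraMap_injective ℂ h
lemma pK_X : pK X = zX := RatFunc.algebraMap_X
lemma pK_mul (p q : ℂ[X]) : pK (p * q) = pK p * pK q := map_mul _ _ _
lemma pK_Xpow (k : ℕ) : pK (X ^ k) = zX ^ k := by rw [pK, map_pow]; rw [← pK_X]
lemma pK_C (c : ℂ) : pK (C c) = algebraMap ℂ KK c := by
  rw [pK, RatFunc.algebraMap_C]; rfl

/-- Laurent polynomials in `z^m` -/
def Lm (m : ℕ) : Subalgebra ℂ KK where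
  carrier := {f | ∃ (k : ℕ) (p : ℂ[X]), f * (zX ^ m) ^ k = aeval (zX ^ m) p}
  mul_mem' := by
    rintro f g ⟨k, p, h⟩ ⟨k', p', h'⟩
    refine ⟨k + k', p * p', ?_⟩
    rw [pow_add, map_mul, ← h, ← h']; ring
  add_mem' := by
    rintro f g ⟨k, p, h⟩ ⟨k', p', h'⟩
    refine ⟨k + k', p * X ^ k' + p' * X ^ k, ?_⟩
    rw [pow_add, map_add, map_mul, map_mul, ← h, ← h', map_pow, map_pow, aeval_X]; ring
  algebraMap_mem' := fun c => ⟨0, C c, by simp⟩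

abbrev Lam0 : Subalgebra ℂ KK := Lm 1

lemma aeval_zX (p : ℂ[X]) : aeval zX p = pK p := by
  rw [← pK_X, pK, aeval_algebraMap_apply, aeval_X_left_apply]

lemma mem_L {f : KK} : f ∈ Lam0 ↔ ∃ (k : ℕ) (p : ℂ[X]), f * zX ^ k = pK p := by
  constructor
  · rintro ⟨k, p, h⟩
    exact ⟨k, p, by rw [pow_one, aeval_zX] at h; exact h⟩
  · rintro ⟨k, p, h⟩
    exact ⟨k, p, by rw [pow_one, aeval_zX]; exact h⟩

lemma Lm_zpow (m : ℕ) (j : ℤ) : (zX ^ m) ^ j ∈ Lm m := by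
  have hz : zX ^ m ≠ 0 := pow_ne_zero _ zX_ne
  obtain ⟨k, rfl | rfl⟩ := j.eq_nat_or_neg
  · exact ⟨0, X ^ k, by simp⟩
  · refine ⟨k, 1, ?_⟩
    rw [zpow_neg, zpow_natCast, map_one, inv_mul_cancel₀ (pow_ne_zero _ hz)]

lemma zpow_mem (j : ℤ) : zX ^ j ∈ Lam0 := by
  have := Lm_zpow 1 j
  rwa [pow_one] at this

lemma pK_mem (p : ℂ[X]) : pK p ∈ Lam0 := mem_L.2 ⟨0, p, by simp⟩

lemma Lm_le (m : ℕ) {f : KK} (h : f ∈ Lm m) : f ∈ Lam0 := by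
  obtain ⟨k, p, h⟩ := h
  refine mem_L.2 ⟨m * k, expand ℂ m p, ?_⟩
  rw [pow_mul, h, ← aeval_zX, expand_aeval]

/-- integral closedness -/
lemma L_int {f : KK} (h : IsIntegral Lam0 f) : f ∈ Lam0 := by
  obtain ⟨P, hP, h0⟩ := h
  have hk : ∃ k : ℕ, ∀ i ∈ Finset.range (P.natDegree), ∃ p : ℂ[X], (P.coeff i : KK) * zX ^ k = pK p := by
    have h1 : ∀ i, ∃ (k : ℕ) (p : ℂ[X]), (P.coeff i : KK) * zX ^ k = pK p := fun i => mem_L.1 (P.coeff i).2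
    choose k p hp using h1
    refine ⟨∑ i ∈ Finset.range P.natDegree, k i, fun i hi => ?_⟩
    obtain ⟨d, hd⟩ : ∃ d, ∑ i ∈ Finset.range P.natDegree, k i = k i + d :=
      Nat.exists_eq_add_of_le (Finset.single_le_sum (f := k) (fun _ _ => Nat.zero_le _) hi)
    refine ⟨p i * X ^ d, ?_⟩
    rw [hd, pow_add, ← mul_assoc, hp, pK_mul, pK_Xpow]
  obtain ⟨k, hk⟩ := hk
  choose! p hp using hk
  set d := P.natDegree
  set N := f.num
  set D := f.denom
  have hD : pK D ≠ 0 := fun h => f.denom_ne_zero (pK_inj (by rw [h]; simp [pK]))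
  have hf : f * pK D = pK N := by
    conv_lhs => rw [← RatFunc.num_div_denom f]
    exact div_mul_cancel₀ _ hD
  have key : X ^ k * N ^ d + ∑ i ∈ Finset.range d, p i * N ^ i * D ^ (d - i) = 0 := by
    apply pK_inj
    rw [eval₂_eq_sum_range, Finset.sum_range_succ] at h0
    have hl : P.coeff P.natDegree = 1 := hP
    rw [hl, map_one, one_mul] at h0
    have h1 : (zX ^ k * pK D ^ d) * (∑ i ∈ Finset.range d, (algebraMap Lam0 KK) (P.coeff i) * f ^ i + f ^ d) = 0 := by
      rw [h0, mul_zero]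
    rw [mul_add, Finset.mul_sum] at h1
    have h2 : pK (X ^ k * N ^ d + ∑ i ∈ Finset.range d, p i * N ^ i * D ^ (d - i)) =
        zX ^ k * pK N ^ d + ∑ i ∈ Finset.range d, pK (p i) * pK N ^ i * pK D ^ (d - i) := by
      simp only [pK, map_add, map_mul, map_pow, map_sum]
      rw [← pK_X]
    rw [h2, ← hf, mul_pow]
    have h3 : pK 0 = 0 := by simp [pK]
    rw [h3, ← h1, add_comm]
    congr 1
    · apply Finset.sum_congr rfl
      intro i hi
      rw [← hp i hi]
      have hid : i < d := Finset.mem_range.1 hi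
      obtain ⟨e, he⟩ : ∃ e, d = i + e := Nat.exists_eq_add_of_le hid.le
      have : d - i = e := by omega
      rw [this, he, pow_add]
      show _ = _ * ((P.coeff i : KK) * f ^ i)
      ring
    · ring
  have hdvd : D ∣ X ^ k * N ^ d := by
    rw [eq_neg_of_add_eq_zero_left key]
    apply (dvd_neg).2
    apply Finset.dvd_sum
    intro i hi
    have hid : i < d := Finset.mem_range.1 hi
    exact Dvd.dvd.mul_left (dvd_pow_self D (by omega)) _
  have hcop : IsCoprime D (N ^ d) := (f.isCoprime_num_denom.symm).pow_right
  obtain ⟨q, hq⟩ := hcop.dvd_of_dvd_mul_right hdvd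
  refine mem_L.2 ⟨k, N * q, ?_⟩
  rw [← pK_Xpow, hq, pK_mul, pK_mul, ← mul_assoc, hf]

lemma int_lead {R : Subalgebra ℂ KK} {x : KK} (P : R[X]) {c : ℂ} (hc : c ≠ 0)
    (h : P.leadingCoeff = algebraMap ℂ R c) (h0 : aeval x P = 0) : IsIntegral R x := by
  refine ⟨C (algebraMap ℂ R c⁻¹) * P, ?_, ?_⟩
  · apply monic_C_mul_of_mul_leadingCoeff_eq_one
    rw [h, ← map_mul, inv_mul_cancel₀ hc, map_one]
  · rw [eval₂_mul]
    have : eval₂ (algebraMap R KK) x P = 0 := h0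
    rw [this, mul_zero]

lemma int_inv {R : Subalgebra ℂ KK} {x : KK} (hx : x ≠ 0) (P : R[X]) {c : ℂ} (hc : c ≠ 0)
    (h : P.coeff 0 = algebraMap ℂ R c) (h0 : aeval x P = 0) : IsIntegral R x⁻¹ := by
  have hc' : algebraMap ℂ R c ≠ 0 := by
    intro h; apply hc
    exact (algebraMap ℂ R).injective (by rw [h, map_zero])
  apply int_lead P.reverse hc
  · rw [reverse_leadingCoeff, trailingCoeff_eq_coeff_zero (by rw [h]; exact hc'), h]
  · let _ : Invertible x := invertibleOfNonzero hx
    have := (eval₂_reverse_eq_zero_iff (algebraMap R KK) x P).2 h0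
    rwa [invOf_eq_inv] at this

/-- relation polynomial `A - x B` over a subalgebra containing `x` -/
lemma rel_poly {R : Subalgebra ℂ KK} {x : KK} (hx : x ∈ R) (A B : ℂ[X]) :
    ∃ P : R[X], (∀ i, P.coeff i = algebraMap ℂ R (A.coeff i) - ⟨x, hx⟩ * algebraMap ℂ R (B.coeff i)) ∧
      ∀ t, aeval t P = aeval t A - x * aeval t B := by
  refine ⟨A.map (algebraMap ℂ R) - C ⟨x, hx⟩ * B.map (algebraMap ℂ R), ?_, ?_⟩
  · intro i; simp
  · intro t
    rw [map_sub, map_mul, aeval_map_algebraMap, aeval_map_algebraMap, aeval_C]; rfl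

lemma int_deg {R : Subalgebra ℂ KK} {x t : KK} (hx : x ∈ R) (A B : ℂ[X])
    (hd : B.natDegree < A.natDegree) (h : x * aeval t B = aeval t A) : IsIntegral R t := by
  obtain ⟨P, hP, hP'⟩ := rel_poly hx A B
  have hA : A ≠ 0 := by rintro rfl; simp at hd
  have hl : A.leadingCoeff ≠ 0 := leadingCoeff_ne_zero.2 hA
  have h1 : P.coeff A.natDegree = algebraMap ℂ R A.leadingCoeff := by
    rw [hP, coeff_eq_zero_of_natDegree_lt hd, map_zero, mul_zero, sub_zero]; rfl
  have hne : algebraMap ℂ R A.leadingCoeff ≠ 0 := by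
    intro h; apply hl
    exact (algebraMap ℂ R).injective (by rw [h, map_zero])
  have h2 : P.natDegree = A.natDegree := by
    apply le_antisymm
    · apply natDegree_le_iff_coeff_eq_zero.2
      intro i hi
      rw [hP, coeff_eq_zero_of_natDegree_lt hi, coeff_eq_zero_of_natDegree_lt (hd.trans hi)]
      simp
    · apply le_natDegree_of_ne_zero
      rw [h1]; exact hne
  apply int_lead P hl
  · rw [leadingCoeff, h2, h1]
  · rw [hP', h, sub_self]

lemma int_root {R : Subalgebra ℂ KK} {x t : KK} (hx : x ∈ R) (A B : ℂ[X]) (ht : t ≠ 0)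
    (hA : A.coeff 0 ≠ 0) (hB : B.coeff 0 = 0) (h : x * aeval t B = aeval t A) : IsIntegral R t⁻¹ := by
  obtain ⟨P, hP, hP'⟩ := rel_poly hx A B
  apply int_inv ht P hA
  · rw [hP, hB]; simp
  · rw [hP', h, sub_self]

lemma coprime_rep {t x : KK} (hx : x ∈ IntermediateField.adjoin ℂ {t}) :
    ∃ A B : ℂ[X], IsCoprime A B ∧ aeval t B ≠ 0 ∧ x * aeval t B = aeval t A := by
  classical
  obtain ⟨r, s, h⟩ := (IntermediateField.mem_adjoin_simple_iff ℂ x).1 hx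
  by_cases hs : aeval t s = 0
  · refine ⟨0, 1, isCoprime_zero_left.2 isUnit_one, by simp, ?_⟩
    rw [h, hs]; simp
  · have hs0 : s ≠ 0 := by rintro rfl; simp at hs
    obtain ⟨g, A, B, hc, hA, hB⟩ : ∃ g A B : ℂ[X], IsCoprime A B ∧ r = g * A ∧ s = g * B := by
      refine ⟨gcd r s, r / gcd r s, s / gcd r s, isCoprime_div_gcd_div_gcd hs0, ?_, ?_⟩
      · exact (EuclideanDomain.mul_div_cancel' (fun h => hs0 ((gcd_eq_zero_iff _ _).1 h).2) (gcd_dvd_left _ _)).symm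
      · exact (EuclideanDomain.mul_div_cancel' (fun h => hs0 ((gcd_eq_zero_iff _ _).1 h).2) (gcd_dvd_right _ _)).symm
    have hgB : aeval t g * aeval t B ≠ 0 := by rw [← map_mul, ← hB]; exact hs
    refine ⟨A, B, hc, right_ne_zero_of_mul hgB, ?_⟩
    rw [h, hA, hB, map_mul, map_mul]
    have h1 := left_ne_zero_of_mul hgB
    have h2 := right_ne_zero_of_mul hgB
    field_simp

lemma unit_form {f g : KK} (hf : f ∈ Lam0) (hg : g ∈ Lam0) (h : f * g = 1) :
    ∃ (c : ℂ) (l : ℤ), c ≠ 0 ∧ f = algebraMap ℂ KK c * zX ^ l := by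
  obtain ⟨k, p, hp⟩ := mem_L.1 hf
  obtain ⟨k', q, hq⟩ := mem_L.1 hg
  have h1 : p * q = X ^ (k + k') := by
    apply pK_inj
    rw [pK_Xpow, pK, map_mul, ← pK, ← pK, ← hp, ← hq, pow_add]
    linear_combination (zX ^ k * zX ^ k') * h
  obtain ⟨i, hi, u, hu⟩ := (dvd_prime_pow prime_X _).1 (Dvd.intro _ h1)
  obtain ⟨c, hc, hcu⟩ := Polynomial.isUnit_iff.1 u.isUnit
  have hc0 : c ≠ 0 := hc.ne_zero
  refine ⟨c⁻¹, (i : ℤ) - k, inv_ne_zero hc0, ?_⟩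
  have hz : zX ^ k ≠ 0 := pow_ne_zero _ zX_ne
  rw [← hcu] at hu
  have h2 : pK p * algebraMap ℂ KK c = zX ^ i := by
    rw [← pK_C, ← pK_Xpow, ← hu, pK_mul]
  rw [zpow_sub₀ zX_ne, zpow_natCast, zpow_natCast, ← h2, ← hp, map_inv₀]
  have : algebraMap ℂ KK c ≠ 0 := by rwa [Ne, map_eq_zero]
  field_simp

lemma zpow_not {c c' δ : ℂ} {l l' : ℤ} (hc : c ≠ 0) (hδ : δ ≠ 0) (hl : l ≠ 0)
    (h : algebraMap ℂ KK c * zX ^ l + algebraMap ℂ KK δ = algebraMap ℂ KK c' * zX ^ l') : False := by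
  -- multiply by a power to get polynomials
  obtain ⟨N, a, ha⟩ : ∃ N a : ℕ, (a : ℤ) = l + N ∧ 0 < N + l' := ⟨l.natAbs + l'.natAbs + 1, (l + (l.natAbs + l'.natAbs + 1 : ℕ)).toNat, by omega, by omega⟩
  obtain ⟨b, hb⟩ : ∃ b : ℕ, (b : ℤ) = l' + N := ⟨(l' + N).toNat, by omega⟩
  have h1 : C c * X ^ a + C δ * X ^ N = C c' * X ^ b := by
    apply pK_inj
    simp only [pK, map_add, map_mul]
    rw [← pK, ← pK, ← pK, ← pK, ← pK, ← pK, pK_C, pK_C, pK_C, pK_Xpow, pK_Xpow, pK_Xpow, ← zpow_natCast, ← zpow_natCast, ← zpow_natCast, ha.1, hb,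
      zpow_add₀ zX_ne, zpow_add₀ zX_ne]
    linear_combination (zX ^ (N:ℤ)) * h
  have haN : a ≠ N := by omega
  have e1 := congrArg (fun q => coeff q N) h1
  have e2 := congrArg (fun q => coeff q a) h1
  simp [coeff_X_pow, haN, haN.symm] at e1 e2
  by_cases hbN : N = b
  · subst hbN
    simp [haN] at e2
    exact hc e2
  · simp [hbN] at e1
    exact hδ e1

end Ctr
end
end

section
open MeasureTheory Set Filter Topology
noncomputable section
namespace Ctr
set_option linter.unusedVariables false
open Polynomial

lemma aeval_mem_sub {R : Subalgebra ℂ KK} {s : KK} (hs : s ∈ R) (A : ℂ[X]) : aeval s A ∈ R := by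
  have : aeval s A = ((aeval (⟨s, hs⟩ : R) A : R) : KK) := by
    rw [← Subalgebra.coe_val, ← aeval_algHom_apply]; rfl
  rw [this]; exact Subtype.property _

lemma const_of_natDeg {t x : KK} {A B : ℂ[X]} (hA : A.natDegree = 0) (hB : B.natDegree = 0)
    (h0 : aeval t B ≠ 0) (h : x * aeval t B = aeval t A) : ∃ c, x = algebraMap ℂ KK c := by
  rw [eq_C_of_natDegree_eq_zero hA, eq_C_of_natDegree_eq_zero hB, aeval_C, aeval_C] at h
  rw [eq_C_of_natDegree_eq_zero hB, aeval_C] at h0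
  refine ⟨A.coeff 0 / B.coeff 0, ?_⟩
  rw [map_div₀, ← h, mul_div_cancel_right₀ _ h0]

/-- a good generator -/
lemma good_gen {n : ℕ} (α : Fin n → KK) (hα : ∀ i, α i ∈ Lam0) (i0 : Fin n)
    (hi0 : ¬ ∃ c, α i0 = algebraMap ℂ KK c) :
    ∃ s ∈ Lam0, s ∈ IntermediateField.adjoin ℂ (range α) ∧
      ∀ i, α i ∈ IntermediateField.adjoin ℂ {s} := by
  set E := IntermediateField.adjoin ℂ (range α) with hE
  have hαE : ∀ i, α i ∈ E := fun i => IntermediateField.subset_adjoin _ _ (mem_range_self i)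
  obtain ⟨t, ht⟩ : ∃ t, E = IntermediateField.adjoin ℂ {t} := ⟨_, RatFunc.Luroth.eq_adjoin_generator⟩
  have htE : t ∈ E := by rw [ht]; exact IntermediateField.mem_adjoin_simple_self ℂ t
  obtain ⟨A, B, hc, hB, hAB⟩ := coprime_rep (ht ▸ hαE i0)
  by_cases hd : B.natDegree < A.natDegree
  · exact ⟨t, L_int (int_deg (hα i0) A B hd hAB), htE, fun i => ht ▸ hαE i⟩
  · have hB0 : B.natDegree ≠ 0 := by
      intro h
      exact hi0 (const_of_natDeg (by omega) h hB hAB)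
    obtain ⟨μ, hμ⟩ := IsAlgClosed.exists_root B (by
      intro h; exact hB0 (natDegree_eq_of_degree_eq_some h))
    set μ' := algebraMap ℂ KK μ
    have htμ : t - μ' ≠ 0 := by
      intro h
      rw [sub_eq_zero] at h
      apply hB
      rw [h, aeval_algebraMap_apply, coe_aeval_eq_eval, hμ.eq_zero, map_zero]
    refine ⟨(t - μ')⁻¹, ?_, ?_, fun i => ?_⟩
    · apply L_int
      have e : ∀ Q : ℂ[X], aeval (t - μ') (Q.comp (X + C μ)) = aeval t Q := by
        intro Q
        rw [aeval_comp]; simp [μ']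
      apply int_root (hα i0) (A.comp (X + C μ)) (B.comp (X + C μ)) htμ
      · rw [coeff_zero_eq_eval_zero, eval_comp]
        simp only [eval_add, eval_X, eval_C, zero_add]
        intro h
        obtain ⟨U, V, hUV⟩ := hc
        have := congrArg (eval μ) hUV
        simp [h, hμ.eq_zero] at this
      · rw [coeff_zero_eq_eval_zero, eval_comp]
        simp only [eval_add, eval_X, eval_C, zero_add]
        exact hμ
      · rw [e, e, hAB]
    · exact E.inv_mem (E.sub_mem htE (E.algebraMap_mem μ))
    · have h1 : E ≤ IntermediateField.adjoin ℂ {(t - μ')⁻¹} := by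
        rw [ht, IntermediateField.adjoin_le_iff]
        rintro x rfl
        have h2 := IntermediateField.mem_adjoin_simple_self ℂ (x - μ')⁻¹
        have h3 := (IntermediateField.adjoin ℂ {(x - μ')⁻¹}).add_mem
          ((IntermediateField.adjoin ℂ {(x - μ')⁻¹}).inv_mem h2)
          ((IntermediateField.adjoin ℂ {(x - μ')⁻¹}).algebraMap_mem μ)
        rw [inv_inv] at h3
        change x - μ' + μ' ∈ _ at h3
        rw [sub_add_cancel] at h3
        exact h3
      exact h1 (hαE i)

lemma root_unit {s x : KK} (hs : s ∈ Lam0) (hx : x ∈ Lam0) {A B : ℂ[X]} (hc : IsCoprime A B)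
    (h : x * aeval s B = aeval s A) {μ : ℂ} (hμ : B.IsRoot μ) :
    ∃ (c : ℂ) (l : ℤ), c ≠ 0 ∧ s - algebraMap ℂ KK μ = algebraMap ℂ KK c * zX ^ l := by
  obtain ⟨U, V, hUV⟩ := hc
  obtain ⟨q, hq⟩ := dvd_iff_isRoot.2 hμ
  have h1 := congrArg (aeval s) hUV
  rw [map_add, map_mul, map_mul, ← h, map_one] at h1
  refine unit_form (g := aeval s q * (aeval s U * x + aeval s V)) ?_ ?_ ?_
  · exact Lam0.sub_mem hs (Lam0.algebraMap_mem μ)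
  · exact Lam0.mul_mem (aeval_mem_sub hs _) (Lam0.add_mem (Lam0.mul_mem (aeval_mem_sub hs _) hx) (aeval_mem_sub hs _))
  · have h2 : aeval s B = (s - algebraMap ℂ KK μ) * aeval s q := by
      rw [hq, map_mul]; simp
    rw [h2] at h1
    linear_combination h1

theorem dichotomy {n : ℕ} (α : Fin n → KK) (hα : ∀ i, α i ∈ Lam0) :
    (∃ s ∈ Lam0, ∀ i, ∃ A : ℂ[X], α i = aeval s A) ∨
    (∃ m : ℕ, 0 < m ∧ (∀ i, α i ∈ Lm m) ∧ zX ^ m ∈ IntermediateField.adjoin ℂ (range α)) := by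
  by_cases hconst : ∀ i, ∃ c, α i = algebraMap ℂ KK c
  · left
    choose c hc using hconst
    exact ⟨0, Lam0.zero_mem, fun i => ⟨C (c i), by rw [hc, aeval_C]⟩⟩
  push Not at hconst
  obtain ⟨i0, hi0⟩ := hconst
  have hi0' : ¬ ∃ c, α i0 = algebraMap ℂ KK c := fun ⟨c, hc⟩ => hi0 c hc
  obtain ⟨s, hs, hsE, hsα⟩ := good_gen α hα i0 hi0'
  choose A B hc hB hAB using fun i => coprime_rep (hsα i)
  by_cases hdeg : ∀ i, (B i).natDegree = 0
  · left
    refine ⟨s, hs, fun i => ⟨A i * C ((B i).coeff 0)⁻¹, ?_⟩⟩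
    have h1 := hAB i
    have h2 := hB i
    rw [eq_C_of_natDegree_eq_zero (hdeg i), aeval_C] at h1 h2
    rw [map_mul, ← h1, aeval_C, map_inv₀, mul_assoc, mul_inv_cancel₀ h2, mul_one]
  right
  push Not at hdeg
  obtain ⟨i1, hi1⟩ := hdeg
  obtain ⟨μ, hμ⟩ := IsAlgClosed.exists_root (B i1) (by
      intro h; exact hi1 (natDegree_eq_of_degree_eq_some h))
  obtain ⟨c, l, hc0, hsl⟩ := root_unit hs (hα i1) (hc i1) (hAB i1) hμ
  have hcK : algebraMap ℂ KK c ≠ 0 := by rwa [Ne, map_eq_zero]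
  have hsl' : s = algebraMap ℂ KK μ + algebraMap ℂ KK c * zX ^ l := by rw [← hsl]; ring
  have hl : l ≠ 0 := by
    rintro rfl
    rw [zpow_zero, mul_one, ← map_add] at hsl'
    apply hi0 ((A i0).eval (μ + c) / (B i0).eval (μ + c))
    have h1 := hAB i0
    have h2 := hB i0
    rw [hsl', aeval_algebraMap_apply, aeval_algebraMap_apply, coe_aeval_eq_eval] at h1
    rw [hsl', aeval_algebraMap_apply, coe_aeval_eq_eval] at h2
    rw [map_div₀]
    erw [← h1, mul_div_cancel_right₀ _ h2]
  have hroots : ∀ i μ', (B i).IsRoot μ' → μ' = μ := by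
    intro i μ' h'
    by_contra hne
    obtain ⟨c', l', hc', hsl2⟩ := root_unit hs (hα i) (hc i) (hAB i) h'
    refine zpow_not hc0 (sub_ne_zero.2 (Ne.symm hne)) hl (c' := c') (l' := l') ?_
    rw [← hsl2, ← hsl, map_sub]; ring
  have hy : ∀ j : ℤ, (zX ^ l) ^ j ∈ Lm l.natAbs := by
    intro j
    rcases Int.natAbs_eq l with h | h
    · have := Lm_zpow l.natAbs j
      rw [← zpow_natCast, ← h] at this
      exact this
    · have := Lm_zpow l.natAbs (-j)
      rw [← zpow_natCast, ← zpow_mul, show (l.natAbs : ℤ) * -j = l * j by rw [h]; simp] at this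
      rwa [zpow_mul] at this
  have hsm : s ∈ Lm l.natAbs := by
    rw [hsl']
    refine Subalgebra.add_mem _ (Subalgebra.algebraMap_mem _ _) (Subalgebra.mul_mem _ (Subalgebra.algebraMap_mem _ _) ?_)
    simpa using hy 1
  refine ⟨l.natAbs, by omega, fun i => ?_, ?_⟩
  · have hBne : B i ≠ 0 := by intro h; apply hB i; rw [h, map_zero]
    obtain ⟨q, hq, hq'⟩ := exists_eq_pow_rootMultiplicity_mul_and_not_dvd (B i) hBne μ
    have hqd : q.natDegree = 0 := by
      by_contra hqd
      obtain ⟨ν, hν⟩ := IsAlgClosed.exists_root q (by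
        intro h; exact hqd (natDegree_eq_of_degree_eq_some h))
      have : ν = μ := hroots i ν (by
        rw [hq, IsRoot, eval_mul, hν.eq_zero, mul_zero])
      subst this
      exact hq' (dvd_iff_isRoot.2 hν)
    set e := rootMultiplicity μ (B i)
    rw [eq_C_of_natDegree_eq_zero hqd] at hq
    have h1 := hAB i
    have h2 := hB i
    have h3 : aeval s (B i) = (algebraMap ℂ KK c * zX ^ l) ^ e * algebraMap ℂ KK (q.coeff 0) := by
      rw [hq, map_mul, map_pow, ← hsl]; simp
    rw [h3] at h1 h2
    have h4 : α i = aeval s (A i) * (algebraMap ℂ KK ((c ^ e * q.coeff 0)⁻¹) * (zX ^ l) ^ (-(e : ℤ))) := by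
      have hq0 := right_ne_zero_of_mul h2
      have hz := zpow_ne_zero l zX_ne
      rw [← h1, map_inv₀, map_mul, map_pow, zpow_neg, zpow_natCast]
      field_simp
      rw [mul_pow, mul_assoc]
    rw [h4]
    exact Subalgebra.mul_mem _ (aeval_mem_sub hsm _) (Subalgebra.mul_mem _ (Subalgebra.algebraMap_mem _ _) (hy _))
  · set E := IntermediateField.adjoin ℂ (range α) with hE
    have h1 : zX ^ l ∈ E := by
      have : zX ^ l = (s - algebraMap ℂ KK μ) * (algebraMap ℂ KK c)⁻¹ := by
        rw [hsl]; field_simp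
      rw [this]
      exact E.mul_mem (E.sub_mem hsE (E.algebraMap_mem μ)) (E.inv_mem (E.algebraMap_mem c))
    rcases Int.natAbs_eq l with h | h
    · rw [← zpow_natCast, ← h]; exact h1
    · rw [← zpow_natCast, show (l.natAbs : ℤ) = -l by omega, zpow_neg]; exact E.inv_mem h1

end Ctr
end
end

section
open MeasureTheory Set Filter Topology
noncomputable section
namespace Ctr
set_option linter.unusedVariables false
open Polynomial

open Classical in
def evL (z : ℂ) (f : KK) : ℂ :=
  if h : f ∈ Lam0 then (mem_L.1 h).choose_spec.choose.eval z / z ^ (mem_L.1 h).choose else 0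

lemma evL_eq {z : ℂ} (hz : z ≠ 0) {f : KK} {k : ℕ} {p : ℂ[X]} (h : f * zX ^ k = pK p) :
    evL z f = p.eval z / z ^ k := by
  have hf : f ∈ Lam0 := mem_L.2 ⟨k, p, h⟩
  rw [evL, dif_pos hf]
  set k' := (mem_L.1 hf).choose
  set q := (mem_L.1 hf).choose_spec.choose
  have hq : f * zX ^ k' = pK q := (mem_L.1 hf).choose_spec.choose_spec
  have h1 : q * X ^ k = p * X ^ k' := by
    apply pK_inj
    rw [pK_mul, pK_mul, pK_Xpow, pK_Xpow, ← h, ← hq]; ring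
  have h2 := congrArg (eval z) h1
  simp only [eval_mul, eval_pow, eval_X] at h2
  rw [div_eq_div_iff (pow_ne_zero _ hz) (pow_ne_zero _ hz), h2]

lemma evL_add {z : ℂ} (hz : z ≠ 0) {f g : KK} (hf : f ∈ Lam0) (hg : g ∈ Lam0) :
    evL z (f + g) = evL z f + evL z g := by
  obtain ⟨k, p, hp⟩ := mem_L.1 hf
  obtain ⟨k', q, hq⟩ := mem_L.1 hg
  rw [evL_eq hz hp, evL_eq hz hq, evL_eq hz (k := k + k') (p := p * X ^ k' + q * X ^ k)]
  · have := pow_ne_zero k hz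
    have := pow_ne_zero k' hz
    simp only [eval_add, eval_mul, eval_pow, eval_X]
    field_simp
    rw [pow_add]; ring
  · have : pK (p * X ^ k' + q * X ^ k) = pK (p * X ^ k') + pK (q * X ^ k) := map_add _ _ _
    rw [this, pK_mul, pK_mul, pK_Xpow, pK_Xpow, ← hp, ← hq]; ring

lemma evL_mul {z : ℂ} (hz : z ≠ 0) {f g : KK} (hf : f ∈ Lam0) (hg : g ∈ Lam0) :
    evL z (f * g) = evL z f * evL z g := by
  obtain ⟨k, p, hp⟩ := mem_L.1 hf
  obtain ⟨k', q, hq⟩ := mem_L.1 hg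
  rw [evL_eq hz hp, evL_eq hz hq, evL_eq hz (k := k + k') (p := p * q)]
  · rw [eval_mul, pow_add, div_mul_div_comm]
  · rw [pK_mul, ← hp, ← hq]; ring

lemma evL_alg {z : ℂ} (hz : z ≠ 0) (c : ℂ) : evL z (algebraMap ℂ KK c) = c := by
  rw [evL_eq hz (k := 0) (p := C c)]
  · simp
  · rw [pK_C]; simp

lemma evL_zpow {z : ℂ} (hz : z ≠ 0) (l : ℤ) : evL z (zX ^ l) = z ^ l := by
  obtain ⟨k, rfl | rfl⟩ := l.eq_nat_or_neg
  · rw [evL_eq hz (k := 0) (p := X ^ k)]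
    · simp
    · rw [pK_Xpow]; simp
  · rw [evL_eq hz (k := k) (p := 1)]
    · simp
    · rw [zpow_neg, zpow_natCast, inv_mul_cancel₀ (pow_ne_zero _ zX_ne)]; simp [pK]

lemma evL_pK {z : ℂ} (hz : z ≠ 0) (p : ℂ[X]) : evL z (pK p) = p.eval z := by
  rw [evL_eq hz (k := 0) (p := p)]
  · simp
  · simp

/-- evaluation as an algebra hom -/
def evH (z : ℂ) (hz : z ≠ 0) : Lam0 →ₐ[ℂ] ℂ where
  toFun f := evL z f
  map_one' := by
    have := evL_alg hz 1
    rw [map_one] at this; exact this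
  map_zero' := by
    have := evL_alg hz 0
    rw [map_zero] at this; exact this
  map_add' f g := evL_add hz f.2 g.2
  map_mul' f g := evL_mul hz f.2 g.2
  commutes' c := evL_alg hz c

lemma aevalL_mem {n : ℕ} {α : Fin n → KK} {R : Subalgebra ℂ KK} (hα : ∀ i, α i ∈ R) (P : MvPolynomial (Fin n) ℂ) :
    MvPolynomial.aeval α P = ((MvPolynomial.aeval (fun i => (⟨α i, hα i⟩ : R)) P : R) : KK) := by
  rw [← Subalgebra.coe_val]
  have := MvPolynomial.map_aeval (fun i => (⟨α i, hα i⟩ : R)) (R.val : R →+* KK) P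
  have h2 := MvPolynomial.comp_aeval_apply (fun i => (⟨α i, hα i⟩ : R)) R.val P
  rw [h2]; rfl

lemma aevalL_mem' {n : ℕ} {α : Fin n → KK} {R : Subalgebra ℂ KK} (hα : ∀ i, α i ∈ R) (P : MvPolynomial (Fin n) ℂ) :
    MvPolynomial.aeval α P ∈ R := by
  rw [aevalL_mem hα]; exact Subtype.property _

lemma evL_aeval {n : ℕ} {α : Fin n → KK} (hα : ∀ i, α i ∈ Lam0) (P : MvPolynomial (Fin n) ℂ)
    {z : ℂ} (hz : z ≠ 0) :
    evL z (MvPolynomial.aeval α P) = MvPolynomial.aeval (fun i => evL z (α i)) P := by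
  rw [aevalL_mem hα]
  have h2 := MvPolynomial.comp_aeval_apply (fun i => (⟨α i, hα i⟩ : Lam0)) (evH z hz) P
  exact h2

lemma evL_paeval {s : KK} (hs : s ∈ Lam0) (A : ℂ[X]) {z : ℂ} (hz : z ≠ 0) :
    evL z (aeval s A) = A.eval (evL z s) := by
  have h1 : aeval s A = ((aeval (⟨s, hs⟩ : Lam0) A : Lam0) : KK) := by
    rw [← Subalgebra.coe_val, ← aeval_algHom_apply]; rfl
  rw [h1]
  have h2 := aeval_algHom_apply (evH z hz) (⟨s, hs⟩ : Lam0) A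
  rw [← coe_aeval_eq_eval]
  exact h2.symm

/-- `e^{2πix/T}` -/
def ez (T : ℝ) (x : ℂ) : ℂ := Complex.exp (2 * (Real.pi : ℂ) * Complex.I / (T : ℂ) * x)
lemma ez_ne (T : ℝ) (x : ℂ) : ez T x ≠ 0 := Complex.exp_ne_zero _
lemma ez_deriv (T : ℝ) (x : ℂ) : HasDerivAt (ez T) (2 * (Real.pi : ℂ) * Complex.I / (T : ℂ) * ez T x) x := by
  unfold ez
  have := ((hasDerivAt_id x).const_mul (2 * (Real.pi : ℂ) * Complex.I / (T : ℂ))).cexp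
  simp only [id, mul_one] at this
  exact this.congr_deriv (mul_comm _ _)
lemma ez_cont (T : ℝ) : Continuous (ez T) := by unfold ez; fun_prop
lemma ez_per {T : ℝ} (hT : 0 < T) (x : ℂ) : ez T (x + T) = ez T x := by
  unfold ez
  have : (T : ℂ) ≠ 0 := by exact_mod_cast hT.ne'
  rw [mul_add, div_mul_cancel₀ _ this, Complex.exp_periodic]
lemma ez_zero (T : ℝ) : ez T 0 = 1 := by simp [ez]
lemma ez_add (T : ℝ) (x y : ℂ) : ez T (x + y) = ez T x * ez T y := by
  unfold ez; rw [mul_add, Complex.exp_add]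
lemma ez_int (T : ℝ) (x : ℂ) (l : ℤ) : ez T (l * x) = ez T x ^ l := by
  unfold ez; rw [← Complex.exp_int_mul]; congr 1; ring

lemma int_ez_zpow {T : ℝ} (hT : 0 < T) {j : ℤ} (hj : j ≠ 0) : ∫ x in (0:ℝ)..T, ez T x ^ j = 0 := by
  have hT' : (T : ℂ) ≠ 0 := by exact_mod_cast hT.ne'
  have hc : 2 * (Real.pi : ℂ) * Complex.I / (T : ℂ) * j ≠ 0 := by
    have : (Real.pi : ℂ) ≠ 0 := by exact_mod_cast Real.pi_ne_zero
    have hj' : (j : ℂ) ≠ 0 := by exact_mod_cast hj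
    have := Complex.I_ne_zero
    simp [*]
  have h1 : ∀ x : ℝ, ez T x ^ j = Complex.exp (2 * (Real.pi : ℂ) * Complex.I / (T : ℂ) * j * x) := by
    intro x; rw [← ez_int, ez]; congr 1; ring
  simp_rw [h1]
  rw [integral_exp_mul_complex hc, div_eq_zero_iff]
  left
  rw [sub_eq_zero]
  have e1 := ez_int T T j
  have e2 := ez_per hT 0
  rw [zero_add, ez_zero] at e2
  rw [e2, one_zpow, ez] at e1
  rw [Complex.ofReal_zero, mul_zero, Complex.exp_zero, ← e1]
  congr 1; ring

lemma int_poly {T : ℝ} (hT : 0 < T) (p : ℂ[X]) : ∫ x in (0:ℝ)..T, p.eval (ez T x) = T * p.coeff 0 := by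
  have hc := ez_cont T
  induction p using Polynomial.induction_on' with
  | add p q hp hq =>
    simp only [eval_add, coeff_add]
    rw [intervalIntegral.integral_add, hp, hq, mul_add]
    · exact Continuous.intervalIntegrable (by fun_prop) _ _
    · exact Continuous.intervalIntegrable (by fun_prop) _ _
  | monomial k a =>
    simp only [eval_monomial]
    rw [intervalIntegral.integral_const_mul]
    by_cases hk : k = 0
    · subst hk; simp; ring
    · have := int_ez_zpow hT (j := k) (by exact_mod_cast hk)
      simp only [zpow_natCast] at this
      rw [this, coeff_monomial, if_neg hk]; simp

/-- lowest term form -/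
lemma low_form {f : KK} (hf : f ∈ Lam0) (h0 : f ≠ 0) : ∃ (a : ℤ) (p : ℂ[X]), p.coeff 0 ≠ 0 ∧ f = zX ^ a * pK p := by
  obtain ⟨k, p, hp⟩ := mem_L.1 hf
  have hp0 : p ≠ 0 := by
    rintro rfl
    have : pK 0 = 0 := map_zero _
    rw [this, mul_eq_zero] at hp
    exact hp.elim h0 (pow_ne_zero _ zX_ne)
  obtain ⟨q, hq, hq'⟩ := exists_eq_pow_rootMultiplicity_mul_and_not_dvd p hp0 0
  rw [C_0, sub_zero] at hq hq'
  rw [X_dvd_iff] at hq'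
  set e := rootMultiplicity 0 p
  refine ⟨e - k, q, hq', ?_⟩
  rw [hq, pK_mul, pK_Xpow] at hp
  have hz := pow_ne_zero k zX_ne
  rw [zpow_sub₀ zX_ne, zpow_natCast, zpow_natCast, div_mul_eq_mul_div, ← hp, mul_div_cancel_right₀ _ hz]

lemma evL_low {z : ℂ} (hz : z ≠ 0) (a : ℤ) (p : ℂ[X]) : evL z (zX ^ a * pK p) = z ^ a * p.eval z := by
  rw [evL_mul hz (zpow_mem a) (pK_mem p), evL_zpow hz, evL_pK hz]

lemma deriv_low (T : ℝ) (a : ℤ) (p : ℂ[X]) (x : ℂ) :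
    HasDerivAt (fun x => evL (ez T x) (zX ^ a * pK p))
      (2 * (Real.pi : ℂ) * Complex.I / (T : ℂ) * (ez T x ^ a * (C (a : ℂ) * p + X * derivative p).eval (ez T x))) x := by
  have h1 : (fun x => evL (ez T x) (zX ^ a * pK p)) = fun x => ez T x ^ a * p.eval (ez T x) := by
    funext x; exact evL_low (ez_ne T x) a p
  rw [h1]
  have hz := ez_ne T x
  have h2 := (hasDerivAt_zpow a (ez T x) (Or.inl hz)).comp x (ez_deriv T x)
  have h3 := (p.hasDerivAt (ez T x)).comp x (ez_deriv T x)
  refine (h2.mul h3).congr_deriv ?_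
  simp only [Function.comp, eval_add, eval_mul, eval_C, eval_X]
  rw [zpow_sub_one₀ hz]
  field_simp

/-- the moment functional -/
def mom (T : ℝ) {n : ℕ} (φ : Fin n → ℂ → ℂ) (P : MvPolynomial (Fin n) ℂ) (i : Fin n) : ℂ :=
  ∫ x in (0:ℝ)..T, MvPolynomial.aeval (fun j => φ j x) P * deriv (φ i) x

def feL (T : ℝ) {n : ℕ} (α : Fin n → KK) (i : Fin n) (x : ℂ) : ℂ := evL (ez T x) (α i)

lemma mom_feL (T : ℝ) {n : ℕ} {α : Fin n → KK} (hα : ∀ i, α i ∈ Lam0) (P : MvPolynomial (Fin n) ℂ) (i : Fin n) :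
    mom T (feL T α) P i = ∫ x in (0:ℝ)..T, evL (ez T x) (MvPolynomial.aeval α P) * deriv (feL T α i) x := by
  unfold mom
  congr 1; funext x
  rw [evL_aeval hα P (ez_ne T x)]; rfl

/-- key nonvanishing computation -/
lemma mom_ne {T : ℝ} (hT : 0 < T) {n : ℕ} {α : Fin n → KK} (hα : ∀ i, α i ∈ Lam0)
    {P : MvPolynomial (Fin n) ℂ} {i : Fin n} {K : ℕ} (hK : 0 < K) {p R : ℂ[X]}
    (hi : α i = zX ^ (-(K:ℤ)) * pK p) (hp : p.coeff 0 ≠ 0) (hR : R.coeff 0 ≠ 0)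
    (hP : MvPolynomial.aeval α P = zX ^ (K:ℤ) * pK R) : mom T (feL T α) P i ≠ 0 := by
  rw [mom_feL T hα, hP]
  have h1 : ∀ x : ℝ, evL (ez T x) (zX ^ (K:ℤ) * pK R) * deriv (feL T α i) x =
      2 * (Real.pi : ℂ) * Complex.I / (T : ℂ) * (R * (C ((-(K:ℤ) : ℤ) : ℂ) * p + X * derivative p)).eval (ez T x) := by
    intro x
    have h2 : feL T α i = fun x => evL (ez T x) (zX ^ (-(K:ℤ)) * pK p) := by
      funext x; rw [feL, hi]
    rw [h2, (deriv_low T _ _ _).deriv, evL_low (ez_ne T x), eval_mul]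
    have hz := ez_ne T x
    rw [zpow_neg]
    field_simp
  simp_rw [h1]
  rw [intervalIntegral.integral_const_mul, int_poly hT, mul_coeff_zero, coeff_add, mul_coeff_zero, mul_coeff_zero]
  have hT' : (T : ℂ) ≠ 0 := by exact_mod_cast hT.ne'
  have : (Real.pi : ℂ) ≠ 0 := by exact_mod_cast Real.pi_ne_zero
  have hj' : (K : ℂ) ≠ 0 := by exact_mod_cast hK.ne'
  have := Complex.I_ne_zero
  simp only [coeff_C_zero, coeff_X_zero, zero_mul, add_zero, Int.cast_neg, Int.cast_natCast]
  simp [*]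

end Ctr
end
end

section
open MeasureTheory Set Filter Topology
noncomputable section
namespace Ctr
set_option linter.unusedVariables false
open Polynomial

def DegL {n : ℕ} (α : Fin n → KK) : Prop := ∃ s ∈ Lam0, ∀ i, ∃ A : ℂ[X], α i = aeval s A

lemma pole0 {m : ℕ} {f : KK} (h : f ∈ Lm m) :
    (∃ A : ℂ[X], f = aeval (zX ^ m) A) ∨
      ∃ (k : ℕ) (p : ℂ[X]), 0 < k ∧ p.coeff 0 ≠ 0 ∧ f * (zX ^ m) ^ k = aeval (zX ^ m) p := by
  obtain ⟨k, p, h⟩ := h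
  have hz : zX ^ m ≠ 0 := pow_ne_zero _ zX_ne
  induction k generalizing p with
  | zero => exact Or.inl ⟨p, by simpa using h⟩
  | succ k ih =>
    by_cases hp : p.coeff 0 = 0
    · obtain ⟨q, rfl⟩ := X_dvd_iff.2 hp
      apply ih q
      rw [map_mul, aeval_X, pow_succ] at h
      apply mul_left_cancel₀ hz
      rw [← h]; ring
    · exact Or.inr ⟨k + 1, p, by omega, hp, h⟩

lemma poleInf {m : ℕ} {f : KK} (h : f ∈ Lm m) :
    (∃ A : ℂ[X], f = aeval (zX ^ m)⁻¹ A) ∨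
      ∃ (k : ℕ) (p : ℂ[X]), k < p.natDegree ∧ f * (zX ^ m) ^ k = aeval (zX ^ m) p := by
  obtain ⟨k, p, h⟩ := h
  have hz : zX ^ m ≠ 0 := pow_ne_zero _ zX_ne
  by_cases hk : k < p.natDegree
  · exact Or.inr ⟨k, p, hk, h⟩
  · left
    refine ⟨p.reflect k, ?_⟩
    let _ : Invertible (zX ^ m) := invertibleOfNonzero hz
    have := eval₂_reflect_mul_pow (algebraMap ℂ KK) (zX ^ m) k p (by omega)
    rw [invOf_eq_inv] at this
    apply mul_right_cancel₀ (pow_ne_zero k hz)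
    rw [h]; exact this.symm

lemma cond1 {R : Subalgebra ℂ KK} {y G H : KK} (hG : G ∈ R) (hH : H ∈ R) (hH0 : H ≠ 0) (hy : y * H = G)
    (hi : IsIntegral R y) : ∃ g ∈ R, g ≠ 0 ∧ ∀ j : ℕ, g * y ^ j ∈ R := by
  obtain ⟨P, hP, h0⟩ := hi
  rw [eval₂_eq_sum_range, Finset.sum_range_succ] at h0
  have hl : P.coeff P.natDegree = 1 := hP
  rw [hl, map_one, one_mul] at h0
  set d := P.natDegree
  refine ⟨H ^ d, R.pow_mem hH d, pow_ne_zero _ hH0, fun j => ?_⟩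
  induction j using Nat.strong_induction_on with
  | _ j ih =>
    by_cases hj : j < d
    · obtain ⟨e, he⟩ : ∃ e, d = j + e := Nat.exists_eq_add_of_le hj.le
      have : H ^ d * y ^ j = G ^ j * H ^ e := by
        rw [← hy, he, mul_pow, pow_add]; ring
      rw [this]
      exact R.mul_mem (R.pow_mem hG _) (R.pow_mem hH _)
    · obtain ⟨e, rfl⟩ : ∃ e, j = d + e := Nat.exists_eq_add_of_le (by omega)
      have h1 : H ^ d * y ^ (d + e) = ∑ i ∈ Finset.range d, -((P.coeff i : KK) * (H ^ d * y ^ (i + e))) := by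
        have h2 : y ^ d = - ∑ x ∈ Finset.range d, (algebraMap R KK) (P.coeff x) * y ^ x :=
          eq_neg_of_add_eq_zero_right h0
        rw [pow_add, h2, Finset.sum_neg_distrib, neg_mul, mul_neg, Finset.sum_mul, Finset.mul_sum]
        congr 1
        apply Finset.sum_congr rfl
        intro i _
        rw [pow_add]
        show _ * ((P.coeff i : KK) * _ * _) = _
        ring
      rw [h1]
      apply R.sum_mem
      intro i hi
      apply R.neg_mem
      exact R.mul_mem (P.coeff i).2 (ih _ (by have := Finset.mem_range.1 hi; omega))

lemma nondeg {n : ℕ} {α : Fin n → KK} (hα : ∀ i, α i ∈ Lam0) (hd : ¬ DegL α) :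
    ∃ m : ℕ, 0 < m ∧ (∀ i, α i ∈ Lm m) ∧
      (∃ (i0 : Fin n) (K : ℕ) (p : ℂ[X]), 0 < K ∧ p.coeff 0 ≠ 0 ∧ α i0 = zX ^ (-(K:ℤ)) * pK p) ∧
      ∃ (g : KK) (G : ℤ → MvPolynomial (Fin n) ℂ), g ≠ 0 ∧ ∀ j, MvPolynomial.aeval α (G j) = g * (zX ^ m) ^ j := by
  rcases dichotomy α hα with h | ⟨m, hm, hL, hE⟩
  · exact absurd h hd
  have hz : zX ^ m ≠ 0 := pow_ne_zero _ zX_ne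
  have hzL : zX ^ m ∈ Lam0 := by have := zpow_mem m; rwa [zpow_natCast] at this
  have hzL' : (zX ^ m)⁻¹ ∈ Lam0 := by have := zpow_mem (-m); rwa [zpow_neg, zpow_natCast] at this
  obtain ⟨i0, k0, p0, hk0, hp0, h0⟩ : ∃ i0, ∃ (k : ℕ) (p : ℂ[X]), 0 < k ∧ p.coeff 0 ≠ 0 ∧ α i0 * (zX ^ m) ^ k = aeval (zX ^ m) p := by
    by_contra hcon
    apply hd
    refine ⟨_, hzL, fun i => ?_⟩
    exact (pole0 (hL i)).resolve_right (fun h => hcon ⟨i, h⟩)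
  obtain ⟨i1, k1, p1, hk1, h1⟩ : ∃ i0, ∃ (k : ℕ) (p : ℂ[X]), k < p.natDegree ∧ α i0 * (zX ^ m) ^ k = aeval (zX ^ m) p := by
    by_contra hcon
    apply hd
    refine ⟨_, hzL', fun i => ?_⟩
    exact (poleInf (hL i)).resolve_right (fun h => hcon ⟨i, h⟩)
  refine ⟨m, hm, hL, ⟨i0, m * k0, expand ℂ m p0, by positivity, ?_, ?_⟩, ?_⟩
  · have := coeff_expand_mul hm p0 0
    rw [zero_mul] at this
    rwa [this]
  · rw [← aeval_zX, expand_aeval, ← h0, zpow_neg, zpow_natCast, pow_mul]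
    field_simp
  · set R := (MvPolynomial.aeval (R := ℂ) α).range
    have hαR : ∀ i, α i ∈ R := fun i => ⟨MvPolynomial.X i, by simp⟩
    have hy' : IsIntegral R (zX ^ m)⁻¹ :=
      int_root (hαR i0) p0 (X ^ k0) hz hp0 (by simp [coeff_X_pow, hk0.ne]) (by simpa using h0)
    have hy : IsIntegral R (zX ^ m) :=
      int_deg (hαR i1) p1 (X ^ k1) (by simpa using hk1) (by simpa using h1)
    obtain ⟨r, s, hrs⟩ := (IntermediateField.mem_adjoin_range_iff ℂ α _).1 hE
    have hs : MvPolynomial.aeval α s ≠ 0 := by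
      intro h; rw [h, div_zero] at hrs; exact hz hrs
    have hr : MvPolynomial.aeval α r ≠ 0 := by
      intro h; rw [h, zero_div] at hrs; exact hz hrs
    obtain ⟨g1, hg1, hg1', hg1j⟩ := cond1 (R := R) (y := zX ^ m) ⟨r, rfl⟩ ⟨s, rfl⟩ hs (by
      rw [hrs]; exact div_mul_cancel₀ _ hs) hy
    obtain ⟨g2, hg2, hg2', hg2j⟩ := cond1 (R := R) (y := (zX ^ m)⁻¹) ⟨s, rfl⟩ ⟨r, rfl⟩ hr (by
      rw [hrs, inv_div]; exact div_mul_cancel₀ _ hr) hy'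
    have : ∀ j : ℤ, ∃ Q, MvPolynomial.aeval (R := ℂ) α Q = g1 * g2 * (zX ^ m) ^ j := by
      intro j
      have : g1 * g2 * (zX ^ m) ^ j ∈ R := by
        obtain ⟨k, rfl | rfl⟩ := j.eq_nat_or_neg
        · rw [zpow_natCast, mul_right_comm]
          exact R.mul_mem (hg1j k) hg2
        · rw [zpow_neg, zpow_natCast, ← inv_pow, mul_assoc]
          exact R.mul_mem hg1 (hg2j k)
      exact this
    choose G hG using this
    exact ⟨g1 * g2, G, mul_ne_zero hg1' hg2', hG⟩

theorem lemN {T : ℝ} (hT : 0 < T) {n : ℕ} {α : Fin n → KK} (hα : ∀ i, α i ∈ Lam0) (hd : ¬ DegL α) :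
    ∃ i0 : Fin n, ∀ P : MvPolynomial (Fin n) ℂ, MvPolynomial.aeval α P ≠ 0 →
      ∃ Q, mom T (feL T α) (P * Q) i0 ≠ 0 := by
  obtain ⟨m, hm, hL, ⟨i0, K, p, hK, hp, hi0⟩, g, G, hg, hG⟩ := nondeg hα hd
  refine ⟨i0, fun P hP => ?_⟩
  obtain ⟨a, pF, hpF, hF⟩ := low_form (aevalL_mem' hα P) hP
  have hgL : g ∈ Lam0 := by
    have := aevalL_mem' hα (G 0)
    rw [hG, zpow_zero, mul_one] at this; exact this
  obtain ⟨b, pg, hpg, hgf⟩ := low_form hgL hg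
  set j : ℕ := a.natAbs + b.natAbs + 1 with hj
  have hmj : (j : ℤ) ≤ m * j := by
    have : 1 * j ≤ m * j := Nat.mul_le_mul_right _ hm
    rw [one_mul] at this; exact_mod_cast this
  obtain ⟨c, hc⟩ : ∃ c : ℕ, (c : ℤ) + 1 = a + b + m * j := by
    refine ⟨(a + b + m * j - 1).toNat, ?_⟩
    omega
  obtain ⟨K', rfl⟩ : ∃ K', K = K' + 1 := ⟨K - 1, by omega⟩
  refine ⟨P ^ K' * (G j) ^ (K' + 1) * (MvPolynomial.X i0) ^ c, ?_⟩
  apply mom_ne hT hα hK hi0 hp (R := pF ^ (K' + 1) * pg ^ (K' + 1) * p ^ c)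
  · have hcp : ∀ (q : ℂ[X]) (e : ℕ), (q ^ e).coeff 0 = q.coeff 0 ^ e := by
      intro q e; simp [coeff_zero_eq_eval_zero]
    simp only [mul_coeff_zero, hcp, Ne, mul_eq_zero, not_or]
    refine ⟨⟨pow_ne_zero _ hpF, pow_ne_zero _ hpg⟩, pow_ne_zero _ hp⟩
  · rw [map_mul, map_mul, map_mul, map_pow, map_pow, map_pow, MvPolynomial.aeval_X, hi0, hG, hF, hgf]
    have e : pK (pF ^ (K' + 1) * pg ^ (K' + 1) * p ^ c) = pK pF ^ (K' + 1) * pK pg ^ (K' + 1) * pK p ^ c := by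
      simp [pK]
    rw [e]
    have e2 : zX ^ ((K' + 1 : ℕ) : ℤ) = (zX ^ a) ^ (K' + 1) * (zX ^ b) ^ (K' + 1) * ((zX ^ m) ^ (j:ℤ)) ^ (K' + 1) * (zX ^ (-((K' + 1 : ℕ) : ℤ))) ^ c := by
      have h1 : (zX ^ m : KK) = zX ^ (m : ℤ) := (zpow_natCast _ _).symm
      rw [h1]
      simp only [← zpow_natCast, ← zpow_mul, ← zpow_add₀ zX_ne]
      congr 1
      push_cast
      linear_combination ((K':ℤ) + 1) * hc
    rw [e2]
    ring

theorem pureS {T : ℝ} (hT : 0 < T) {n : ℕ} {α : Fin n → KK} (hα : ∀ i, α i ∈ Lam0)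
    (h : ∀ P i, mom T (feL T α) P i = 0) : DegL α := by
  by_contra hd
  obtain ⟨i0, h0⟩ := lemN hT hα hd
  obtain ⟨Q, hQ⟩ := h0 1 (by simp)
  exact hQ (h _ _)

end Ctr
end
end

section
open MeasureTheory Set Filter Topology
noncomputable section
namespace Ctr
set_option linter.unusedVariables false
open Polynomial

lemma exists_antideriv (Q : ℂ[X]) : ∃ B : ℂ[X], derivative B = Q := by
  induction Q using Polynomial.induction_on' with
  | add p q hp hq =>
    obtain ⟨B, rfl⟩ := hp
    obtain ⟨B', rfl⟩ := hq
    exact ⟨B + B', derivative_add⟩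
  | monomial k a =>
    refine ⟨monomial (k + 1) (a / (k + 1)), ?_⟩
    rw [derivative_monomial]
    have : ((k : ℂ) + 1) ≠ 0 := by exact_mod_cast Nat.succ_ne_zero k
    simp
    field_simp

lemma int_pull {T : ℝ} (hT : 0 < T) {s : ℂ → ℂ} (hs : Differentiable ℂ s) (Q : ℂ[X]) (x : ℝ) :
    ∃ B : ℂ[X], derivative B = Q ∧ B.eval (s 0) = 0 ∧ ∀ x : ℝ, ∫ y in (0:ℝ)..x, Q.eval (s y) * deriv s y = B.eval (s x) := by
  obtain ⟨B0, hB⟩ := exists_antideriv Q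
  refine ⟨B0 - C (B0.eval (s 0)), by simp [hB], by simp, fun x => ?_⟩
  have h1 : ∀ y : ℝ, HasDerivAt (fun y : ℝ => B0.eval (s y)) (Q.eval (s y) * deriv s y) y := by
    intro y
    have := ((B0.hasDerivAt (s y)).comp (y:ℂ) (hs y).hasDerivAt).comp_ofReal
    rw [hB] at this
    exact this
  have hc : Continuous fun y : ℝ => Q.eval (s y) * deriv s y := by
    have h2 : Continuous s := hs.continuous
    have h3 : Continuous (deriv s) := hs.deriv.continuous
    fun_prop
  rw [intervalIntegral.integral_eq_sub_of_hasDerivAt (fun y _ => h1 y) (hc.intervalIntegrable _ _)]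
  simp

lemma mom_pull {T : ℝ} (hT : 0 < T) {n : ℕ} {φ : Fin n → ℂ → ℂ} {s : ℂ → ℂ} (hs : Differentiable ℂ s)
    (hper : s T = s 0) (A : Fin n → ℂ[X]) (hφ : ∀ i x, φ i x = (A i).eval (s x)) (P : MvPolynomial (Fin n) ℂ) (i : Fin n) :
    mom T φ P i = 0 := by
  obtain ⟨B, hB, hB0, hB'⟩ := int_pull hT hs (MvPolynomial.aeval A P * derivative (A i)) 0
  unfold mom
  rw [← hB0, ← hper, ← hB']
  congr 1; funext y
  have h1 : φ i = fun x => (A i).eval (s x) := funext (hφ i)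
  have h2 : deriv (φ i) y = (derivative (A i)).eval (s y) * deriv s y := by
    rw [h1]
    exact (((A i).hasDerivAt (s y)).comp (y:ℂ) (hs y).hasDerivAt).deriv
  have h3 : MvPolynomial.aeval (fun j => φ j y) P = (MvPolynomial.aeval A P).eval (s y) := by
    have := MvPolynomial.comp_aeval_apply A (aeval (R := ℂ) (s y)) P
    rw [coe_aeval_eq_eval] at this
    rw [this]
    congr 2; funext j; exact hφ j y
  rw [h2, h3, eval_mul]; ring

lemma feL_form (T : ℝ) {f : KK} (hf : f ∈ Lam0) : ∃ (k : ℕ) (p : ℂ[X]), ∀ x, evL (ez T x) f = p.eval (ez T x) / ez T x ^ k := by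
  obtain ⟨k, p, h⟩ := mem_L.1 hf
  exact ⟨k, p, fun x => evL_eq (ez_ne T x) h⟩

lemma ez_diff (T : ℝ) : Differentiable ℂ (ez T) := fun x => (ez_deriv T x).differentiableAt

lemma feL_diff (T : ℝ) {f : KK} (hf : f ∈ Lam0) : Differentiable ℂ (fun x => evL (ez T x) f) := by
  obtain ⟨k, p, h⟩ := feL_form T hf
  simp_rw [h]
  have := ez_diff T
  intro x
  have hk := pow_ne_zero k (ez_ne T x)
  refine DifferentiableAt.div ?_ (((ez_diff T) x).pow k) hk
  exact (p.differentiable _).comp x (ez_diff T x)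

lemma feL_per {T : ℝ} (hT : 0 < T) (f : KK) (x : ℂ) : evL (ez T (x + T)) f = evL (ez T x) f := by
  rw [ez_per hT]

lemma mom_deg {T : ℝ} (hT : 0 < T) {n : ℕ} {α : Fin n → KK} (h : DegL α) (P : MvPolynomial (Fin n) ℂ) (i : Fin n) :
    mom T (feL T α) P i = 0 := by
  obtain ⟨s, hs, hA⟩ := h
  choose A hA using hA
  refine mom_pull hT (feL_diff T hs) ?_ A ?_ P i
  · have := feL_per hT s 0
    rwa [zero_add] at this
  · intro i x
    rw [feL, hA, evL_paeval hs _ (ez_ne T x)]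

lemma ker_sub {T : ℝ} (hT : 0 < T) {n : ℕ} {α β : Fin n → KK} (hα : ∀ i, α i ∈ Lam0) (hβ : ∀ i, β i ∈ Lam0)
    (hm : ∀ P i, mom T (feL T α) P i = mom T (feL T β) P i) (hd : ¬ DegL β) (P : MvPolynomial (Fin n) ℂ)
    (hP : MvPolynomial.aeval α P = 0) : MvPolynomial.aeval β P = 0 := by
  by_contra hne
  obtain ⟨i0, h0⟩ := lemN hT hβ hd
  obtain ⟨Q, hQ⟩ := h0 P hne
  apply hQ
  rw [← hm, mom_feL T hα, map_mul, hP, zero_mul]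
  have : ∀ x, evL (ez T x) 0 = 0 := by
    intro x
    have := evL_alg (ez_ne T x) 0
    rwa [map_zero] at this
  simp [this]

lemma unit_of_bdd {F r : KK} (hF : F ≠ 0) (h : ∀ j : ℕ, F * r ^ j ∈ Lam0) : r ∈ Lam0 := by
  obtain ⟨k, p, hp⟩ := mem_L.1 (by simpa using h 0)
  have hp0 : p ≠ 0 := by
    rintro rfl
    have : pK 0 = 0 := map_zero _
    rw [this, mul_eq_zero] at hp
    exact hp.elim hF (pow_ne_zero _ zX_ne)
  set N := r.num
  set D := r.denom
  have hD0 : D ≠ 0 := r.denom_ne_zero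
  have hD : pK D ≠ 0 := fun h => hD0 (pK_inj (by rw [h]; simp [pK]))
  have hr : r * pK D = pK N := by
    conv_lhs => rw [← RatFunc.num_div_denom r]
    exact div_mul_cancel₀ _ hD
  obtain ⟨D', hD', hnd⟩ := exists_eq_pow_rootMultiplicity_mul_and_not_dvd D hD0 0
  rw [C_0, sub_zero] at hD' hnd
  set e := rootMultiplicity 0 D
  set j := p.natDegree + 1
  obtain ⟨k', q, hq⟩ := mem_L.1 (h j)
  have h1 : p * X ^ k' * N ^ j = q * D ^ j * X ^ k := by
    apply pK_inj
    have e1 : ∀ (A : ℂ[X]) (i : ℕ), pK (A ^ i) = pK A ^ i := fun A i => map_pow _ _ _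
    rw [pK_mul, pK_mul, pK_mul, pK_mul, pK_Xpow, pK_Xpow, e1, e1, ← hp, ← hq, ← hr, mul_pow]; ring
  have hcopX : IsCoprime D' X := by
    rw [isCoprime_comm]
    exact (prime_X.irreducible.coprime_iff_not_dvd).2 hnd
  have hcopN : IsCoprime D' N := by
    have := r.isCoprime_num_denom.symm
    change IsCoprime D N at this
    rw [hD'] at this
    exact this.of_mul_left_right
  have h2 : D' ^ j ∣ p := by
    have h3 : D' ^ j ∣ p * X ^ k' * N ^ j := by
      rw [h1]
      apply Dvd.dvd.mul_right
      apply Dvd.dvd.mul_left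
      exact pow_dvd_pow_of_dvd (Dvd.intro_left _ hD'.symm) j
    have h4 := (hcopN.pow (m := j) (n := j)).dvd_of_dvd_mul_right h3
    exact (hcopX.pow (m := j) (n := k')).dvd_of_dvd_mul_right h4
  have h5 := natDegree_le_of_dvd h2 hp0
  rw [natDegree_pow] at h5
  have h6 : D'.natDegree = 0 := by
    by_contra hne
    have : 1 ≤ D'.natDegree := Nat.one_le_iff_ne_zero.2 hne
    have : j * 1 ≤ j * D'.natDegree := Nat.mul_le_mul_left _ this
    omega
  rw [eq_C_of_natDegree_eq_zero h6] at hD'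
  set d := D'.coeff 0
  have hd0 : d ≠ 0 := by
    intro h; rw [h, C_0, mul_zero] at hD'; exact hD0 hD'
  refine mem_L.2 ⟨e, N * C d⁻¹, ?_⟩
  rw [pK_mul, ← hr, hD', pK_mul, pK_Xpow, pK_C, pK_C, map_inv₀]
  have : algebraMap ℂ KK d ≠ 0 := by rwa [Ne, map_eq_zero]
  field_simp

lemma int_laurent {T : ℝ} (hT : 0 < T) (S : ℂ[X]) (N : ℕ) {c : ℂ} (hc : c ≠ 0) {l : ℤ} (hl : l ≠ 0) :
    ∫ x in (0:ℝ)..T, S.eval (c * ez T x ^ l) / (c * ez T x ^ l) ^ N = T * S.coeff N := by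
  have hcont : Continuous fun x : ℝ => ez T x := (ez_cont T).comp Complex.continuous_ofReal
  have hne : ∀ x : ℝ, ez T x ≠ 0 := fun x => ez_ne T x
  have hcl : Continuous fun x : ℝ => c * ez T x ^ l := continuous_const.mul (hcont.zpow₀ l (fun x => Or.inl (hne x)))
  have hne' : ∀ x : ℝ, c * ez T x ^ l ≠ 0 := fun x => mul_ne_zero hc (zpow_ne_zero _ (hne x))
  induction S using Polynomial.induction_on' with
  | add p q hp hq =>
    simp only [eval_add, coeff_add, add_div]
    rw [intervalIntegral.integral_add, hp, hq, mul_add]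
    · exact Continuous.intervalIntegrable (Continuous.div (p.continuous.comp hcl) (hcl.pow N) (fun x => pow_ne_zero _ (hne' x))) _ _
    · exact Continuous.intervalIntegrable (Continuous.div (q.continuous.comp hcl) (hcl.pow N) (fun x => pow_ne_zero _ (hne' x))) _ _
  | monomial k a =>
    have h1 : ∀ x : ℝ, eval (c * ez T x ^ l) (monomial k a) / (c * ez T x ^ l) ^ N =
        (a * c ^ ((k:ℤ) - N)) * ez T x ^ (l * ((k:ℤ) - N)) := by
      intro x
      rw [eval_monomial, zpow_mul, mul_assoc, ← mul_zpow, zpow_sub₀ (hne' x), zpow_natCast, zpow_natCast, mul_div_assoc]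
    simp_rw [h1]
    rw [intervalIntegral.integral_const_mul, coeff_monomial]
    by_cases hk : k = N
    · subst hk; simp; ring
    · rw [int_ez_zpow hT, if_neg hk]
      · simp
      · apply mul_ne_zero hl
        rw [sub_ne_zero]; exact_mod_cast hk

/-- moments of a substitution -/
lemma mom_subst {T : ℝ} (hT : 0 < T) {n : ℕ} {A : Fin n → KK} (hA : ∀ i, A i ∈ Lam0)
    (P : MvPolynomial (Fin n) ℂ) (i : Fin n) :
    ∃ κ : ℂ, ∀ (c : ℂ) (l : ℤ), c ≠ 0 → mom T (fun i x => evL (c * ez T x ^ l) (A i)) P i = l * κ := by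
  obtain ⟨k, p, hp⟩ := mem_L.1 (hA i)
  have hAi : A i = zX ^ (-(k:ℤ)) * pK p := by
    rw [← hp, zpow_neg, zpow_natCast]
    have := pow_ne_zero k zX_ne
    field_simp
  set q := C ((-(k:ℤ) : ℤ) : ℂ) * p + X * derivative p with hq
  have hPm : MvPolynomial.aeval A P ∈ Lam0 := aevalL_mem' hA P
  have hqm : zX ^ (-(k:ℤ)) * pK q ∈ Lam0 := Subalgebra.mul_mem _ (zpow_mem _) (pK_mem _)
  set W := MvPolynomial.aeval A P * (zX ^ (-(k:ℤ)) * pK q) with hW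
  obtain ⟨N, S, hS⟩ := mem_L.1 (Lam0.mul_mem hPm hqm)
  refine ⟨2 * (Real.pi : ℂ) * Complex.I / (T : ℂ) * (T * S.coeff N), fun c l hc => ?_⟩
  have hne' : ∀ x : ℂ, c * ez T x ^ l ≠ 0 := fun x => mul_ne_zero hc (zpow_ne_zero _ (ez_ne T x))
  have hder : ∀ x : ℂ, deriv (fun x => evL (c * ez T x ^ l) (A i)) x =
      2 * (Real.pi : ℂ) * Complex.I / (T : ℂ) * l * evL (c * ez T x ^ l) (zX ^ (-(k:ℤ)) * pK q) := by
    intro x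
    have h1 : (fun x => evL (c * ez T x ^ l) (A i)) = fun x => (c * ez T x ^ l) ^ (-(k:ℤ)) * p.eval (c * ez T x ^ l) := by
      funext x; rw [hAi]; exact evL_low (hne' x) _ p
    rw [h1, evL_low (hne' x)]
    have hz := ez_ne T x
    have h0 : HasDerivAt (fun x => c * ez T x ^ l) (2 * (Real.pi : ℂ) * Complex.I / (T : ℂ) * l * (c * ez T x ^ l)) x := by
      have := ((hasDerivAt_zpow l (ez T x) (Or.inl hz)).comp x (ez_deriv T x)).const_mul c
      refine this.congr_deriv ?_
      rw [zpow_sub_one₀ hz]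
      field_simp
    have h2 := (hasDerivAt_zpow (-(k:ℤ)) (c * ez T x ^ l) (Or.inl (hne' x))).comp x h0
    have h3 := (p.hasDerivAt (c * ez T x ^ l)).comp x h0
    refine ((h2.mul h3).congr_deriv ?_).deriv
    simp only [Function.comp, hq, eval_add, eval_mul, eval_C, eval_X]
    have hu := hne' x
    generalize c * ez T x ^ l = u at hu ⊢
    rw [zpow_sub_one₀ hu]
    field_simp
  unfold mom
  have h4 : ∀ x : ℝ, MvPolynomial.aeval (fun j => evL (c * ez T x ^ l) (A j)) P * deriv (fun x => evL (c * ez T x ^ l) (A i)) x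
      = 2 * (Real.pi : ℂ) * Complex.I / (T : ℂ) * l * (S.eval (c * ez T x ^ l) / (c * ez T x ^ l) ^ N) := by
    intro x
    rw [hder, ← evL_aeval hA P (hne' x), ← evL_eq (hne' x) hS, evL_mul (hne' x) hPm hqm]; ring
  simp_rw [h4]
  rw [intervalIntegral.integral_const_mul]
  by_cases hl : l = 0
  · subst hl; simp
  · rw [int_laurent hT S N hc hl]; ring

theorem pureP {T : ℝ} (hT : 0 < T) {n : ℕ} {α β : Fin n → KK} (hα : ∀ i, α i ∈ Lam0) (hβ : ∀ i, β i ∈ Lam0)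
    (hm : ∀ P i, mom T (feL T α) P i = mom T (feL T β) P i) :
    (DegL α ∧ DegL β) ∨ ∃ xc : ℂ, ∀ i x, feL T β i x = feL T α i (x + xc) := by
  by_cases hda : DegL α
  · exact Or.inl ⟨hda, pureS hT hβ fun P i => by rw [← hm, mom_deg hT hda]⟩
  by_cases hdb : DegL β
  · exact Or.inl ⟨pureS hT hα fun P i => by rw [hm, mom_deg hT hdb], hdb⟩
  right
  have kab := fun P => ker_sub hT hα hβ hm hdb P
  have kba := fun P => ker_sub hT hβ hα (fun P i => (hm P i).symm) hda P
  obtain ⟨m, hm0, hL, -, g, G, hg, hG⟩ := nondeg hα hda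
  have hz : zX ^ m ≠ 0 := pow_ne_zero _ zX_ne
  set F : ℤ → KK := fun j => MvPolynomial.aeval β (G j) with hF
  have hF0 : ∀ j, F j ≠ 0 := by
    intro j h
    have := kba _ h
    rw [hG] at this
    exact mul_ne_zero hg (zpow_ne_zero _ hz) this
  have hrec : ∀ j, F (j + 1) * F 0 = F j * F 1 := by
    intro j
    have := kab (G (j+1) * G 0 - G j * G 1) (by
      simp only [map_sub, map_mul, hG, zpow_add₀ hz, zpow_zero, zpow_one]; ring)
    simp only [map_sub, map_mul] at this
    exact sub_eq_zero.1 this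
  set r := F 1 / F 0 with hr
  have hr0 : r ≠ 0 := div_ne_zero (hF0 1) (hF0 0)
  have hstep : ∀ j, F (j + 1) = F j * r := by
    intro j
    rw [hr, ← mul_div_assoc, ← hrec, mul_div_assoc, div_self (hF0 0), mul_one]
  have hFj : ∀ j : ℤ, F j = F 0 * r ^ j := by
    intro j
    induction j using Int.induction_on with
    | zero => simp
    | succ i ih => rw [hstep, ih, zpow_add_one₀ hr0, mul_assoc]
    | pred i ih =>
      have := hstep (-(i:ℤ) - 1)
      rw [sub_add_cancel, ih] at this
      rw [zpow_sub_one₀ hr0, ← mul_assoc, this, mul_assoc, mul_inv_cancel₀ hr0, mul_one]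
  have hFL : ∀ j, F j ∈ Lam0 := fun j => aevalL_mem' hβ _
  have hrL : r ∈ Lam0 := unit_of_bdd (hF0 0) fun j => by
    have := hFj j
    rw [zpow_natCast] at this
    rw [← this]; exact hFL _
  have hrL' : r⁻¹ ∈ Lam0 := unit_of_bdd (hF0 0) fun j => by
    have := hFj (-j)
    rw [zpow_neg, zpow_natCast, ← inv_pow] at this
    rw [← this]; exact hFL _
  obtain ⟨c, l, hc, hrc⟩ := unit_form hrL hrL' (mul_inv_cancel₀ hr0)
  have hL' : ∀ i, ∃ (k : ℕ) (p : ℂ[X]), α i * (zX ^ m) ^ k = aeval (zX ^ m) p := fun i => hL i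
  choose k p hp using hL'
  have hβ' : ∀ i, β i * r ^ k i = aeval r (p i) := by
    intro i
    have := kab (G (k i) * MvPolynomial.X i - ∑ j ∈ Finset.range ((p i).natDegree + 1), MvPolynomial.C ((p i).coeff j) * G j) (by
      simp only [map_sub, map_mul, map_sum, hG, MvPolynomial.aeval_X, MvPolynomial.aeval_C, zpow_natCast]
      rw [sub_eq_zero]
      calc g * (zX ^ m) ^ k i * α i = g * (α i * (zX ^ m) ^ k i) := by ring
        _ = _ := by
          rw [hp, aeval_eq_sum_range, Finset.mul_sum]
          refine Finset.sum_congr rfl fun j _ => ?_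
          rw [Algebra.smul_def]; ring)
    simp only [map_sub, map_mul, map_sum, MvPolynomial.aeval_X, MvPolynomial.aeval_C] at this
    change F (k i) * β i - ∑ j ∈ Finset.range ((p i).natDegree + 1), algebraMap ℂ KK ((p i).coeff j) * F j = 0 at this
    rw [sub_eq_zero, hFj] at this
    refine mul_left_cancel₀ (hF0 0) ?_
    rw [aeval_eq_sum_range, Finset.mul_sum]
    calc F 0 * (β i * r ^ k i) = F 0 * r ^ (k i : ℤ) * β i := by rw [zpow_natCast]; ring
      _ = _ := this
      _ = _ := by
        refine Finset.sum_congr rfl fun j _ => ?_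
        rw [hFj, Algebra.smul_def, zpow_natCast]; ring
  set A : Fin n → KK := fun i => zX ^ (-(k i : ℤ)) * pK (p i) with hA
  have hAL : ∀ i, A i ∈ Lam0 := fun i => Subalgebra.mul_mem _ (zpow_mem _) (pK_mem _)
  have eα : ∀ i x, feL T α i x = evL (1 * ez T x ^ (m:ℤ)) (A i) := by
    intro i x
    have hx := ez_ne T x
    have h1 : α i * zX ^ (m * k i) = pK (expand ℂ m (p i)) := by
      rw [pow_mul, hp, ← aeval_zX, expand_aeval]
    rw [feL, evL_eq hx h1, one_mul, hA]
    simp only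
    rw [evL_low (zpow_ne_zero _ hx), expand_eval, zpow_natCast, zpow_neg, zpow_natCast, pow_mul]
    rw [div_eq_inv_mul]
  have eβ : ∀ i x, feL T β i x = evL (c * ez T x ^ l) (A i) := by
    intro i x
    have hx := ez_ne T x
    have hu : c * ez T x ^ l ≠ 0 := mul_ne_zero hc (zpow_ne_zero _ hx)
    have h1 := congrArg (evL (ez T x)) (hβ' i)
    have h2 : evL (ez T x) r = c * ez T x ^ l := by
      rw [hrc, evL_mul hx (Subalgebra.algebraMap_mem _ _) (zpow_mem _), evL_alg hx, evL_zpow hx]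
    have h3 : r ^ k i = aeval r (X ^ k i : ℂ[X]) := by simp
    rw [evL_mul hx (hβ i) (Subalgebra.pow_mem _ hrL _), evL_paeval hrL _ hx, h3, evL_paeval hrL _ hx, h2] at h1
    rw [feL, hA]
    simp only
    rw [evL_low hu, ← h1]
    simp only [eval_pow, eval_X]
    rw [zpow_neg, zpow_natCast]
    have := pow_ne_zero (k i) hu
    field_simp
  have e1 : feL T α = fun i x => evL (1 * ez T x ^ (m:ℤ)) (A i) := by funext i x; exact eα i x
  have e2 : feL T β = fun i x => evL (c * ez T x ^ l) (A i) := by funext i x; exact eβ i x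
  obtain ⟨i0, h0⟩ := lemN hT hα hda
  obtain ⟨Q, hQ⟩ := h0 1 (by simp)
  obtain ⟨κ, hκ⟩ := mom_subst hT hAL (1 * Q) i0
  have k1 : mom T (feL T α) (1 * Q) i0 = m * κ := by
    rw [e1, hκ _ _ one_ne_zero]; simp
  have k2 : mom T (feL T β) (1 * Q) i0 = l * κ := by
    rw [e2, hκ _ _ hc]
  have k3 : (m : ℂ) * κ = l * κ := by rw [← k1, ← k2, hm]
  have hκ0 : κ ≠ 0 := by rintro rfl; apply hQ; rw [k1]; simp
  have hlm : l = (m : ℤ) := by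
    have := mul_right_cancel₀ hκ0 k3
    exact_mod_cast this.symm
  have hT' : (T : ℂ) ≠ 0 := by exact_mod_cast hT.ne'
  have hm' : (m : ℂ) ≠ 0 := by exact_mod_cast hm0.ne'
  refine ⟨T / (2 * Real.pi * Complex.I) * Complex.log c / m, fun i x => ?_⟩
  rw [eα, eβ, ez_add, mul_zpow, hlm, ← ez_int, ← ez_int T (_ / _)]
  have : ez T ((m:ℤ) * (T / (2 * Real.pi * Complex.I) * Complex.log c / m)) = c := by
    unfold ez
    rw [← Complex.exp_log hc]
    congr 1
    rw [Complex.exp_log hc]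
    have := Complex.two_pi_I_ne_zero
    push_cast
    have hpi : (Real.pi : ℂ) ≠ 0 := by exact_mod_cast Real.pi_ne_zero
    have := Complex.I_ne_zero
    field_simp
  rw [this]
  congr 1
  ring

end Ctr
end
end

section
open MeasureTheory Set Filter Topology
noncomputable section
namespace Ctr
set_option linter.unusedVariables false

variable {n : ℕ} {T : ℝ} {a : Fin n → ℝ → ℂ}

def fld (a : Fin n → ℝ → ℂ) (t : ℝ) (x : ℂ) : ℂ := ∑ i, a i t * x ^ ((i : ℕ) + 2)

lemma fld_cont (ha : ∀ i, Continuous (a i)) : Continuous fun q : ℝ × ℂ => fld a q.1 q.2 := by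
  unfold fld
  refine continuous_finsetSum _ fun i _ => ?_
  exact ((ha i).comp continuous_fst).mul (continuous_snd.pow _)

lemma fld_lip (ha : ∀ i, Continuous (a i)) (T B : ℝ) :
    ∃ K : NNReal, ∀ t ∈ Icc 0 T, LipschitzOnWith K (fld a t) (Metric.closedBall 0 B) := by
  have hc : Continuous fun q : ℝ × ℂ => ∑ i, a i q.1 * (((i : ℕ) + 2 : ℕ) * q.2 ^ ((i : ℕ) + 1)) := by
    refine continuous_finsetSum _ fun i _ => ?_
    exact ((ha i).comp continuous_fst).mul (continuous_const.mul (continuous_snd.pow _))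
  obtain ⟨K, hK⟩ := (isCompact_Icc (a := (0:ℝ)) (b := T)).prod (isCompact_closedBall (0:ℂ) B) |>.exists_bound_of_continuousOn hc.continuousOn
  have hd : ∀ t x, HasDerivAt (fld a t) (∑ i, a i t * (((i : ℕ) + 2 : ℕ) * x ^ ((i : ℕ) + 1))) x := by
    intro t x
    unfold fld
    refine HasDerivAt.fun_sum fun i _ => ?_
    simpa using (hasDerivAt_pow ((i:ℕ)+2) x).const_mul (a i t)
  refine ⟨K.toNNReal, fun t ht => ?_⟩
  refine (convex_closedBall (0:ℂ) B).lipschitzOnWith_of_nnnorm_deriv_le (𝕜 := ℂ) (fun x _ => (hd t x).differentiableAt) fun x hx => ?_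
  rw [(hd t x).deriv]
  rw [← NNReal.coe_le_coe, coe_nnnorm]
  exact (hK (t, x) ⟨ht, hx⟩).trans (Real.le_coe_toNNReal K)

lemma coef_bd (ha : ∀ i, Continuous (a i)) (T : ℝ) : ∃ C : ℝ, 0 ≤ C ∧ ∀ t ∈ Icc 0 T, ∀ i, ‖a i t‖ ≤ C := by
  have : ∀ i, ∃ C, ∀ t ∈ Icc 0 T, ‖a i t‖ ≤ C := fun i => isCompact_Icc.exists_bound_of_continuousOn (ha i).continuousOn
  choose C hC using this
  refine ⟨∑ i, |C i|, Finset.sum_nonneg fun _ _ => abs_nonneg _, fun t ht i => ?_⟩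
  exact (hC i t ht).trans ((le_abs_self _).trans (Finset.single_le_sum (f := fun i => |C i|) (fun _ _ => abs_nonneg _) (Finset.mem_univ i)))

lemma fld_bd {C : ℝ} (hC0 : 0 ≤ C) {t : ℝ} (hC : ∀ i, ‖a i t‖ ≤ C) {x : ℂ} (hx : ‖x‖ ≤ 1) :
    ‖fld a t x‖ ≤ n * C * ‖x‖ ^ 2 := by
  unfold fld
  refine (norm_sum_le _ _).trans ?_
  calc _ ≤ ∑ i : Fin n, C * ‖x‖ ^ 2 := by
        refine Finset.sum_le_sum fun i _ => ?_
        rw [norm_mul, norm_pow]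
        exact mul_le_mul (hC i) (pow_le_pow_of_le_one (norm_nonneg _) hx (by omega)) (by positivity) hC0
    _ = _ := by simp; ring

def IsSol (T : ℝ) (a : Fin n → ℝ → ℂ) (v : ℝ → ℂ) : Prop :=
  ∀ x ∈ Icc (0:ℝ) T, v x = v 0 + ∫ s in (0:ℝ)..x, fld a s (v s)

lemma sol_small (hT : 0 < T) (ha : ∀ i, Continuous (a i)) : ∃ ε > (0:ℝ), ε ≤ 1 ∧ ∀ v0 : ℂ, ‖v0‖ < ε →
    ∃ v : ℝ → ℂ, v 0 = v0 ∧ Continuous v ∧ IsSol T a v ∧ ∀ x, ‖v x‖ ≤ 2 * ‖v0‖ := by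
  obtain ⟨C, hC0, hC⟩ := coef_bd ha T
  refine ⟨1 / (4 * (n * C * T + 1)), by positivity, ?_, fun v0 hv0 => ?_⟩
  · rw [div_le_one (by positivity)]
    nlinarith [show 0 ≤ n * C * T by positivity]
  have hq : 0 ≤ n * C * T := by positivity
  have h2 : ‖v0‖ * (4 * (n * C * T + 1)) < 1 := by rwa [lt_div_iff₀ (by positivity)] at hv0
  have h1 : 2 * ‖v0‖ ≤ 1 := by nlinarith [norm_nonneg v0, mul_nonneg (norm_nonneg v0) hq]
  obtain ⟨K, hK⟩ := fld_lip ha T 1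
  have hball : ∀ x ∈ Metric.closedBall v0 ‖v0‖, ‖x‖ ≤ 2 * ‖v0‖ := by
    intro x hx
    rw [mem_closedBall_iff_norm] at hx
    have := norm_add_le (x - v0) v0
    rw [sub_add_cancel] at this
    linarith
  have hP : IsPicardLindelof (fld a) (tmin := 0) (tmax := T) ⟨0, le_rfl, hT.le⟩ v0 ‖v0‖₊ 0
      (Real.toNNReal (n * C * (2 * ‖v0‖) ^ 2)) K := by
    constructor
    · intro t ht
      refine (hK t ht).mono fun x hx => ?_
      rw [mem_closedBall_zero_iff]
      exact (hball x hx).trans h1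
    · intro x _
      exact ((fld_cont ha).comp (Continuous.prodMk_left x)).continuousOn
    · intro t ht x hx
      have h3 := hball x hx
      refine (fld_bd hC0 (hC t ht) (h3.trans h1)).trans ?_
      rw [Real.coe_toNNReal _ (by positivity)]
      gcongr
    · rw [Real.coe_toNNReal _ (by positivity)]
      simp only [sub_zero, NNReal.coe_zero, coe_nnnorm]
      rw [max_eq_left (by linarith)]
      have : n * C * (2 * ‖v0‖) ^ 2 * T = ‖v0‖ * (‖v0‖ * (4 * (n * C * T))) := by ring
      rw [this]
      refine mul_le_of_le_one_right (norm_nonneg _) ?_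
      nlinarith [norm_nonneg v0]
  have hx0 : v0 ∈ Metric.closedBall v0 ((0 : NNReal) : ℝ) := by simp
  obtain ⟨α, hα⟩ := ODE.FunSpace.exists_isFixedPt_next hP hx0
  have h0 : α.compProj 0 = v0 := by
    rw [ODE.FunSpace.compProj_of_mem ⟨le_rfl, hT.le⟩]
    exact α.apply_of_zero
  refine ⟨α.compProj, h0, α.continuous_compProj, fun x hx => ?_, fun x => hball _ ?_⟩
  · have h4 := (ODE.FunSpace.isFixedPt_next_iff hP hx0).1 hα ⟨x, hx⟩
    rw [ODE.FunSpace.compProj_of_mem hx, h4, h0, ODE.picard_apply]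
  · exact ODE.FunSpace.compProj_mem_closedBall α hP.mul_max_le

lemma sol_deriv (hT : 0 < T) (ha : ∀ i, Continuous (a i)) {v : ℝ → ℂ} (hv : ContinuousOn v (Icc 0 T)) (hs : IsSol T a v)
    {x : ℝ} (hx : x ∈ Icc 0 T) : HasDerivWithinAt v (fld a x (v x)) (Icc 0 T) x := by
  have hF : ContinuousOn (fun s => fld a s (v s)) (Icc 0 T) :=
    (fld_cont ha).comp_continuousOn (continuousOn_id.prodMk hv)
  have : Fact (x ∈ Icc 0 T) := ⟨hx⟩
  have h1 : HasDerivWithinAt (fun u => ∫ s in (0:ℝ)..u, fld a s (v s)) (fld a x (v x)) (Icc 0 T) x := by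
    refine intervalIntegral.integral_hasDerivWithinAt_right ?_ (s := Icc 0 T) (t := Icc 0 T) ?_ (hF x hx)
    · refine ContinuousOn.intervalIntegrable (hF.mono ?_)
      rw [uIcc_of_le hx.1]
      exact Icc_subset_Icc le_rfl hx.2
    · exact hF.stronglyMeasurableAtFilter_nhdsWithin measurableSet_Icc x
  exact (h1.const_add (v 0)).congr (fun y hy => hs y hy) (hs x hx)

lemma sol_uniq (hT : 0 < T) (ha : ∀ i, Continuous (a i)) {v w : ℝ → ℂ} (hv : ContinuousOn v (Icc 0 T)) (hs : IsSol T a v)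
    (hw : ContinuousOn w (Icc 0 T)) (hs' : IsSol T a w) (h0 : v 0 = w 0) : EqOn v w (Icc 0 T) := by
  obtain ⟨B, hB⟩ := isCompact_Icc.exists_bound_of_continuousOn hv
  obtain ⟨B', hB'⟩ := isCompact_Icc.exists_bound_of_continuousOn hw
  obtain ⟨K, hK⟩ := fld_lip ha T (max B B')
  have key : ∀ {u : ℝ → ℂ}, ContinuousOn u (Icc 0 T) → IsSol T a u → ∀ t ∈ Ico 0 T, HasDerivWithinAt u (fld a t (u t)) (Ici t) t := by
    intro u hu hsu t ht
    refine (sol_deriv hT ha hu hsu ⟨ht.1, ht.2.le⟩).mono_of_mem_nhdsWithin ?_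
    refine mem_of_superset (Icc_mem_nhdsGE ht.2) (Icc_subset_Icc ht.1 le_rfl)
  refine ODE_solution_unique_of_mem_Icc_right (v := fld a) (s := fun _ => Metric.closedBall 0 (max B B'))
    (fun t ht => hK t ⟨ht.1, ht.2.le⟩) hv (key hv hs) ?_ hw (key hw hs') ?_ h0
  · intro t ht; rw [mem_closedBall_zero_iff]; exact (hB t ⟨ht.1, ht.2.le⟩).trans (le_max_left _ _)
  · intro t ht; rw [mem_closedBall_zero_iff]; exact (hB' t ⟨ht.1, ht.2.le⟩).trans (le_max_right _ _)

lemma sol_dich (hT : 0 < T) {v : ℝ → ℂ} (hs : IsSol T a v) : v T = v 0 ∨ ContinuousOn v (Icc 0 T) := by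
  by_cases hi : IntervalIntegrable (fun s => fld a s (v s)) volume 0 T
  · right
    have h1 := intervalIntegral.continuousOn_primitive_interval' hi (left_mem_uIcc)
    rw [uIcc_of_le hT.le] at h1
    exact (continuousOn_const.add h1).congr fun x hx => hs x hx
  · left
    rw [hs T ⟨hT.le, le_rfl⟩, intervalIntegral.integral_undef hi, add_zero]

end Ctr
end
end

section
open MeasureTheory Set Filter Topology
noncomputable section
namespace Ctr
set_option linter.unusedVariables false

variable {n : ℕ} {T : ℝ} {a : Fin n → ℝ → ℂ}

def WW (a : Fin n → ℝ → ℂ) : ℕ → ℕ → ℝ → ℂ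
  | _, 0 => fun _ => 1
  | p, d + 1 => fun x => p * ∑ i : Fin n, if (i : ℕ) ≤ d then ∫ s in (0:ℝ)..x, a i s * WW a (p + i + 1) (d - i) s else 0
  termination_by _ d => d

lemma WW_zero (p : ℕ) : WW a p 0 = fun _ => 1 := by unfold WW; rfl
lemma WW_succ (p d : ℕ) (x : ℝ) : WW a p (d+1) x =
    p * ∑ i : Fin n, if (i : ℕ) ≤ d then ∫ s in (0:ℝ)..x, a i s * WW a (p + i + 1) (d - i) s else 0 := by
  conv_lhs => unfold WW

lemma WW_cont (ha : ∀ i, Continuous (a i)) (p d : ℕ) : Continuous (WW a p d) := by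
  induction d using Nat.strong_induction_on generalizing p with
  | _ d ih =>
    cases d with
    | zero => rw [WW_zero]; exact continuous_const
    | succ d =>
      have : WW a p (d+1) = fun x => WW a p (d+1) x := rfl
      rw [this]
      simp_rw [WW_succ]
      refine continuous_const.mul (continuous_finsetSum _ fun i _ => ?_)
      split_ifs with h
      · exact intervalIntegral.continuous_primitive (fun x y => ((ha i).mul (ih _ (by omega) _)).intervalIntegrable x y) 0
      · exact continuous_const

lemma shift_sum {M : Type*} [AddCommMonoid M] (i D : ℕ) (g : ℕ → M) :
    (∑ d ∈ Finset.range D, if i ≤ d then g (d - i) else 0) = ∑ e ∈ Finset.range (D - i), g e := by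
  induction D with
  | zero => simp
  | succ D ih =>
    rw [Finset.sum_range_succ, ih]
    split_ifs with h
    · rw [Nat.succ_sub h, Finset.sum_range_succ]
    · rw [Nat.sub_eq_zero_of_le (by omega : D + 1 ≤ i), Nat.sub_eq_zero_of_le (by omega : D ≤ i), add_zero]

lemma pow_sol (hT : 0 < T) (ha : ∀ i, Continuous (a i)) {v : ℝ → ℂ} (hv : Continuous v) (hs : IsSol T a v)
    (p : ℕ) {x : ℝ} (hx : x ∈ Icc 0 T) :
    v x ^ p = v 0 ^ p + p * ∑ i, ∫ s in (0:ℝ)..x, a i s * v s ^ (p + i + 1) := by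
  have h1 : ∀ y ∈ Icc 0 T, HasDerivWithinAt (fun y => v y ^ p) (p * ∑ i, a i y * v y ^ (p + i + 1)) (Icc 0 T) y := by
    intro y hy
    refine ((sol_deriv hT ha hv.continuousOn hs hy).pow p).congr_deriv ?_
    cases p with
    | zero => simp
    | succ p =>
      rw [fld, mul_assoc, Finset.mul_sum, Nat.add_sub_cancel]
      congr 1
      refine Finset.sum_congr rfl fun i _ => ?_
      rw [show p + 1 + (i:ℕ) + 1 = p + (i + 2) by ring, pow_add]; ring
  have hc : Continuous fun y => p * ∑ i, a i y * v y ^ (p + i + 1) := by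
    refine continuous_const.mul (continuous_finsetSum _ fun i _ => (ha i).mul (hv.pow _))
  have h2 := intervalIntegral.integral_eq_sub_of_hasDeriv_right (a := 0) (b := x) (f := fun y => v y ^ p)
    (f' := fun y => p * ∑ i, a i y * v y ^ (p + i + 1)) (hv.pow p).continuousOn (fun y hy => by
      rw [min_eq_left hx.1, max_eq_right hx.1] at hy
      refine (h1 y ⟨hy.1.le, hy.2.le.trans hx.2⟩).mono_of_mem_nhdsWithin ?_
      refine mem_of_superset (Ioo_mem_nhdsGT (hy.2.trans_le hx.2)) fun z hz => ⟨hy.1.le.trans hz.1.le, hz.2.le⟩) (hc.intervalIntegrable _ _)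
  have hi : ∀ i : Fin n, i ∈ Finset.univ → IntervalIntegrable (fun s => a i s * v s ^ (p + i + 1)) volume 0 x :=
    fun i _ => ((ha i).mul (hv.pow _)).intervalIntegrable _ _
  rw [intervalIntegral.integral_const_mul, intervalIntegral.integral_finsetSum hi] at h2
  rw [h2]; ring

def Rem (a : Fin n → ℝ → ℂ) (v : ℝ → ℂ) (p D : ℕ) (x : ℝ) : ℂ :=
  v x ^ p - ∑ d ∈ Finset.range D, WW a p d x * v 0 ^ (p + d)

lemma rem_succ (hT : 0 < T) (ha : ∀ i, Continuous (a i)) {v : ℝ → ℂ} (hv : Continuous v) (hs : IsSol T a v)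
    (p D : ℕ) {x : ℝ} (hx : x ∈ Icc 0 T) :
    Rem a v p (D + 1) x = p * ∑ i, ∫ s in (0:ℝ)..x, a i s * Rem a v (p + i + 1) (D - i) s := by
  have h1 : ∀ i : Fin n, ∫ s in (0:ℝ)..x, a i s * Rem a v (p + i + 1) (D - i) s =
      (∫ s in (0:ℝ)..x, a i s * v s ^ (p + i + 1)) -
        ∑ d ∈ Finset.range D, (if (i : ℕ) ≤ d then ∫ s in (0:ℝ)..x, a i s * WW a (p + i + 1) (d - i) s else 0) * v 0 ^ (p + (d + 1)) := by
    intro i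
    have h2 : ∑ d ∈ Finset.range D, (if (i : ℕ) ≤ d then ∫ s in (0:ℝ)..x, a i s * WW a (p + i + 1) (d - i) s else 0) * v 0 ^ (p + (d + 1))
        = ∑ e ∈ Finset.range (D - i), (∫ s in (0:ℝ)..x, a i s * WW a (p + i + 1) e s) * v 0 ^ (p + i + 1 + e) := by
      rw [← shift_sum (i : ℕ) D]
      refine Finset.sum_congr rfl fun d _ => ?_
      split_ifs with h
      · congr 2; omega
      · simp
    rw [h2]
    have hc : ∀ e, Continuous fun s => a i s * WW a (p + i + 1) e s := fun e => (ha i).mul (WW_cont ha _ _)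
    simp_rw [← intervalIntegral.integral_mul_const]
    have hi1 : ∀ e, e ∈ Finset.range (D - i) → IntervalIntegrable (fun s => a i s * WW a (p + i + 1) e s * v 0 ^ (p + i + 1 + e)) volume 0 x :=
      fun e _ => ((hc e).mul continuous_const).intervalIntegrable _ _
    have hi2 : IntervalIntegrable (fun s => a i s * v s ^ (p + i + 1)) volume 0 x := ((ha i).mul (hv.pow _)).intervalIntegrable _ _
    have hi3 : IntervalIntegrable (fun s => ∑ e ∈ Finset.range (D - i), a i s * WW a (p + i + 1) e s * v 0 ^ (p + i + 1 + e)) volume 0 x :=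
      (continuous_finsetSum _ fun e _ => (hc e).mul continuous_const).intervalIntegrable _ _
    rw [← intervalIntegral.integral_finsetSum hi1, ← intervalIntegral.integral_sub hi2 hi3]
    refine intervalIntegral.integral_congr fun s _ => ?_
    simp only [Rem]
    rw [mul_sub, Finset.mul_sum]
    congr 1
    exact Finset.sum_congr rfl fun e _ => by ring
  simp_rw [h1]
  rw [Finset.sum_sub_distrib, mul_sub, Rem, pow_sol hT ha hv hs p hx, Finset.sum_range_succ', WW_zero]
  have h3 : ∑ d ∈ Finset.range D, WW a p (d + 1) x * v 0 ^ (p + (d + 1)) =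
      p * ∑ i : Fin n, ∑ d ∈ Finset.range D, (if (i : ℕ) ≤ d then ∫ s in (0:ℝ)..x, a i s * WW a (p + i + 1) (d - i) s else 0) * v 0 ^ (p + (d + 1)) := by
    rw [Finset.sum_comm, Finset.mul_sum]
    refine Finset.sum_congr rfl fun d _ => ?_
    rw [WW_succ, ← Finset.sum_mul]; ring
  rw [h3]; simp only [add_zero]; ring

lemma rem_cont (ha : ∀ i, Continuous (a i)) {v : ℝ → ℂ} (hv : Continuous v) (p D : ℕ) : Continuous (Rem a v p D) := by
  unfold Rem
  exact (hv.pow _).sub (continuous_finsetSum _ fun d _ => (WW_cont ha _ _).mul continuous_const)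

lemma rem_bd (hT : 0 < T) (ha : ∀ i, Continuous (a i)) {v : ℝ → ℂ} (hv : Continuous v) (hs : IsSol T a v)
    (hb : ∀ x, ‖v x‖ ≤ 2 * ‖v 0‖) {C : ℝ} (hC0 : 0 ≤ C) (hC : ∀ t ∈ Icc 0 T, ∀ i, ‖a i t‖ ≤ C)
    (hδ : 2 * ‖v 0‖ * Real.exp (n * C * T) ≤ 1) (D : ℕ) : ∀ p : ℕ, ∀ x ∈ Icc 0 T,
    ‖Rem a v p D x‖ ≤ (2 * ‖v 0‖ * Real.exp (n * C * x)) ^ p * (2 * ‖v 0‖ * Real.exp (n * C * T)) ^ (D - 1) := by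
  set δ := 2 * ‖v 0‖ * Real.exp (n * C * T) with hδd
  have hδ0 : 0 ≤ δ := by positivity
  set φ : ℝ → ℝ := fun x => 2 * ‖v 0‖ * Real.exp (n * C * x) with hφ
  have hφ0 : ∀ x, 0 ≤ φ x := fun x => by positivity
  have hφδ : ∀ x ∈ Icc 0 T, φ x ≤ δ := by
    intro x hx
    simp only [hφ, hδd]
    gcongr
    exact hx.2
  have hφc : Continuous φ := by fun_prop
  induction D using Nat.strong_induction_on with
  | _ D ih =>
    intro p x hx
    change _ ≤ φ x ^ p * _
    cases D with
    | zero =>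
      simp only [Rem, Finset.range_zero, Finset.sum_empty, sub_zero, norm_pow, zero_tsub, pow_zero, mul_one]
      refine pow_le_pow_left₀ (norm_nonneg _) ((hb x).trans ?_) _
      refine le_mul_of_one_le_right (by positivity) (Real.one_le_exp (mul_nonneg (by positivity) hx.1))
    | succ D =>
      rw [rem_succ hT ha hv hs p D hx, Nat.add_sub_cancel]
      have h1 : ∀ i : Fin n, ‖∫ s in (0:ℝ)..x, a i s * Rem a v (p + i + 1) (D - i) s‖ ≤
          ∫ s in (0:ℝ)..x, C * (φ s ^ p * δ ^ D) := by
        intro i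
        refine intervalIntegral.norm_integral_le_of_norm_le hx.1 (Filter.Eventually.of_forall fun s hs' => ?_)
          ((continuous_const.mul ((hφc.pow p).mul continuous_const)).intervalIntegrable _ _)
        have hs2 : s ∈ Icc 0 T := ⟨hs'.1.le, hs'.2.trans hx.2⟩
        rw [norm_mul]
        refine mul_le_mul (hC s hs2 i) ?_ (norm_nonneg _) hC0
        refine (ih (D - i) (by omega) _ s hs2).trans ?_
        change φ s ^ (p + i + 1) * _ ≤ _
        rw [add_assoc, pow_add, mul_assoc]
        refine mul_le_mul_of_nonneg_left ?_ (pow_nonneg (hφ0 s) _)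
        calc φ s ^ ((i:ℕ) + 1) * δ ^ (D - i - 1) ≤ δ ^ ((i:ℕ)+1) * δ ^ (D - i - 1) := by
              gcongr
              exact hφδ s hs2
          _ = δ ^ ((i:ℕ) + 1 + (D - i - 1)) := (pow_add _ _ _).symm
          _ ≤ δ ^ D := pow_le_pow_of_le_one hδ0 hδ (by omega)
      have h2 : ∫ s in (0:ℝ)..x, (p * (n * C)) * φ s ^ p = φ x ^ p - φ 0 ^ p := by
        have hi : IntervalIntegrable (fun s => (p * (n * C)) * φ s ^ p) volume 0 x :=
          (continuous_const.mul (hφc.pow p)).intervalIntegrable _ _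
        refine intervalIntegral.integral_eq_sub_of_hasDerivAt (f := fun s => φ s ^ p) (fun s _ => ?_) hi
        have h3 : HasDerivAt φ (n * C * φ s) s := by
          refine ((((hasDerivAt_id s).const_mul (n * C)).exp).const_mul (2 * ‖v 0‖)).congr_deriv ?_
          simp only [hφ, id]; ring
        refine (h3.pow p).congr_deriv ?_
        cases p with
        | zero => simp
        | succ p => rw [Nat.add_sub_cancel, pow_succ]; ring
      rw [norm_mul, Complex.norm_natCast]
      calc _ ≤ (p:ℝ) * ∑ i : Fin n, ∫ s in (0:ℝ)..x, C * (φ s ^ p * δ ^ D) := by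
            refine mul_le_mul_of_nonneg_left ?_ (Nat.cast_nonneg _)
            exact (norm_sum_le _ _).trans (Finset.sum_le_sum fun i _ => h1 i)
        _ = (∫ s in (0:ℝ)..x, (p * (n * C)) * φ s ^ p) * δ ^ D := by
            simp only [Finset.sum_const, Finset.card_univ, Fintype.card_fin, nsmul_eq_mul]
            rw [← mul_assoc, ← intervalIntegral.integral_const_mul, ← intervalIntegral.integral_mul_const]
            refine intervalIntegral.integral_congr fun s _ => ?_
            ring
        _ ≤ _ := by
            rw [h2]
            gcongr
            linarith [pow_nonneg (hφ0 0) p]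

theorem center_iff (hT : 0 < T) (ha : ∀ i, Continuous (a i)) :
    DeterminesCenter T a ↔ ∀ p d, WW a p (d + 1) T = 0 := by
  obtain ⟨C, hC0, hC⟩ := coef_bd ha T
  obtain ⟨ε, hε, hε1, hsol⟩ := sol_small hT ha
  set s := 2 * Real.exp (n * C * T) with hs
  have hs0 : 0 < s := by positivity
  have hTm : T ∈ Icc 0 T := ⟨hT.le, le_rfl⟩
  have key : ∀ v0 : ℂ, ‖v0‖ < min ε (1 / s) → ∃ v : ℝ → ℂ, v 0 = v0 ∧ Continuous v ∧ IsSol T a v ∧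
      ∀ p D, ‖v T ^ p - ∑ d ∈ Finset.range D, WW a p d T * v0 ^ (p + d)‖ ≤ (s * ‖v0‖) ^ p * (s * ‖v0‖) ^ (D - 1) := by
    intro v0 h0
    obtain ⟨v, hv0, hvc, hvs, hvb⟩ := hsol v0 (h0.trans_le (min_le_left _ _))
    refine ⟨v, hv0, hvc, hvs, fun p D => ?_⟩
    have h1 : ‖v0‖ < 1 / s := h0.trans_le (min_le_right _ _)
    rw [lt_div_iff₀ hs0] at h1
    have e : s * ‖v0‖ = 2 * ‖v 0‖ * Real.exp (n * C * T) := by rw [hv0, hs]; ring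
    have := rem_bd hT ha hvc hvs (by rw [hv0]; exact hvb) hC0 hC (by rw [← e]; linarith) D p T hTm
    rw [← e, Rem, hv0] at this
    exact this
  constructor
  · rintro ⟨ε', hε', hc⟩ p d
    induction d using Nat.strong_induction_on with
    | _ d ih =>
      by_contra hne
      set M := s ^ (p + d + 2) + ‖WW a p (d + 2) T‖ with hM
      have hM0 : 0 < M := by positivity
      have hpos : 0 < ‖WW a p (d + 1) T‖ := norm_pos_iff.2 hne
      obtain ⟨t, ht0, ht⟩ := exists_between (a₁ := (0:ℝ)) (a₂ := min (min (min ε (1/s)) ε') (‖WW a p (d + 1) T‖ / M)) (by positivity)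
      obtain ⟨v, hv0, hvc, hvs, hve⟩ := key (t : ℂ) (by
        rw [Complex.norm_real, Real.norm_of_nonneg ht0.le]
        exact ht.trans_le ((min_le_left _ _).trans (min_le_left _ _)))
      have hvT := hc v hvs (by
        rw [hv0, Complex.norm_real, Real.norm_of_nonneg ht0.le]
        exact ht.trans_le ((min_le_left _ _).trans (min_le_right _ _)))
      have h1 := hve p (d + 3)
      rw [hvT, hv0, Complex.norm_real, Real.norm_of_nonneg ht0.le, Finset.sum_range_succ, Finset.sum_range_succ,
        Finset.sum_range_succ', WW_zero, Finset.sum_eq_zero (fun e he => by rw [ih e (Finset.mem_range.1 he), zero_mul]),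
        ← pow_add, show d + 3 - 1 = d + 2 by omega, ← add_assoc] at h1
      have h2 : ‖WW a p (d+1) T * (t:ℂ) ^ (p + d + 1) + WW a p (d+2) T * (t:ℂ) ^ (p + d + 2)‖ ≤ (s * t) ^ (p + d + 2) := by
        rw [← norm_neg]
        refine le_trans (le_of_eq ?_) h1
        congr 1
        simp only [add_zero, zero_add, one_mul, add_assoc]
        ring
      have h3 : ‖WW a p (d+1) T‖ * t ^ (p+d+1) ≤ (s * t) ^ (p + d + 2) + ‖WW a p (d+2) T‖ * t ^ (p+d+2) := by
        have := norm_sub_le (WW a p (d+1) T * (t:ℂ) ^ (p + d + 1) + WW a p (d+2) T * (t:ℂ) ^ (p + d + 2)) (WW a p (d+2) T * (t:ℂ) ^ (p + d + 2))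
        rw [add_sub_cancel_right, norm_mul, norm_mul, norm_pow, norm_pow, Complex.norm_real, Real.norm_of_nonneg ht0.le] at this
        linarith
      have h4 : ‖WW a p (d+1) T‖ * t ^ (p+d+1) ≤ (M * t) * t ^ (p+d+1) := by
        refine h3.trans (le_of_eq ?_)
        rw [hM, mul_pow]; ring
      have h5 := le_of_mul_le_mul_right h4 (by positivity)
      have h6 : t < ‖WW a p (d + 1) T‖ / M := ht.trans_le (min_le_right _ _)
      rw [lt_div_iff₀ hM0] at h6
      linarith
  · intro h
    refine ⟨min ε (1 / s), by positivity, fun w hw hw0 => ?_⟩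
    obtain ⟨v, hv0, hvc, hvs, hve⟩ := key (w 0) hw0
    rcases sol_dich hT (a := a) (v := w) hw with h0 | hcont
    · exact h0
    have e := sol_uniq hT ha hcont hw hvc.continuousOn hvs hv0.symm hTm
    rw [e]
    have h1 : ‖w 0‖ * s < 1 := by
      have := hw0.trans_le (min_le_right _ _)
      rwa [lt_div_iff₀ hs0] at this
    have h2 : ∀ D : ℕ, ‖v T - w 0‖ ≤ (s * ‖w 0‖) * (s * ‖w 0‖) ^ D := by
      intro D
      have := hve 1 (D + 1)
      rw [Finset.sum_range_succ', Finset.sum_eq_zero (fun e he => by rw [h 1 e, zero_mul]), WW_zero] at this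
      simpa using this
    have h3 : Tendsto (fun D : ℕ => (s * ‖w 0‖) * (s * ‖w 0‖) ^ D) atTop (𝓝 ((s * ‖w 0‖) * 0)) :=
      (tendsto_pow_atTop_nhds_zero_of_lt_one (by positivity) (by linarith)).const_mul _
    have h4 := ge_of_tendsto' h3 h2
    rw [mul_zero] at h4
    exact sub_eq_zero.1 (norm_le_zero_iff.1 h4)

end Ctr
end
end

section
open MeasureTheory Set Filter Topology
noncomputable section
namespace Ctr
set_option linter.unusedVariables false

variable {n : ℕ} {T : ℝ}

lemma WW_joint {X : Type*} [TopologicalSpace X] [FirstCountableTopology X] [LocallyCompactSpace X] {b : X → Fin n → ℝ → ℂ} (hb : ∀ i, Continuous fun q : X × ℝ => b q.1 i q.2)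
    (p d : ℕ) : Continuous fun q : X × ℝ => WW (b q.1) p d q.2 := by
  induction d using Nat.strong_induction_on generalizing p with
  | _ d ih =>
    cases d with
    | zero => simp_rw [WW_zero]; exact continuous_const
    | succ d =>
      simp_rw [WW_succ]
      refine continuous_const.mul (continuous_finsetSum _ fun i _ => ?_)
      split_ifs with h
      · have h1 : Continuous (Function.uncurry fun (x : X) (s : ℝ) => b x i s * WW (b x) (p + i + 1) (d - i) s) :=
          (hb i).mul (ih (d - i) (by omega) _)
        have h2 := intervalIntegral.continuous_parametric_primitive_of_continuous (μ := volume) (a₀ := (0:ℝ)) h1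
        exact h2
      · exact continuous_const

/-! combinations of iterated integrals -/
abbrev CF (n : ℕ) := {a : Fin n → ℝ → ℂ // ∀ i, Continuous (a i)}

def wd (l : List (Fin n)) : CF n → ℝ → ℂ := fun a x => simplexInt (l.map a.1) x

def Comb (n : ℕ) : Submodule ℂ (CF n → ℝ → ℂ) := Submodule.span ℂ (range (wd (n := n)))

lemma wd_cons (i : Fin n) (l : List (Fin n)) (a : CF n) (x : ℝ) : wd (i :: l) a x = ∫ s in (0:ℝ)..x, a.1 i s * wd l a s := rfl

lemma wd_cont (l : List (Fin n)) (a : CF n) : Continuous (wd l a) := by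
  induction l with
  | nil => exact continuous_const
  | cons i l ih =>
    exact intervalIntegral.continuous_primitive (fun x y => ((a.2 i).mul ih).intervalIntegrable x y) 0

lemma wd_mem (l : List (Fin n)) : wd l ∈ Comb n := Submodule.subset_span ⟨l, rfl⟩

lemma comb_cont {Φ : CF n → ℝ → ℂ} (h : Φ ∈ Comb n) (a : CF n) : Continuous (Φ a) := by
  induction h using Submodule.span_induction with
  | mem x hx => obtain ⟨l, rfl⟩ := hx; exact wd_cont l a
  | zero => exact continuous_const
  | add x y _ _ hx hy => exact hx.add hy
  | smul c x _ hx => exact hx.const_smul c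

lemma comb_int {Φ : CF n → ℝ → ℂ} (h : Φ ∈ Comb n) (i : Fin n) :
    (fun a x => ∫ s in (0:ℝ)..x, a.1 i s * Φ a s) ∈ Comb n := by
  induction h using Submodule.span_induction with
  | mem x hx => obtain ⟨l, rfl⟩ := hx; exact wd_mem (i :: l)
  | zero =>
    convert (Comb n).zero_mem using 1
    funext a x
    simp
  | add Φ Ψ h1 h2 hx hy =>
    convert (Comb n).add_mem hx hy using 1
    funext a x
    have i1 : IntervalIntegrable (fun s => a.1 i s * Φ a s) volume 0 x := ((a.2 i).mul (comb_cont h1 a)).intervalIntegrable _ _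
    have i2 : IntervalIntegrable (fun s => a.1 i s * Ψ a s) volume 0 x := ((a.2 i).mul (comb_cont h2 a)).intervalIntegrable _ _
    change _ = (∫ s in (0:ℝ)..x, a.1 i s * Φ a s) + ∫ s in (0:ℝ)..x, a.1 i s * Ψ a s
    rw [← intervalIntegral.integral_add i1 i2]
    simp [mul_add]
  | smul c Φ _ hx =>
    convert (Comb n).smul_mem c hx using 1
    funext a x
    change _ = c * ∫ s in (0:ℝ)..x, a.1 i s * Φ a s
    rw [← intervalIntegral.integral_const_mul]
    refine intervalIntegral.integral_congr fun s _ => ?_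
    simp only [Pi.smul_apply, smul_eq_mul]; ring

lemma comb_eq {Φ : CF n → ℝ → ℂ} (h : Φ ∈ Comb n) {a a' : CF n} {x : ℝ} (he : ∀ l, wd l a x = wd l a' x) : Φ a x = Φ a' x := by
  induction h using Submodule.span_induction with
  | mem x hx => obtain ⟨l, rfl⟩ := hx; exact he l
  | zero => rfl
  | add Φ Ψ h1 h2 hx hy => simp only [Pi.add_apply, hx, hy]
  | smul c Φ _ hx => simp only [Pi.smul_apply, hx]

lemma wd_shuffle (i : Fin n) (l : List (Fin n)) : (fun (a : CF n) x => primitive (a.1 i) x * wd l a x) ∈ Comb n := by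
  induction l with
  | nil =>
    convert wd_mem [i] using 1
    funext a x
    simp [wd, simplexInt, primitive]
  | cons j l ih =>
    convert (Comb n).add_mem (wd_mem (i :: j :: l)) (comb_int ih j) using 1
    funext a x
    change _ = (∫ s in (0:ℝ)..x, a.1 i s * wd (j :: l) a s) + ∫ s in (0:ℝ)..x, a.1 j s * (primitive (a.1 i) s * wd l a s)
    have hp : ∀ y, HasDerivAt (primitive (a.1 i)) (a.1 i y) y := fun y => (a.2 i).integral_hasStrictDerivAt 0 y |>.hasDerivAt
    have hpc : Continuous (primitive (a.1 i)) := continuous_iff_continuousAt.2 fun y => (hp y).continuousAt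
    have hw : ∀ y, HasDerivAt (wd (j :: l) a) (a.1 j y * wd l a y) y := fun y =>
      ((a.2 j).mul (wd_cont l a)).integral_hasStrictDerivAt 0 y |>.hasDerivAt
    have i1 : IntervalIntegrable (fun s => a.1 i s * wd (j :: l) a s) volume 0 x := ((a.2 i).mul (wd_cont _ a)).intervalIntegrable _ _
    have i2 : IntervalIntegrable (fun s => a.1 j s * (primitive (a.1 i) s * wd l a s)) volume 0 x :=
      ((a.2 j).mul (hpc.mul (wd_cont l a))).intervalIntegrable _ _
    rw [← intervalIntegral.integral_add i1 i2]
    rw [intervalIntegral.integral_eq_sub_of_hasDerivAt (f := fun y => primitive (a.1 i) y * wd (j :: l) a y) _ (i1.add i2)]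
    · simp [primitive]
    · intro y _
      refine ((hp y).mul (hw y)).congr_deriv ?_
      ring

lemma comb_mul {Φ : CF n → ℝ → ℂ} (h : Φ ∈ Comb n) (i : Fin n) : (fun a x => primitive (a.1 i) x * Φ a x) ∈ Comb n := by
  induction h using Submodule.span_induction with
  | mem x hx => obtain ⟨l, rfl⟩ := hx; exact wd_shuffle i l
  | zero =>
    convert (Comb n).zero_mem using 1
    funext a x
    simp
  | add Φ Ψ h1 h2 hx hy =>
    convert (Comb n).add_mem hx hy using 1
    funext a x
    simp [mul_add]
  | smul c Φ _ hx =>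
    convert (Comb n).smul_mem c hx using 1
    funext a x
    simp; ring

lemma comb_moment (ps : List (Fin n × ℕ)) (i : Fin n) : (fun (a : CF n) x => moment x a.1 ps i) ∈ Comb n := by
  have h1 : (fun (a : CF n) x => (ps.map fun q => primitive (a.1 q.1) x ^ q.2).prod) ∈ Comb n := by
    induction ps with
    | nil => exact wd_mem []
    | cons q ps ih =>
      obtain ⟨j, k⟩ := q
      simp only [List.map_cons, List.prod_cons]
      induction k with
      | zero => simpa using ih
      | succ k ihk =>
        convert comb_mul ihk j using 1
        funext a x
        ring
  convert comb_int h1 i using 1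
  funext a x
  unfold moment
  simp_rw [mul_comm]

lemma comb_WW (p d : ℕ) : (fun (a : CF n) x => WW a.1 p d x) ∈ Comb n := by
  induction d using Nat.strong_induction_on generalizing p with
  | _ d ih =>
    cases d with
    | zero => simp_rw [WW_zero]; exact wd_mem []
    | succ d =>
      simp_rw [WW_succ]
      have : (∑ i : Fin n, if (i:ℕ) ≤ d then (fun (a : CF n) x => ∫ s in (0:ℝ)..x, a.1 i s * WW a.1 (p + i + 1) (d - i) s) else 0) ∈ Comb n := by
        refine Submodule.sum_mem _ fun i _ => ?_
        split_ifs with h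
        · exact comb_int (ih (d - i) (by omega) (p + i + 1)) i
        · exact Submodule.zero_mem _
      convert (Comb n).smul_mem (p : ℂ) this using 1
      funext a x
      simp only [Pi.smul_apply, Finset.sum_apply, smul_eq_mul]
      congr 1
      refine Finset.sum_congr rfl fun i _ => ?_
      split_ifs <;> rfl

lemma moment_zero_of_wd (a : CF n) (T : ℝ) (h : ∀ l ≠ [], wd l a T = 0) (ps : List (Fin n × ℕ)) (i : Fin n) : moment T a.1 ps i = 0 := by
  have h1 := comb_eq (comb_moment ps i) (a := a) (a' := ⟨fun _ _ => 0, fun _ => continuous_const⟩) (x := T) (fun l => by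
    cases l with
    | nil => rfl
    | cons i l => rw [h _ (by simp), wd_cons]; simp)
  simp only at h1
  rw [h1]
  simp [moment]

lemma center_of_wd (hT : 0 < T) (a a' : CF n) (h : ∀ l, wd l a T = wd l a' T) : DeterminesCenter T a.1 ↔ DeterminesCenter T a'.1 := by
  rw [center_iff hT a.2, center_iff hT a'.2]
  have : ∀ p d, WW a.1 p d T = WW a'.1 p d T := fun p d => comb_eq (comb_WW p d) h
  simp_rw [this]

/-! complex version and shift -/
lemma exists_cp {f : ℂ → ℂ} (hf : Differentiable ℂ f) : ∃ g : ℂ → ℂ, (∀ x, HasDerivAt g (f x) x) ∧ g 0 = 0 := by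
  obtain ⟨G, hG0, hG⟩ := (hf.isExactOn_univ).with_val_at 0 0
  exact ⟨G, fun x => hG x (mem_univ x), hG0⟩

def cp (f : ℂ → ℂ) : ℂ → ℂ := open Classical in if h : Differentiable ℂ f then (exists_cp h).choose else 0
lemma cp_deriv {f : ℂ → ℂ} (hf : Differentiable ℂ f) (x : ℂ) : HasDerivAt (cp f) (f x) x := by
  rw [cp, dif_pos hf]; exact (exists_cp hf).choose_spec.1 x
lemma cp_zero (f : ℂ → ℂ) : cp f 0 = 0 := by
  rw [cp]; split_ifs with h
  · exact (exists_cp h).choose_spec.2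
  · rfl
lemma cp_diff {f : ℂ → ℂ} (hf : Differentiable ℂ f) : Differentiable ℂ (cp f) := fun x => (cp_deriv hf x).differentiableAt
lemma cp_int {f : ℂ → ℂ} (hf : Differentiable ℂ f) (x : ℝ) : ∫ s in (0:ℝ)..x, f s = cp f x := by
  have h1 : Continuous fun s : ℝ => f s := hf.continuous.comp Complex.continuous_ofReal
  rw [intervalIntegral.integral_eq_sub_of_hasDerivAt (f := fun s : ℝ => cp f s) (fun s _ => (cp_deriv hf s).comp_ofReal) (h1.intervalIntegrable _ _)]
  simp [cp_zero]
lemma eq_of_deriv {f g : ℂ → ℂ} (hf : Differentiable ℂ f) (hg : Differentiable ℂ g) (h : ∀ x, deriv f x = deriv g x)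
    (h0 : f 0 = g 0) (x : ℂ) : f x = g x := by
  have h1 := is_const_of_deriv_eq_zero (hf.sub hg) (fun y => by
    rw [deriv_sub (hf y) (hg y), h, sub_self]) x 0
  simp only [Pi.sub_apply, h0, sub_self] at h1
  exact sub_eq_zero.1 h1

def WC (A : Fin n → ℂ → ℂ) : ℕ → ℕ → ℂ → ℂ
  | _, 0 => fun _ => 1
  | p, d + 1 => fun x => p * ∑ i : Fin n, if (i : ℕ) ≤ d then cp (fun s => A i s * WC A (p + i + 1) (d - i) s) x else 0
  termination_by _ d => d

lemma WC_zero (A : Fin n → ℂ → ℂ) (p : ℕ) : WC A p 0 = fun _ => 1 := by unfold WC; rfl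
lemma WC_succ (A : Fin n → ℂ → ℂ) (p d : ℕ) (x : ℂ) : WC A p (d+1) x =
    p * ∑ i : Fin n, if (i : ℕ) ≤ d then cp (fun s => A i s * WC A (p + i + 1) (d - i) s) x else 0 := by
  conv_lhs => unfold WC
lemma WC_at0 (A : Fin n → ℂ → ℂ) (p d : ℕ) : WC A p (d+1) 0 = 0 := by
  rw [WC_succ]; simp [cp_zero]

lemma WC_diff {A : Fin n → ℂ → ℂ} (hA : ∀ i, Differentiable ℂ (A i)) (p d : ℕ) : Differentiable ℂ (WC A p d) := by
  induction d using Nat.strong_induction_on generalizing p with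
  | _ d ih =>
    cases d with
    | zero => rw [WC_zero]; exact differentiable_const _
    | succ d =>
      have : WC A p (d+1) = fun x => WC A p (d+1) x := rfl
      rw [this]
      simp_rw [WC_succ]
      refine (differentiable_const _).mul (Differentiable.fun_sum fun i _ => ?_)
      split_ifs with h
      · exact cp_diff ((hA i).mul (ih _ (by omega) _))
      · exact differentiable_const _

lemma WC_deriv {A : Fin n → ℂ → ℂ} (hA : ∀ i, Differentiable ℂ (A i)) (p d : ℕ) (x : ℂ) :
    HasDerivAt (WC A p (d+1)) (p * ∑ i : Fin n, if (i : ℕ) ≤ d then A i x * WC A (p + i + 1) (d - i) x else 0) x := by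
  have : WC A p (d+1) = fun x => WC A p (d+1) x := rfl
  rw [this]
  simp_rw [WC_succ]
  refine HasDerivAt.const_mul _ (HasDerivAt.fun_sum fun i _ => ?_)
  split_ifs with h
  · exact cp_deriv ((hA i).mul (WC_diff hA _ _)) x
  · exact hasDerivAt_const _ _

lemma WW_eq_WC {A : Fin n → ℂ → ℂ} (hA : ∀ i, Differentiable ℂ (A i)) (p d : ℕ) (x : ℝ) :
    WW (fun i (x : ℝ) => A i x) p d x = WC A p d x := by
  induction d using Nat.strong_induction_on generalizing p x with
  | _ d ih =>
    cases d with
    | zero => rw [WW_zero, WC_zero]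
    | succ d =>
      rw [WW_succ, WC_succ]
      congr 1
      refine Finset.sum_congr rfl fun i _ => ?_
      split_ifs with h
      · have hd : Differentiable ℂ (fun s => A i s * WC A (p + i + 1) (d - i) s) := (hA i).mul (WC_diff hA _ _)
        rw [← cp_int hd]
        refine intervalIntegral.integral_congr fun s _ => ?_
        rw [ih (d - i) (by omega)]
      · rfl

lemma WC_shift {A B : Fin n → ℂ → ℂ} (hA : ∀ i, Differentiable ℂ (A i)) (xc : ℂ) (hB : ∀ i x, B i x = A i (x + xc)) (d : ℕ) :
    ∀ (p : ℕ) (x : ℂ), WC A p d (x + xc) = ∑ e ∈ Finset.range (d + 1), WC B p e x * WC A (p + e) (d - e) xc := by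
  have hBd : ∀ i, Differentiable ℂ (B i) := fun i => by
    have : B i = fun x => A i (x + xc) := funext (hB i)
    rw [this]
    exact (hA i).comp (differentiable_id.add_const xc)
  induction d using Nat.strong_induction_on with
  | _ d ih =>
    intro p
    cases d with
    | zero => intro x; simp [WC_zero]
    | succ d =>
      refine eq_of_deriv ((WC_diff hA _ _).comp (differentiable_id.add_const xc))
        (Differentiable.fun_sum fun e _ => (WC_diff hBd _ _).mul_const _) (fun x => ?_) ?_
      · have h1 : HasDerivAt (fun x => WC A p (d+1) (x + xc)) _ x := (WC_deriv hA p d (x + xc)).comp_add_const x xc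
        have h2 : HasDerivAt (fun x => ∑ e ∈ Finset.range (d + 1), WC B p (e + 1) x * WC A (p + (e + 1)) (d + 1 - (e + 1)) xc + WC B p 0 x * WC A (p + 0) (d + 1 - 0) xc) _ x :=
          (HasDerivAt.fun_sum fun e _ => (WC_deriv hBd p e x).mul_const _).add (by
            rw [WC_zero]; exact hasDerivAt_const _ _)
        rw [h1.deriv]
        simp_rw [Finset.sum_range_succ' _ (d+1)]
        rw [h2.deriv, add_zero]
        simp_rw [mul_assoc, ← Finset.mul_sum, Finset.sum_mul]
        rw [Finset.sum_comm]
        congr 1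
        refine Finset.sum_congr rfl fun i _ => ?_
        have h3 : ∀ e, (if (i:ℕ) ≤ e then B i x * WC B (p + i + 1) (e - i) x else 0) * WC A (p + (e + 1)) (d + 1 - (e + 1)) xc
            = if (i:ℕ) ≤ e then B i x * (WC B (p + i + 1) (e - i) x * WC A (p + i + 1 + (e - i)) (d - i - (e - i)) xc) else 0 := by
          intro e
          split_ifs with h
          · rw [mul_assoc, show p + (e + 1) = p + i + 1 + (e - i) by omega, show d + 1 - (e + 1) = d - i - (e - i) by omega]
          · rw [zero_mul]
        simp_rw [h3]
        rw [shift_sum (i:ℕ) (d+1) (fun e => B i x * (WC B (p + i + 1) e x * WC A (p + i + 1 + e) (d - i - e) xc))]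
        split_ifs with h
        · rw [ih (d - i) (by omega), ← Finset.mul_sum, hB, Nat.sub_add_comm h]
        · rw [Nat.sub_eq_zero_of_le (by omega)]; simp
      · rw [Finset.sum_range_succ']
        simp [WC_at0, WC_zero]

theorem center_shift (hT : 0 < T) {A B : Fin n → ℂ → ℂ} (hA : ∀ i, Differentiable ℂ (A i)) (hper : ∀ i x, A i (x + T) = A i x)
    (xc : ℂ) (hB : ∀ i x, B i x = A i (x + xc)) (h : DeterminesCenter T (fun i (x : ℝ) => A i x)) :
    DeterminesCenter T (fun i (x : ℝ) => B i x) := by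
  have hBd : ∀ i, Differentiable ℂ (B i) := fun i => by
    have : B i = fun x => A i (x + xc) := funext (hB i)
    rw [this]
    exact (hA i).comp (differentiable_id.add_const xc)
  have hAc : ∀ i, Continuous (fun x : ℝ => A i x) := fun i => (hA i).continuous.comp Complex.continuous_ofReal
  have hBc : ∀ i, Continuous (fun x : ℝ => B i x) := fun i => (hBd i).continuous.comp Complex.continuous_ofReal
  rw [center_iff hT hAc] at h
  rw [center_iff hT hBc]
  simp_rw [WW_eq_WC hA] at h
  simp_rw [WW_eq_WC hBd]
  have hp : ∀ p d x, WC A p d (x + T) = WC A p d x := by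
    intro p d x
    rw [WC_shift hA (T:ℂ) (B := A) (fun i x => (hper i x).symm), Finset.sum_range_succ, Finset.sum_eq_zero]
    · simp [WC_zero]
    · intro e he
      have := Finset.mem_range.1 he
      obtain ⟨k, hk⟩ : ∃ k, d - e = k + 1 := ⟨d - e - 1, by omega⟩
      rw [hk, h, mul_zero]
  intro p d
  induction d using Nat.strong_induction_on with
  | _ d ih =>
    have h1 := WC_shift hA xc hB (d + 1) p T
    rw [add_comm (T:ℂ) xc, hp, Finset.sum_range_succ', Finset.sum_range_succ, Finset.sum_eq_zero (fun e he => by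
      rw [ih e (Finset.mem_range.1 he), zero_mul])] at h1
    simpa [WC_zero] using h1

end Ctr
end
end

section
open MeasureTheory Set Filter Topology
noncomputable section
namespace Ctr
set_option linter.unusedVariables false

lemma diff_deriv {f : ℂ → ℂ} (hf : Differentiable ℂ f) : Differentiable ℂ (deriv f) :=
  (hf.contDiff (n := 2)).differentiable_deriv_two

def wC {n : ℕ} (φ : Fin n → ℂ → ℂ) : List (Fin n) → ℂ → ℂ
  | [] => fun _ => 1
  | i :: l => cp (fun x => deriv (φ i) x * wC φ l x)

lemma wC_diff {n : ℕ} {φ : Fin n → ℂ → ℂ} (hφ : ∀ i, Differentiable ℂ (φ i)) (l : List (Fin n)) :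
    Differentiable ℂ (wC φ l) := by
  induction l with
  | nil => exact differentiable_const _
  | cons i l ih => exact cp_diff ((diff_deriv (hφ i)).mul ih)

def dr {n : ℕ} (φ : Fin n → ℂ → ℂ) (hφ : ∀ i, Differentiable ℂ (φ i)) : CF n :=
  ⟨fun i x => deriv (φ i) x, fun i => (diff_deriv (hφ i)).continuous.comp Complex.continuous_ofReal⟩

lemma wd_wC {n : ℕ} {φ : Fin n → ℂ → ℂ} (hφ : ∀ i, Differentiable ℂ (φ i)) (l : List (Fin n)) (x : ℝ) :
    wd l (dr φ hφ) x = wC φ l x := by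
  induction l generalizing x with
  | nil => rfl
  | cons i l ih =>
    rw [wd_cons]
    have hd : Differentiable ℂ (fun x => deriv (φ i) x * wC φ l x) := (diff_deriv (hφ i)).mul (wC_diff hφ l)
    have h2 := cp_int hd x
    change _ = cp _ _
    rw [← h2]
    refine intervalIntegral.integral_congr fun s _ => ?_
    simp only [ih]; rfl

/-- open ball as an open set -/
abbrev VB (T : ℝ) : TopologicalSpace.Opens ℂ := ⟨Metric.ball 0 (T + 1), Metric.isOpen_ball⟩

lemma VB_mem {T : ℝ} (x : ℝ) (hx : x ∈ Icc (0:ℝ) T) : (x : ℂ) ∈ VB T := by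
  change (x : ℂ) ∈ Metric.ball 0 (T + 1)
  rw [mem_ball_zero_iff, Complex.norm_real, Real.norm_of_nonneg hx.1]
  linarith [hx.2]

abbrev mE (T : ℝ) (F : ℂ → ℂ) (hF : Differentiable ℂ F) : EV (VB T) := EV.mk F hF.differentiableOn

lemma fn_mE {T : ℝ} {F : ℂ → ℂ} (hF : Differentiable ℂ F) {x : ℂ} (hx : x ∈ VB T) : EV.fn (mE T F hF) x = F x :=
  EV.fn_mk F _ hx

lemma DV_mE {T : ℝ} {F : ℂ → ℂ} (hF : Differentiable ℂ F) : EV.DV (mE T F hF) = mE T (deriv F) (diff_deriv hF) := by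
  refine EV.ext' fun x hx => ?_
  rw [EV.fn_DV _ hx, EV.fn_mk _ _ hx]
  refine Filter.EventuallyEq.deriv_eq ?_
  filter_upwards [(VB T).isOpen.mem_nhds hx] with y hy using fn_mE hF hy

lemma mE_ent {T : ℝ} {F : ℂ → ℂ} (hF : Differentiable ℂ F) : Ent (mE T F hF) := ⟨F, hF, fun x hx => fn_mE hF hx⟩

lemma Lam1_eq {T : ℝ} (hT : 0 ≤ T) (f : EV (VB T)) : Lam1 hT (VB_mem) f = ∫ x in (0:ℝ)..T, EV.fn f x := rfl

lemma fn_mvaeval {V : TopologicalSpace.Opens ℂ} {n : ℕ} (f : Fin n → EV V) (P : MvPolynomial (Fin n) ℂ) {x : ℂ} (hx : x ∈ V) :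
    EV.fn (MvPolynomial.aeval f P) x = MvPolynomial.aeval (fun i => EV.fn (f i) x) P := by
  induction P using MvPolynomial.induction_on with
  | C c => simp [MvPolynomial.algHom_C, EV.fn_alg c hx]
  | add p q hp hq => rw [map_add, EV.fn_add _ _ hx, hp, hq, map_add]
  | mul_X p i hp => rw [map_mul, EV.fn_mul _ _ hx, hp, map_mul, MvPolynomial.aeval_X, MvPolynomial.aeval_X]

lemma mvaeval_fst {V : TopologicalSpace.Opens ℂ} {n : ℕ} (f : Fin n → E2 V) (P : MvPolynomial (Fin n) ℂ) :
    (MvPolynomial.aeval f P).1 = MvPolynomial.aeval (fun i => (f i).1) P :=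
  MvPolynomial.comp_aeval_apply (f := f) (AlgHom.fst ℂ (EV V) (EV V)) P
lemma mvaeval_snd {V : TopologicalSpace.Opens ℂ} {n : ℕ} (f : Fin n → E2 V) (P : MvPolynomial (Fin n) ℂ) :
    (MvPolynomial.aeval f P).2 = MvPolynomial.aeval (fun i => (f i).2) P :=
  MvPolynomial.comp_aeval_apply (f := f) (AlgHom.snd ℂ (EV V) (EV V)) P

lemma Lam1_mom {T : ℝ} (hT : 0 ≤ T) {n : ℕ} {φ : Fin n → ℂ → ℂ} (hφ : ∀ i, Differentiable ℂ (φ i)) (P : MvPolynomial (Fin n) ℂ) (i : Fin n) :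
    Lam1 hT (VB_mem) (MvPolynomial.aeval (fun i => mE T (φ i) (hφ i)) P * EV.DV (mE T (φ i) (hφ i))) = mom T φ P i := by
  rw [Lam1_eq, mom]
  refine intervalIntegral.integral_congr fun x hx => ?_
  rw [uIcc_of_le hT] at hx
  have hx' := VB_mem x hx
  rw [EV.fn_mul _ _ hx', fn_mvaeval _ _ hx', DV_mE, EV.fn_mk _ _ hx']
  simp_rw [EV.fn_mk _ _ hx']

def Reg (T : ℝ) (b : ℂ → ℂ) : Prop := ∀ r : ℝ, ∃ ρ : ℝ, T + 1 ≤ ρ ∧ 0 < ρ ∧ ∀ x : ℂ, ‖x‖ = ρ → r < ‖b x‖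

lemma Reg.intF {T : ℝ} {b : ℂ → ℂ} (h : Reg T b) (hb : Differentiable ℂ b) {r : ℝ} (hr : ∀ x ∈ Metric.ball (0:ℂ) (T+1), ‖b x‖ ≤ r) :
    IntF (Metric.ball 0 (T+1)) b r := by
  obtain ⟨ρ, h1, h2, h3⟩ := h r
  exact intF_of_circle hb h2 h1 hr h3

lemma IntF.alg {V : Set ℂ} {b : ℂ → ℂ} {r : ℝ} (h : IntF V b r) (hV : V.Nonempty) {F : ℂ → ℂ} (hF : Differentiable ℂ F) : AlgF V b r F := by
  obtain ⟨N, χ, h1, h2⟩ := h F hF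
  obtain ⟨x0, hx0⟩ := hV
  refine ⟨N + 1, fun k => if k < N then χ k else fun _ => 1, fun k => ?_, ⟨N, by simp, x0, hx0, by simp⟩, fun x hx => ?_⟩
  · simp only
    split_ifs
    · exact h1 k
    · exact analyticOnNhd_const
  · rw [Finset.sum_range_succ, ← h2 x hx, add_comm]
    congr 1
    · simp
    · refine Finset.sum_congr rfl fun k hk => ?_
      simp only [if_pos (Finset.mem_range.1 hk)]

lemma const_of_ball {T : ℝ} (hT : 0 < T) {b : ℂ → ℂ} (hb : Differentiable ℂ b) (h : ∀ x ∈ VB T, deriv b x = 0) : ∀ x, b x = b 0 := by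
  have h0 : (0:ℂ) ∈ VB T := by simpa using VB_mem (T := T) 0 ⟨le_rfl, hT.le⟩
  have h1 : deriv b = 0 := by
    refine AnalyticOnNhd.eq_of_eventuallyEq (z₀ := 0) (fun x _ => (diff_deriv hb).analyticAt x) (fun x _ => analyticAt_const) ?_
    filter_upwards [(VB T).isOpen.mem_nhds h0] with x hx using h x hx
  intro x
  exact is_const_of_deriv_eq_zero hb (fun x => congrFun h1 x) x 0

lemma Reg.nc {T : ℝ} (hT : 0 < T) {b : ℂ → ℂ} (h : Reg T b) (hb : Differentiable ℂ b) : EV.DV (mE T b hb) ≠ 0 := by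
  intro h0
  rw [DV_mE] at h0
  have := const_of_ball hT hb fun x hx => by
    rw [← fn_mE (diff_deriv hb) hx, h0]
    simpa using EV.fn_alg (V := VB T) 0 hx
  obtain ⟨ρ, h1, h2, h3⟩ := h ‖b 0‖
  have := h3 ρ (by simp [abs_of_pos h2])
  simp_all

lemma ball_bd (T : ℝ) {b : ℂ → ℂ} (hb : Differentiable ℂ b) : ∃ r, 0 ≤ r ∧ ∀ x ∈ Metric.ball (0:ℂ) (T+1), ‖b x‖ ≤ r := by
  obtain ⟨C, hC⟩ := (isCompact_closedBall (0:ℂ) (T+1)).exists_bound_of_continuousOn hb.continuous.continuousOn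
  exact ⟨max C 0, le_max_right _ _, fun x hx => (hC x (Metric.ball_subset_closedBall hx)).trans (le_max_left _ _)⟩

lemma mE_lin (T : ℝ) {n : ℕ} {φ : Fin n → ℂ → ℂ} (hφ : ∀ i, Differentiable ℂ (φ i)) (ξ : Fin n → ℂ) {b : ℂ → ℂ} (hb : Differentiable ℂ b)
    (h : ∀ x, b x = ∑ i, ξ i * φ i x) : mE T b hb = ∑ i, ξ i • mE T (φ i) (hφ i) := by
  refine EV.ext' fun x hx => ?_
  rw [EV.fn_mk _ _ hx, h]
  change _ = (EV.ev x hx) (∑ i, ξ i • mE T (φ i) (hφ i))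
  rw [map_sum]
  refine Finset.sum_congr rfl fun i _ => ?_
  rw [map_smul]
  change _ = ξ i * EV.fn (mE T (φ i) (hφ i)) x
  rw [EV.fn_mk _ _ hx]

lemma PD_mk {T : ℝ} (hT : 0 < T) {n : ℕ} {φ ψ : Fin n → ℂ → ℂ} (hφ : ∀ i, Differentiable ℂ (φ i)) (hψ : ∀ i, Differentiable ℂ (ψ i))
    (ξ : Fin n → ℂ) {b c : ℂ → ℂ} (hb : Differentiable ℂ b) (hc : Differentiable ℂ c)
    (hbe : ∀ x, b x = ∑ i, ξ i * φ i x) (hce : ∀ x, c x = ∑ i, ξ i * ψ i x) (hreg : Reg T b) :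
    ∃ r, (∀ x ∈ Metric.ball (0:ℂ) (T+1), ‖c x‖ ≤ r) ∧
      PD (V := VB T) T (fun i => (mE T (φ i) (hφ i), mE T (ψ i) (hψ i))) (mE T b hb, mE T c hc) r := by
  obtain ⟨r1, h1, h1'⟩ := ball_bd T hb
  obtain ⟨r2, h2, h2'⟩ := ball_bd T hc
  refine ⟨r1 + r2 + 1, fun x hx => (h2' x hx).trans (by linarith), hT.le, (convex_ball _ _).isPreconnected, VB_mem,
    ⟨r1 + r2, by positivity, by linarith, fun x hx => ?_⟩, ⟨ξ, ?_⟩, hreg.nc hT hb, fun i => ⟨mE_ent (hφ i), mE_ent (hψ i)⟩, ?_⟩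
  · rw [EV.fn_mk _ _ hx, EV.fn_mk _ _ hx]
    exact ⟨(h1' x hx).trans (by linarith), (h2' x hx).trans (by linarith)⟩
  · refine Prod.ext ?_ ?_
    · rw [Prod.fst_sum]; exact mE_lin T hφ ξ hb hbe
    · rw [Prod.snd_sum]; exact mE_lin T hψ ξ hc hce
  · intro F hF
    obtain ⟨N, χ, k1, k2⟩ := hreg.intF hb (r := r1 + r2 + 1) (fun x hx => (h1' x hx).trans (by linarith)) F hF
    refine ⟨N, χ, k1, fun x hx => ?_⟩
    rw [EV.fn_mk _ _ hx]
    exact k2 x hx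

lemma Words_mk {T : ℝ} (hT : 0 < T) {n : ℕ} {φ ψ : Fin n → ℂ → ℂ} (hφ : ∀ i, Differentiable ℂ (φ i)) (hψ : ∀ i, Differentiable ℂ (ψ i)) :
    Words (V := VB T) (fun i => (mE T (φ i) (hφ i), mE T (ψ i) (hψ i)))
      (fun l => (mE T (wC φ l) (wC_diff hφ l), mE T (wC ψ l) (wC_diff hψ l))) := by
  have h0 : (0:ℂ) ∈ VB T := by simpa using VB_mem (T := T) 0 ⟨le_rfl, hT.le⟩
  have key : ∀ {φ : Fin n → ℂ → ℂ} (hφ : ∀ i, Differentiable ℂ (φ i)) (i : Fin n) (l : List (Fin n)),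
      EV.DV (mE T (wC φ (i :: l)) (wC_diff hφ (i :: l))) = EV.DV (mE T (φ i) (hφ i)) * mE T (wC φ l) (wC_diff hφ l) := by
    intro φ hφ i l
    have hd : Differentiable ℂ (fun x => deriv (φ i) x * wC φ l x) := (diff_deriv (hφ i)).mul (wC_diff hφ l)
    rw [DV_mE, DV_mE]
    refine EV.ext' fun x hx => ?_
    rw [EV.fn_mul _ _ hx, EV.fn_mk _ _ hx, EV.fn_mk _ _ hx, EV.fn_mk _ _ hx]
    exact (cp_deriv hd x).deriv
  have one : ∀ {φ : Fin n → ℂ → ℂ} (hφ : ∀ i, Differentiable ℂ (φ i)), mE T (wC φ []) (wC_diff hφ []) = 1 := by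
    intro φ hφ
    refine EV.ext' fun x hx => ?_
    rw [EV.fn_mk _ _ hx, EV.fn_one hx]; rfl
  refine ⟨Prod.ext (one hφ) (one hψ), fun i l => Prod.ext (key hφ i l) (key hψ i l), fun i l => ?_, fun i l => ?_, fun l => ⟨mE_ent (wC_diff hφ l), mE_ent (wC_diff hψ l)⟩⟩
  · rw [EV.fn_mk _ _ h0]
    exact cp_zero _
  · rw [EV.fn_mk _ _ h0]
    exact cp_zero _

theorem engS {T : ℝ} (hT : 0 < T) {n : ℕ} {φ : Fin n → ℂ → ℂ} (hφ : ∀ i, Differentiable ℂ (φ i))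
    (ξ : Fin n → ℂ) {b : ℂ → ℂ} (hb : Differentiable ℂ b) (hbe : ∀ x, b x = ∑ i, ξ i * φ i x) (hreg : Reg T b)
    (hm : ∀ P i, mom T φ P i = 0) : ∀ l ≠ [], wd l (dr φ hφ) T = 0 := by
  obtain ⟨r, -, h⟩ := PD_mk hT hφ hφ ξ hb hb hbe hbe hreg
  have hTm : (T : ℂ) ∈ VB T := VB_mem T ⟨hT.le, le_rfl⟩
  intro l hl
  have := single1 h (fun P i => by
    rw [mvaeval_fst]
    exact (Lam1_mom hT.le hφ P i).trans (hm P i)) (Words_mk hT hφ hφ) l hl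
  rw [EV.fn_mk _ _ hTm] at this
  rw [wd_wC, this]

theorem engP {T : ℝ} (hT : 0 < T) {n : ℕ} {φ ψ : Fin n → ℂ → ℂ} (hφ : ∀ i, Differentiable ℂ (φ i)) (hψ : ∀ i, Differentiable ℂ (ψ i))
    (ξ : Fin n → ℂ) {b c : ℂ → ℂ} (hb : Differentiable ℂ b) (hc : Differentiable ℂ c)
    (hbe : ∀ x, b x = ∑ i, ξ i * φ i x) (hce : ∀ x, c x = ∑ i, ξ i * ψ i x) (hreg : Reg T b)
    (hm : ∀ P i, mom T φ P i = mom T ψ P i)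
    (halg : (∃ x, c x ≠ c 0) → ∀ r, (∀ x ∈ Metric.ball (0:ℂ) (T+1), ‖c x‖ ≤ r) → ∀ i, AlgF (Metric.ball (0:ℂ) (T+1)) c r (ψ i)) :
    (∀ l ≠ [], wd l (dr φ hφ) T = 0) ∨ ∀ l, wd l (dr φ hφ) T = wd l (dr ψ hψ) T := by
  obtain ⟨r, hr, h⟩ := PD_mk hT hφ hψ ξ hb hc hbe hce hreg
  have hTm : (T : ℂ) ∈ VB T := VB_mem T ⟨hT.le, le_rfl⟩
  have := pair h (fun P i => by
    have h1 := Lam1_mom hT.le hφ P i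
    have h2 := Lam1_mom hT.le hψ P i
    rw [Lam_apply, Prod.fst_mul, Prod.snd_mul, mvaeval_fst, mvaeval_snd]
    change 1 * Lam1 hT.le VB_mem (_ * EV.DV (mE T (φ i) (hφ i))) + -1 * Lam1 hT.le VB_mem (_ * EV.DV (mE T (ψ i) (hψ i))) = 0
    rw [h1, h2, hm]; ring) (fun hne i => by
    have hx : ∃ x, c x ≠ c 0 := by
      by_contra! hcon
      apply hne
      have hz : deriv c = 0 := by
        have : c = fun _ => c 0 := funext hcon
        rw [this]; funext x; simp
      rw [DV_mE hc]
      refine EV.ext' fun x hx => ?_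
      rw [EV.fn_mk _ _ hx, hz]
      simpa using (EV.fn_alg (V := VB T) 0 hx).symm
    obtain ⟨N, χ, k1, ⟨k, hk, x, hx, k2⟩, k3⟩ := halg hx r hr i
    refine ⟨N, χ, k1, ⟨k, hk, x, hx, ?_⟩, fun x hx => ?_⟩
    · rw [fn_mE hc hx]; exact k2
    · rw [fn_mE hc hx, EV.fn_mk _ _ hx]; exact k3 x hx) (Words_mk hT hφ hψ)
  simp_rw [EV.fn_mk _ _ hTm] at this
  simp_rw [wd_wC]
  exact this

end Ctr
end
end

section
open MeasureTheory Set Filter Topology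
noncomputable section
namespace Ctr
set_option linter.unusedVariables false
open Polynomial

abbrev TT := ℂ[X] × ℂ[X] × ℂ[X]

def mx (T : ℝ) (x : ℂ) : TT →ₗ[ℂ] ℂ :=
  (leval x).comp (LinearMap.fst ℂ _ _) + (leval (ez T x)).comp ((LinearMap.fst ℂ _ _).comp (LinearMap.snd ℂ _ _))
    + (leval (ez T (-x))).comp ((LinearMap.snd ℂ _ _).comp (LinearMap.snd ℂ _ _))

lemma mx_apply (T : ℝ) (x : ℂ) (D : TT) : mx T x D = D.1.eval x + D.2.1.eval (ez T x) + D.2.2.eval (ez T (-x)) := rfl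

lemma mx_diff (T : ℝ) (D : TT) : Differentiable ℂ (fun x => mx T x D) := by
  simp_rw [mx_apply]
  exact (D.1.differentiable.add (D.2.1.differentiable.comp (ez_diff T))).add
    (D.2.2.differentiable.comp ((ez_diff T).comp differentiable_neg))

lemma mx_reg {T : ℝ} (hT : 0 < T) {D : TT} (hD : 0 < D.1.natDegree) : Reg T (fun x => mx T x D) := by
  intro r
  obtain ⟨ρ, h1, h2, h3⟩ := region (c := 2 * Real.pi / T) (by positivity) (Q1 := D.2.1) (Q2 := D.2.2) hD (T + 1) r
  refine ⟨ρ, h1, h2, fun x hx => ?_⟩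
  have := h3 x hx
  have e1 : ez T x = Complex.exp (((2 * Real.pi / T : ℝ) : ℂ) * Complex.I * x) := by
    unfold ez; congr 1; push_cast; ring
  have e2 : ez T (-x) = Complex.exp (-(((2 * Real.pi / T : ℝ) : ℂ) * Complex.I * x)) := by
    unfold ez; congr 1; push_cast; ring
  simp only [mx_apply, e1, e2]
  exact this

def lau (D : TT) : KK := algebraMap ℂ KK (D.1.coeff 0) + (pK D.2.1 + aeval (zX ^ (-1 : ℤ)) D.2.2)

lemma paeval_mem {s : KK} (hs : s ∈ Lam0) (A : ℂ[X]) : aeval s A ∈ Lam0 := by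
  have h1 : aeval s A = ((aeval (⟨s, hs⟩ : Lam0) A : Lam0) : KK) := by
    rw [← Subalgebra.coe_val, ← aeval_algHom_apply]; rfl
  rw [h1]; exact Subtype.property _

lemma lau_mem (D : TT) : lau D ∈ Lam0 :=
  Lam0.add_mem (Lam0.algebraMap_mem _) (Lam0.add_mem (pK_mem _) (paeval_mem (zpow_mem _) _))

lemma mx_lau (T : ℝ) {D : TT} (hD : D.1.natDegree = 0) (x : ℂ) : mx T x D = evL (ez T x) (lau D) := by
  have hz := ez_ne T x
  rw [lau, evL_add hz (Lam0.algebraMap_mem _) (Lam0.add_mem (pK_mem _) (paeval_mem (zpow_mem _) _)), evL_add hz (pK_mem _) (paeval_mem (zpow_mem _) _),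
    evL_alg hz, evL_pK hz, evL_paeval (zpow_mem _) _ hz, evL_zpow hz, ← ez_int, mx_apply, add_assoc]
  congr 2
  · conv_lhs => rw [eq_C_of_natDegree_eq_zero hD, eval_C]
  · simp

open IntermediateField.algebraAdjoinAdjoin in
/-- algebraic dependence -/
lemma alg_rel {f g : KK} (hf : ¬ ∃ c, f = RatFunc.C c) : ∃ P : ℕ → ℂ[X], ∃ N, (∃ k < N, P k ≠ 0) ∧ ∑ k ∈ Finset.range N, aeval f (P k) * g ^ k = 0 := by
  have h1 := RatFunc.isAlgebraic_adjoin_simple_X' f hf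
  have h2 : IsAlgebraic (IntermediateField.adjoin ℂ {f}) g := h1.isAlgebraic g
  have h3 : IsAlgebraic (Algebra.adjoin ℂ {f}) g := (IsFractionRing.isAlgebraic_iff (Algebra.adjoin ℂ {f}) (IntermediateField.adjoin ℂ {f}) _).2 h2
  obtain ⟨p, hp, hpg⟩ := h3
  have h4 : ∀ k, ∃ P : ℂ[X], aeval f P = (p.coeff k : KK) := by
    intro k
    have := (p.coeff k).2
    have h5 : ∀ y ∈ Algebra.adjoin ℂ {f}, ∃ P : ℂ[X], aeval f P = y := by
      intro y hy
      rw [Algebra.adjoin_singleton_eq_range_aeval] at hy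
      exact hy
    exact h5 _ this
  choose P hP using h4
  refine ⟨P, p.natDegree + 1, ⟨p.natDegree, by simp, fun h => ?_⟩, ?_⟩
  · have := hP p.natDegree
    rw [h, map_zero] at this
    exact hp (leadingCoeff_eq_zero.1 (Subtype.ext this.symm))
  · rw [aeval_eq_sum_range] at hpg
    rw [← hpg]
    refine Finset.sum_congr rfl fun k _ => ?_
    rw [hP]; rfl

lemma pure_alg {T : ℝ} (hT : 0 < T) {f g : KK} (hf : f ∈ Lam0) (hg : g ∈ Lam0) (hne : ∃ x, evL (ez T x) f ≠ evL (ez T 0) f) (r : ℝ) :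
    AlgF (Metric.ball (0:ℂ) (T+1)) (fun x => evL (ez T x) f) r (fun x => evL (ez T x) g) := by
  have hc : ¬ ∃ c, f = RatFunc.C c := by
    rintro ⟨c, rfl⟩
    obtain ⟨x, hx⟩ := hne
    apply hx
    rw [← RatFunc.algebraMap_eq_C, evL_alg (ez_ne _ _), evL_alg (ez_ne _ _)]
  obtain ⟨P, N, ⟨k0, hk0, hP⟩, hsum⟩ := alg_rel (g := g) hc
  refine ⟨N, fun k z => (P k).eval z, fun k x _ => (P k).differentiable.analyticAt x, ⟨k0, hk0, ?_⟩, fun x _ => ?_⟩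
  · by_contra! hcon
    have hpre : IsPreconnected ((fun x => evL (ez T x) f) '' Metric.ball (0:ℂ) (T+1)) :=
      (convex_ball _ _).isPreconnected.image _ (feL_diff T hf).continuous.continuousOn
    have hfin : ((fun x => evL (ez T x) f) '' Metric.ball (0:ℂ) (T+1)).Finite := by
      refine (P k0).roots.toFinset.finite_toSet.subset ?_
      rintro _ ⟨x, hx, rfl⟩
      simp only [Finset.mem_coe, Multiset.mem_toFinset, mem_roots hP]
      exact hcon x hx
    have hsub : ((fun x => evL (ez T x) f) '' Metric.ball (0:ℂ) (T+1)).Subsingleton := by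
      by_contra h
      exact hpre.infinite_of_nontrivial (Set.not_subsingleton_iff.1 h) hfin
    obtain ⟨x, hx⟩ := hne
    apply hx
    refine const_of_ball hT (feL_diff T hf) (fun y hy => ?_) x
    have : (fun x => evL (ez T x) f) =ᶠ[𝓝 y] fun _ => evL (ez T y) f := by
      filter_upwards [Metric.isOpen_ball.mem_nhds hy] with z hz using hsub ⟨z, hz, rfl⟩ ⟨y, hy, rfl⟩
    rw [this.deriv_eq]; simp
  · have hz := ez_ne T x
    have h1 : ∀ k, aeval f (P k) * g ^ k ∈ Lam0 := fun k => Lam0.mul_mem (paeval_mem hf _) (Lam0.pow_mem hg k)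
    have hpow : ∀ k, evL (ez T x) (g ^ k) = evL (ez T x) g ^ k := by
      intro k
      have := evL_paeval hg (X ^ k) hz
      simpa using this
    have hs : ∀ N, evL (ez T x) (∑ k ∈ Finset.range N, aeval f (P k) * g ^ k) = ∑ k ∈ Finset.range N, (P k).eval (evL (ez T x) f) * evL (ez T x) g ^ k := by
      intro N
      induction N with
      | zero => simpa using evL_alg hz 0
      | succ N ih =>
        rw [Finset.sum_range_succ, Finset.sum_range_succ, evL_add hz (Lam0.sum_mem fun k _ => h1 k) (h1 N), ih,
          evL_mul hz (paeval_mem hf _) (Lam0.pow_mem hg _), evL_paeval hf _ hz, hpow]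
    rw [← hs N, hsum]
    simpa using evL_alg hz 0

end Ctr
end
end

section
open MeasureTheory Set Filter Topology
noncomputable section
namespace Ctr
set_option linter.unusedVariables false
open Polynomial

lemma mom_integrable {n : ℕ} {φ : Fin n → ℂ → ℂ} (hφ : ∀ i, Differentiable ℂ (φ i)) (P : MvPolynomial (Fin n) ℂ) (i : Fin n) :
    Continuous (fun x : ℝ => MvPolynomial.aeval (fun j => φ j x) P * deriv (φ i) x) := by
  refine Continuous.mul ?_ ((diff_deriv (hφ i)).continuous.comp Complex.continuous_ofReal)
  induction P using MvPolynomial.induction_on with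
  | C c => simp only [MvPolynomial.algHom_C]; exact continuous_const
  | add p q hp hq => simp only [map_add]; exact hp.add hq
  | mul_X p i hp =>
    simp only [map_mul, MvPolynomial.aeval_X]
    exact hp.mul ((hφ i).continuous.comp Complex.continuous_ofReal)

lemma prim_dr {n : ℕ} {φ : Fin n → ℂ → ℂ} (hφ : ∀ i, Differentiable ℂ (φ i)) (h0 : ∀ i, φ i 0 = 0) (i : Fin n) (x : ℝ) :
    primitive ((dr φ hφ).1 i) x = φ i x := by
  unfold primitive
  change ∫ y in (0:ℝ)..x, deriv (φ i) (y:ℂ) = _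
  rw [intervalIntegral.integral_eq_sub_of_hasDerivAt (f := fun y : ℝ => φ i y) (fun y _ => ((hφ i y).hasDerivAt).comp_ofReal)
    (((dr φ hφ).2 i).intervalIntegrable _ _)]
  simp [h0]

lemma moment_mom {T : ℝ} {n : ℕ} {φ : Fin n → ℂ → ℂ} (hφ : ∀ i, Differentiable ℂ (φ i)) (h0 : ∀ i, φ i 0 = 0) (ps : List (Fin n × ℕ)) (i : Fin n) :
    moment T (dr φ hφ).1 ps i = mom T φ ((ps.map fun q => (MvPolynomial.X q.1 : MvPolynomial (Fin n) ℂ) ^ q.2).prod) i := by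
  unfold moment mom
  refine intervalIntegral.integral_congr fun x _ => ?_
  simp only [prim_dr hφ h0, map_list_prod, List.map_map]
  congr 2
  congr 1
  funext q
  simp

/-- the list of index/exponent pairs of a monomial -/
def mlist {n : ℕ} (m : Fin n →₀ ℕ) : List (Fin n × ℕ) := m.support.toList.map fun j => (j, m j)

lemma mlist_pos {n : ℕ} (m : Fin n →₀ ℕ) : ∀ q ∈ mlist m, 0 < q.2 := by
  intro q hq
  simp only [mlist, List.mem_map, Finset.mem_toList, Finsupp.mem_support_iff] at hq
  obtain ⟨j, hj, rfl⟩ := hq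
  exact Nat.pos_of_ne_zero hj

lemma mlist_prod {n : ℕ} (m : Fin n →₀ ℕ) : ((mlist m).map fun q => (MvPolynomial.X q.1 : MvPolynomial (Fin n) ℂ) ^ q.2).prod = MvPolynomial.monomial m 1 := by
  rw [mlist, List.map_map, MvPolynomial.monomial_eq, MvPolynomial.C_1, one_mul, Finsupp.prod]
  exact Finset.prod_map_toList m.support (fun j => (MvPolynomial.X j : MvPolynomial (Fin n) ℂ) ^ m j)

lemma mom_sum {T : ℝ} {n : ℕ} {φ : Fin n → ℂ → ℂ} (hφ : ∀ i, Differentiable ℂ (φ i)) (P : MvPolynomial (Fin n) ℂ) (i : Fin n) :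
    mom T φ P i = ∑ m ∈ P.support, P.coeff m * mom T φ (MvPolynomial.monomial m 1) i := by
  unfold mom
  simp_rw [← intervalIntegral.integral_const_mul]
  rw [← intervalIntegral.integral_finsetSum]
  · refine intervalIntegral.integral_congr fun x _ => ?_
    conv_lhs => rw [P.as_sum, map_sum, Finset.sum_mul]
    refine Finset.sum_congr rfl fun m _ => ?_
    rw [← mul_assoc]
    congr 1
    simp [MvPolynomial.aeval_monomial]
  · intro m _
    exact (continuous_const.mul (mom_integrable hφ _ i)).intervalIntegrable _ _

lemma mom_eq_of {T : ℝ} {n : ℕ} {φ ψ : Fin n → ℂ → ℂ} (hφ : ∀ i, Differentiable ℂ (φ i)) (h0 : ∀ i, φ i 0 = 0)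
    (hψ : ∀ i, Differentiable ℂ (ψ i)) (h0' : ∀ i, ψ i 0 = 0)
    (h : ∀ ps : List (Fin n × ℕ), (∀ q ∈ ps, 0 < q.2) → ∀ i, moment T (dr φ hφ).1 ps i = moment T (dr ψ hψ).1 ps i) (P i) :
    mom T φ P i = mom T ψ P i := by
  rw [mom_sum hφ, mom_sum hψ]
  refine Finset.sum_congr rfl fun m _ => ?_
  rw [← mlist_prod, ← moment_mom hφ h0, ← moment_mom hψ h0', h _ (mlist_pos m)]

lemma mom_zero_of {T : ℝ} {n : ℕ} {φ : Fin n → ℂ → ℂ} (hφ : ∀ i, Differentiable ℂ (φ i)) (h0 : ∀ i, φ i 0 = 0)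
    (h : ∀ ps : List (Fin n × ℕ), (∀ q ∈ ps, 0 < q.2) → ∀ i, moment T (dr φ hφ).1 ps i = 0) (P i) :
    mom T φ P i = 0 := by
  rw [mom_sum hφ]
  refine Finset.sum_eq_zero fun m _ => ?_
  rw [← mlist_prod, ← moment_mom hφ h0, h _ (mlist_pos m), mul_zero]

lemma deg_wd {T : ℝ} (hT : 0 < T) {n : ℕ} {φ : Fin n → ℂ → ℂ} (hφ : ∀ i, Differentiable ℂ (φ i)) {α : Fin n → KK} (hα : ∀ i x, φ i x = feL T α i x)
    (h : DegL α) : ∀ l ≠ [], wd l (dr φ hφ) T = 0 := by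
  obtain ⟨s, hs, hA⟩ := h
  choose A hA using hA
  set σ : ℂ → ℂ := fun x => evL (ez T x) s with hσ
  have hσd : Differentiable ℂ σ := feL_diff T hs
  have hφ' : ∀ i, φ i = fun x => (A i).eval (σ x) := by
    intro i; funext x
    rw [hα, feL, hA, evL_paeval hs _ (ez_ne _ _)]
  have key : ∀ l, ∃ B : ℂ[X], (l ≠ [] → B.eval (σ 0) = 0) ∧ ∀ x : ℝ, wd l (dr φ hφ) x = B.eval (σ x) := by
    intro l
    induction l with
    | nil => exact ⟨1, by simp, fun x => by simp [wd, simplexInt]⟩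
    | cons i l ih =>
      obtain ⟨B, -, hB⟩ := ih
      obtain ⟨B', -, h2, h3⟩ := int_pull hT hσd (derivative (A i) * B) 0
      refine ⟨B', fun _ => h2, fun x => ?_⟩
      rw [wd_cons, ← h3]
      refine intervalIntegral.integral_congr fun y _ => ?_
      simp only [hB]
      have : (dr φ hφ).1 i y = (derivative (A i)).eval (σ y) * deriv σ y := by
        change deriv (φ i) y = _
        rw [hφ']
        exact (((A i).hasDerivAt (σ y)).comp (y:ℂ) (hσd y).hasDerivAt).deriv
      rw [this, eval_mul]; ring
  intro l hl
  obtain ⟨B, h1, h2⟩ := key l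
  rw [h2, ← h1 hl]
  congr 1
  have := feL_per hT s 0
  simpa [hσ] using this

abbrev fm (T : ℝ) {n : ℕ} (D : Fin n → TT) : Fin n → ℂ → ℂ := fun i x => mx T x (D i)
lemma fm_diff (T : ℝ) {n : ℕ} (D : Fin n → TT) : ∀ i, Differentiable ℂ (fm T D i) := fun i => mx_diff T (D i)

lemma lin_mx (T : ℝ) {n : ℕ} (D : Fin n → TT) (ξ : Fin n → ℂ) (x : ℂ) : mx T x (∑ i, ξ i • D i) = ∑ i, ξ i * fm T D i x := by
  rw [map_sum]; simp only [map_smul, smul_eq_mul]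

theorem thmS {T : ℝ} (hT : 0 < T) {n : ℕ} (D : Fin n → TT) (hm : ∀ P i, mom T (fm T D) P i = 0) :
    ∀ l ≠ [], wd l (dr (fm T D) (fm_diff T D)) T = 0 := by
  by_cases h : ∃ i, 0 < (D i).1.natDegree
  · obtain ⟨i, hi⟩ := h
    have e : (∑ j, (Pi.single i 1 : Fin n → ℂ) j • D j) = D i := by
      rw [Finset.sum_eq_single i] <;> simp +contextual
    refine engS hT (fm_diff T D) (Pi.single i 1) (mx_diff T (D i)) (fun x => ?_) (mx_reg hT hi) hm
    rw [← lin_mx, e]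
  · push Not at h
    have hf : fm T D = feL T (fun i => lau (D i)) := by
      funext i x; exact mx_lau T (by have := h i; omega) x
    exact deg_wd hT _ (fun i x => congrFun (congrFun hf i) x) (pureS hT (fun i => lau_mem _) (by rw [← hf]; exact hm))

lemma xi_choice {n : ℕ} (D D' : Fin n → TT) (h : ∃ i, 0 < (D i).1.natDegree) :
    ∃ ξ : Fin n → ℂ, 0 < (∑ i, ξ i • D i).1.natDegree ∧ ((∃ i, 0 < (D' i).1.natDegree) → 0 < (∑ i, ξ i • D' i).1.natDegree) := by
  obtain ⟨i, hi⟩ := h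
  have e : ∀ (D : Fin n → TT) i, (∑ j, (Pi.single i 1 : Fin n → ℂ) j • D j) = D i := by
    intro D i
    rw [Finset.sum_eq_single i] <;> simp +contextual
  by_cases h' : ∃ i, 0 < (D' i).1.natDegree
  · obtain ⟨j, hj⟩ := h'
    by_cases h1 : 0 < (D' i).1.natDegree
    · exact ⟨Pi.single i 1, by rwa [e], fun _ => by rwa [e]⟩
    by_cases h2 : 0 < (D j).1.natDegree
    · exact ⟨Pi.single j 1, by rwa [e], fun _ => by rwa [e]⟩
    refine ⟨Pi.single i 1 + Pi.single j 1, ?_, fun _ => ?_⟩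
    · simp only [Pi.add_apply, add_smul, Finset.sum_add_distrib, e, Prod.fst_add]
      rw [natDegree_add_eq_left_of_natDegree_lt (by omega)]; exact hi
    · simp only [Pi.add_apply, add_smul, Finset.sum_add_distrib, e, Prod.fst_add]
      rw [natDegree_add_eq_right_of_natDegree_lt (by omega)]; exact hj
  · exact ⟨Pi.single i 1, by rwa [e], fun hh => absurd hh h'⟩

lemma evL_sum {z : ℂ} (hz : z ≠ 0) {n : ℕ} {α : Fin n → KK} (hα : ∀ i, α i ∈ Lam0) (ξ : Fin n → ℂ) :
    evL z (∑ i, algebraMap ℂ KK (ξ i) * α i) = ∑ i, ξ i * evL z (α i) := by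
  have := evL_aeval hα (∑ i, MvPolynomial.C (ξ i) * MvPolynomial.X i) hz
  simpa [map_sum, MvPolynomial.algHom_C] using this

theorem thmPA {T : ℝ} (hT : 0 < T) {n : ℕ} (D D' : Fin n → TT) (h0 : ∀ i, mx T 0 (D i) = 0) (ha : ∃ i, 0 < (D i).1.natDegree)
    (hm : ∀ P i, mom T (fm T D) P i = mom T (fm T D') P i) (l : List (Fin n)) :
    wd l (dr (fm T D) (fm_diff T D)) T = wd l (dr (fm T D') (fm_diff T D')) T := by
  obtain ⟨ξ, h1, h2⟩ := xi_choice D D' ha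
  have := engP hT (fm_diff T D) (fm_diff T D') ξ (mx_diff T _) (mx_diff T _) (lin_mx T D ξ) (lin_mx T D' ξ) (mx_reg hT h1) hm (by
    intro hne r hr i
    by_cases h' : ∃ i, 0 < (D' i).1.natDegree
    · exact ((mx_reg hT (h2 h')).intF (mx_diff T _) hr).alg ⟨0, by simp; linarith⟩ (fm_diff T D' i)
    · push Not at h'
      have hf : ∀ i x, fm T D' i x = evL (ez T x) (lau (D' i)) := fun i x => mx_lau T (by have := h' i; omega) x
      have hc : (fun x => mx T x (∑ i, ξ i • D' i)) = fun x => evL (ez T x) (∑ i, algebraMap ℂ KK (ξ i) * lau (D' i)) := by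
        funext x
        rw [lin_mx, evL_sum (ez_ne T x) (fun i => lau_mem _)]
        simp only [hf]
      have hF : fm T D' i = fun x => evL (ez T x) (lau (D' i)) := funext (hf i)
      rw [hc, hF]
      refine pure_alg hT (Lam0.sum_mem fun i _ => Lam0.mul_mem (Lam0.algebraMap_mem _) (lau_mem _)) (lau_mem _) ?_ r
      obtain ⟨x, hx⟩ := hne
      refine ⟨x, ?_⟩
      have e1 := congrFun hc x
      have e2 := congrFun hc 0
      rw [← e1, ← e2]; exact hx)
  rcases this with h | h
  · by_cases hl : l = []
    · subst hl; rfl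
    · rw [h l hl, thmS hT D' (fun P i => ?_) l hl]
      rw [← hm]
      exact mom_zero_of (fm_diff T D) h0 (fun ps _ i => moment_zero_of_wd _ T h ps i) P i
  · exact h l

theorem thmP {T : ℝ} (hT : 0 < T) {n : ℕ} (D D' : Fin n → TT) (h0 : ∀ i, mx T 0 (D i) = 0) (h0' : ∀ i, mx T 0 (D' i) = 0)
    (hm : ∀ P i, mom T (fm T D) P i = mom T (fm T D') P i) :
    DeterminesCenter T (dr (fm T D) (fm_diff T D)).1 ↔ DeterminesCenter T (dr (fm T D') (fm_diff T D')).1 := by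
  by_cases ha : ∃ i, 0 < (D i).1.natDegree
  · exact center_of_wd hT _ _ (thmPA hT D D' h0 ha hm)
  by_cases ha' : ∃ i, 0 < (D' i).1.natDegree
  · exact (center_of_wd hT _ _ (thmPA hT D' D h0' ha' (fun P i => (hm P i).symm))).symm
  push Not at ha ha'
  have hf : fm T D = feL T (fun i => lau (D i)) := by
    funext i x; exact mx_lau T (by have := ha i; omega) x
  have hf' : fm T D' = feL T (fun i => lau (D' i)) := by
    funext i x; exact mx_lau T (by have := ha' i; omega) x
  have hm2 := hm
  rw [hf, hf'] at hm2
  rcases pureP hT (fun i => lau_mem _) (fun i => lau_mem _) hm2 with ⟨h1, h2⟩ | ⟨xc, h⟩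
  · have k1 := deg_wd hT (fm_diff T D) (fun i x => congrFun (congrFun hf i) x) h1
    have k2 := deg_wd hT (fm_diff T D') (fun i x => congrFun (congrFun hf' i) x) h2
    refine center_of_wd hT _ _ fun l => ?_
    by_cases hl : l = []
    · subst hl; rfl
    · rw [k1 l hl, k2 l hl]
  · rw [← hf, ← hf'] at h
    have per : ∀ {D : Fin n → TT} (hf : fm T D = feL T (fun i => lau (D i))) i (x : ℂ), deriv (fm T D i) (x + T) = deriv (fm T D i) x := by
      intro D hf i x
      have : (fun x => fm T D i (x + T)) = fm T D i := by
        funext x; rw [hf]; exact feL_per hT _ x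
      rw [← deriv_comp_add_const, this]
    have sh : ∀ i x, deriv (fm T D' i) x = deriv (fm T D i) (x + xc) := by
      intro i x
      rw [← deriv_comp_add_const]
      congr 1
      funext x; exact h i x
    constructor
    · exact center_shift hT (fun i => diff_deriv (fm_diff T D i)) (per hf) xc sh
    · exact center_shift hT (fun i => diff_deriv (fm_diff T D' i)) (per hf') (-xc) (fun i x => by rw [sh]; congr 1; ring)

end Ctr
end
end

section
open MeasureTheory Set Filter Topology
noncomputable section
namespace Ctr
set_option linter.unusedVariables false
open Polynomial

def Adm (T : ℝ) (e : ℂ → ℂ) : Prop := ∃ D : TT, mx T 0 D = 0 ∧ ∀ x, e x = deriv (fun y => mx T y D) x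

lemma Adm.sum {T : ℝ} {ι : Type*} (s : Finset ι) {e : ι → ℂ → ℂ} (h : ∀ j, Adm T (e j)) (c : ι → ℂ) : Adm T (fun x => ∑ j ∈ s, c j * e j x) := by
  choose D h1 h2 using h
  refine ⟨∑ j ∈ s, c j • D j, ?_, fun x => ?_⟩
  · rw [map_sum]
    exact Finset.sum_eq_zero fun j _ => by rw [map_smul, h1, smul_zero]
  · have : (fun y => mx T y (∑ j ∈ s, c j • D j)) = fun y => ∑ j ∈ s, c j * mx T y (D j) := by
      funext y; rw [map_sum]; simp only [map_smul, smul_eq_mul]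
    rw [this]
    have hd : HasDerivAt (fun y => ∑ j ∈ s, c j * mx T y (D j)) (∑ j ∈ s, c j * deriv (fun y => mx T y (D j)) x) x :=
      HasDerivAt.fun_sum fun j _ => ((mx_diff T (D j) x).hasDerivAt).const_mul (c j)
    rw [hd.deriv]
    exact Finset.sum_congr rfl fun j _ => by rw [h2]

lemma Adm.exp {T : ℝ} (hT : 0 < T) (j : ℤ) : Adm T (fun x => ez T (j * x)) := by
  set ω : ℂ := 2 * (Real.pi : ℂ) * Complex.I / (T : ℂ) with hω
  have hω0 : ω ≠ 0 := by
    have : (T : ℂ) ≠ 0 := by exact_mod_cast hT.ne'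
    have h2 : (Real.pi : ℂ) ≠ 0 := by exact_mod_cast Real.pi_ne_zero
    rw [hω]
    exact div_ne_zero (mul_ne_zero (mul_ne_zero two_ne_zero h2) Complex.I_ne_zero) this
  have hd : ∀ (k : ℂ) x, HasDerivAt (fun y => ez T (k * y)) (k * (ω * ez T (k * x))) x := by
    intro k x
    have := (ez_deriv T (k * x)).comp x ((hasDerivAt_id x).const_mul k)
    refine this.congr_deriv ?_
    simp only [hω]; ring
  rcases lt_trichotomy j 0 with h | h | h
  · obtain ⟨k, hk⟩ : ∃ k : ℕ, j = -k := ⟨j.natAbs, by omega⟩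
    subst hk
    have hk0 : (k : ℂ) ≠ 0 := by
      have : k ≠ 0 := by omega
      exact_mod_cast this
    have e : ∀ y, mx T y (C (1 / (ω * k)), 0, C (-1 / (ω * k)) * X ^ k) = 1 / (ω * k) + -1 / (ω * k) * ez T (-k * y) := by
      intro y
      have := ez_int T (-y) k
      rw [mx_apply]; simp only [eval_C, eval_zero, eval_mul, eval_pow, eval_X, add_zero]
      rw [← zpow_natCast, ← ez_int]; congr 3; push_cast; ring
    refine ⟨(C (1 / (ω * k)), 0, C (-1 / (ω * k)) * X ^ k), ?_, fun x => ?_⟩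
    · rw [e]; simp [ez_zero]; ring
    · simp_rw [e]
      rw [(((hd (-k) x).const_mul (-1 / (ω * k))).const_add _).deriv]
      push_cast
      field_simp
  · subst h
    refine ⟨(X, 0, 0), by simp [mx_apply], fun x => ?_⟩
    simp [mx_apply, ez_zero]
  · obtain ⟨k, hk⟩ : ∃ k : ℕ, j = k := ⟨j.natAbs, by omega⟩
    subst hk
    have hk0 : (k : ℂ) ≠ 0 := by
      have : k ≠ 0 := by omega
      exact_mod_cast this
    have e : ∀ y, mx T y (C (-1 / (ω * k)), C (1 / (ω * k)) * X ^ k, 0) = -1 / (ω * k) + 1 / (ω * k) * ez T (k * y) := by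
      intro y
      rw [mx_apply]; simp only [eval_C, eval_zero, eval_mul, eval_pow, eval_X, add_zero]
      rw [← zpow_natCast, ← ez_int]; congr 3
    refine ⟨(C (-1 / (ω * k)), C (1 / (ω * k)) * X ^ k, 0), ?_, fun x => ?_⟩
    · rw [e]; simp [ez_zero]; ring
    · simp_rw [e]
      rw [(((hd k x).const_mul (1 / (ω * k))).const_add _).deriv]
      push_cast
      field_simp

lemma adm {T : ℝ} (hT : 0 < T) {e : ℝ → ℂ} (he : Admissible T e) :
    ∃ D : TT, mx T 0 D = 0 ∧ ∀ x ∈ Icc (0:ℝ) T, e x = deriv (fun y => mx T y D) x := by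
  rcases he with ⟨p, hp⟩ | ⟨s, c, h⟩
  · obtain ⟨B, h1, h2, -⟩ := int_pull hT (s := fun x => x) differentiable_id p 0
    refine ⟨(B, 0, 0), by simpa [mx_apply] using h2, fun x hx => ?_⟩
    rw [hp x hx]
    simp only [mx_apply, eval_zero, add_zero]
    rw [B.deriv, h1]
  · obtain ⟨D, h1, h2⟩ := Adm.sum s (Adm.exp hT) c
    refine ⟨D, h1, fun x hx => ?_⟩
    rw [h x hx, ← h2]
    refine Finset.sum_congr rfl fun j _ => ?_
    unfold ez
    congr 2; ring

lemma momPoly (T : ℝ) {n : ℕ} {σ : Type*} [Fintype σ] (Ds : Fin n → σ → TT) (P : MvPolynomial (Fin n) ℂ) (i : Fin n) :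
    ∃ M : MvPolynomial σ ℂ, ∀ γ : σ → ℂ, mom T (fm T (fun i => ∑ s, γ s • Ds i s)) P i = MvPolynomial.eval γ M := by
  classical
  let g : Fin n → σ → C(ℝ, ℂ) := fun j s => ⟨fun x => mx T x (Ds j s), (mx_diff T _).continuous.comp Complex.continuous_ofReal⟩
  let d : Fin n → σ → C(ℝ, ℂ) := fun j s => ⟨fun x => deriv (fun y => mx T y (Ds j s)) x, (diff_deriv (mx_diff T _)).continuous.comp Complex.continuous_ofReal⟩
  let R : MvPolynomial σ C(ℝ, ℂ) := MvPolynomial.aeval (fun j => ∑ s, MvPolynomial.C (g j s) * MvPolynomial.X s) P * ∑ s, MvPolynomial.C (d i s) * MvPolynomial.X s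
  let evx : ℝ → C(ℝ, ℂ) →+* ℂ := fun x => { toFun := fun f => f x, map_one' := rfl, map_mul' := fun _ _ => rfl, map_zero' := rfl, map_add' := fun _ _ => rfl }
  have hev : ∀ (γ : σ → ℂ) (x : ℝ), MvPolynomial.eval₂Hom (evx x) γ R = MvPolynomial.aeval (fun j => fm T (fun i => ∑ s, γ s • Ds i s) j x) P * deriv (fm T (fun i => ∑ s, γ s • Ds i s) i) x := by
    intro γ x
    rw [map_mul]
    congr 1
    · induction P using MvPolynomial.induction_on with
      | C c =>
        simp only [MvPolynomial.algHom_C]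
        rw [MvPolynomial.algebraMap_apply, MvPolynomial.coe_eval₂Hom, MvPolynomial.eval₂_C]
        rfl
      | add p q hp hq => rw [map_add, map_add, hp, hq, map_add]
      | mul_X p j hp =>
        rw [map_mul, map_mul, hp, map_mul, MvPolynomial.aeval_X, MvPolynomial.aeval_X, map_sum, fm, map_sum]
        congr 1
        refine Finset.sum_congr rfl fun s _ => ?_
        rw [map_mul, map_smul, smul_eq_mul, MvPolynomial.coe_eval₂Hom, MvPolynomial.eval₂_C, MvPolynomial.eval₂_X, mul_comm]
        rfl
    · have hd : HasDerivAt (fm T (fun i => ∑ s, γ s • Ds i s) i) (∑ s, γ s * deriv (fun y => mx T y (Ds i s)) x) (x:ℂ) := by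
        have : fm T (fun i => ∑ s, γ s • Ds i s) i = fun y => ∑ s, γ s * mx T y (Ds i s) := by
          funext y; rw [fm, map_sum]; simp only [map_smul, smul_eq_mul]
        rw [this]
        exact HasDerivAt.fun_sum fun s _ => ((mx_diff T (Ds i s) x).hasDerivAt).const_mul (γ s)
      rw [hd.deriv, map_sum]
      refine Finset.sum_congr rfl fun s _ => ?_
      rw [map_mul, MvPolynomial.coe_eval₂Hom, MvPolynomial.eval₂_C, MvPolynomial.eval₂_X, mul_comm]
      rfl
  refine ⟨∑ m ∈ R.support, MvPolynomial.monomial m (∫ x in (0:ℝ)..T, R.coeff m x), fun γ => ?_⟩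
  unfold mom
  simp_rw [← hev, MvPolynomial.coe_eval₂Hom, MvPolynomial.eval₂_eq]
  rw [intervalIntegral.integral_finsetSum, map_sum]
  · refine Finset.sum_congr rfl fun m _ => ?_
    rw [MvPolynomial.eval_monomial, Finsupp.prod, ← intervalIntegral.integral_mul_const]
    rfl
  · intro m _
    exact Continuous.intervalIntegrable ((R.coeff m).continuous.mul continuous_const) _ _

lemma noeth {σ ι : Type*} [Finite σ] (M : ι → MvPolynomial σ ℂ) :
    ∃ S : Finset ι, ∀ γ : σ → ℂ, (∀ i ∈ S, MvPolynomial.eval γ (M i) = 0) → ∀ i, MvPolynomial.eval γ (M i) = 0 := by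
  classical
  have h := (isNoetherianRing_iff_ideal_fg (MvPolynomial σ ℂ)).1 inferInstance (Ideal.span (range M))
  obtain ⟨S, hS, hS2⟩ := Submodule.fg_span_iff_fg_span_finset_subset (range M) |>.1 h
  rcases isEmpty_or_nonempty ι with hι | hι
  · exact ⟨∅, fun _ _ i => isEmptyElim i⟩
  choose! pre hpre using (fun x (hx : x ∈ S) => hS hx : ∀ x ∈ S, ∃ i, M i = x)
  refine ⟨S.image pre, fun γ hγ i => ?_⟩
  have h1 : M i ∈ Ideal.span (S : Set (MvPolynomial σ ℂ)) := by
    have : M i ∈ Ideal.span (range M) := Ideal.subset_span ⟨i, rfl⟩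
    rw [Ideal.span, hS2] at this
    exact this
  have h2 : Ideal.span (S : Set (MvPolynomial σ ℂ)) ≤ RingHom.ker (MvPolynomial.eval γ) := by
    rw [Ideal.span_le]
    intro x hx
    have := hγ (pre x) (Finset.mem_image_of_mem _ hx)
    rw [hpre x hx] at this
    exact this
  exact h2 h1

lemma noeth2 {σ ι : Type*} [Finite σ] (M : ι → MvPolynomial σ ℂ) :
    ∃ S : Finset ι, ∀ γ γ' : σ → ℂ, (∀ i ∈ S, MvPolynomial.eval γ (M i) = MvPolynomial.eval γ' (M i)) → ∀ i, MvPolynomial.eval γ (M i) = MvPolynomial.eval γ' (M i) := by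
  obtain ⟨S, hS⟩ := noeth (σ := σ ⊕ σ) (fun i => MvPolynomial.rename Sum.inl (M i) - MvPolynomial.rename Sum.inr (M i))
  refine ⟨S, fun γ γ' h i => ?_⟩
  have := hS (Sum.elim γ γ') (fun i hi => by
    rw [map_sub, MvPolynomial.eval_rename, MvPolynomial.eval_rename]
    simpa [sub_eq_zero] using h i hi) i
  rw [map_sub, MvPolynomial.eval_rename, MvPolynomial.eval_rename] at this
  simpa [sub_eq_zero] using this

lemma center_congr {T : ℝ} {n : ℕ} {a b : Fin n → ℝ → ℂ} (h : ∀ i, ∀ x ∈ Icc (0:ℝ) T, a i x = b i x) (hb : DeterminesCenter T a) : DeterminesCenter T b := by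
  obtain ⟨ε, he, h2⟩ := hb
  refine ⟨ε, he, fun v hv hv0 => h2 v (fun x hx => ?_) hv0⟩
  rw [hv x hx]
  congr 1
  refine intervalIntegral.integral_congr fun s hs => ?_
  rw [uIcc_of_le hx.1] at hs
  exact Finset.sum_congr rfl fun i _ => by rw [h i s ⟨hs.1, hs.2.trans hx.2⟩]

lemma simplex_congr {T : ℝ} {n : ℕ} {a b : Fin n → ℝ → ℂ} (h : ∀ i, ∀ x ∈ Icc (0:ℝ) T, a i x = b i x) (l : List (Fin n)) :
    ∀ x ∈ Icc (0:ℝ) T, simplexInt (l.map a) x = simplexInt (l.map b) x := by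
  induction l with
  | nil => intro x _; rfl
  | cons i l ih =>
    intro x hx
    refine intervalIntegral.integral_congr fun s hs => ?_
    rw [uIcc_of_le hx.1] at hs
    have hs' : s ∈ Icc (0:ℝ) T := ⟨hs.1, hs.2.trans hx.2⟩
    simp only [ih s hs', h i s hs']

lemma moment_congr {T : ℝ} (hT : 0 < T) {n : ℕ} {a b : Fin n → ℝ → ℂ} (h : ∀ i, ∀ x ∈ Icc (0:ℝ) T, a i x = b i x) (ps : List (Fin n × ℕ)) (i : Fin n) :
    moment T a ps i = moment T b ps i := by
  have hp : ∀ i, ∀ x ∈ Icc (0:ℝ) T, primitive (a i) x = primitive (b i) x := by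
    intro i x hx
    refine intervalIntegral.integral_congr fun s hs => ?_
    rw [uIcc_of_le hx.1] at hs
    exact h i s ⟨hs.1, hs.2.trans hx.2⟩
  refine intervalIntegral.integral_congr fun s hs => ?_
  rw [uIcc_of_le hT.le] at hs
  simp only [hp _ s hs, h i s hs]

end Ctr
end
end

section
open MeasureTheory Set Filter Topology
noncomputable section
namespace Ctr
set_option linter.unusedVariables false
open Polynomial

lemma rep {T : ℝ} (hT : 0 < T) {n k : ℕ} (a : Fin n → (Fin k → ℂ) → ℝ → ℂ)
    (hrep : ∀ i, ∃ (m : ℕ) (c : Fin m → (Fin k → ℂ) → ℂ) (e : Fin m → ℝ → ℂ),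
      (∀ j, Differentiable ℂ (c j)) ∧ (∀ j, Admissible T (e j)) ∧
      ∀ (w : Fin k → ℂ), ∀ x ∈ Icc (0:ℝ) T, a i w x = ∑ j, c j w * e j x) :
    ∃ (σ : Type) (_ : Fintype σ) (cw : (Fin k → ℂ) → σ → ℂ) (Ds : Fin n → σ → TT), Continuous cw ∧
      (∀ i s, mx T 0 (Ds i s) = 0) ∧ ∀ i w, ∀ x ∈ Icc (0:ℝ) T, a i w x = ∑ s, cw w s * deriv (fun y => mx T y (Ds i s)) x := by
  classical
  choose m c e hc he hr using hrep
  choose D hD0 hD using fun i j => adm hT (he i j)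
  refine ⟨(Σ i, Fin (m i)), inferInstance, fun w s => c s.1 s.2 w, fun i s => if s.1 = i then D s.1 s.2 else 0, ?_, ?_, ?_⟩
  · exact continuous_pi fun s => (hc s.1 s.2).continuous
  · intro i s
    dsimp only
    split_ifs
    · exact hD0 _ _
    · exact map_zero _
  · intro i w x hx
    rw [hr i w x hx, Fintype.sum_sigma, Finset.sum_eq_single i]
    · refine Finset.sum_congr rfl fun j _ => ?_
      simp only [if_true]
      rw [hD i j x hx]
    · intro b _ hb
      refine Finset.sum_eq_zero fun j _ => ?_
      simp only [if_neg hb, map_zero, deriv_const, mul_zero]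
    · simp

lemma fm_deriv {T : ℝ} {n : ℕ} {σ : Type*} [Fintype σ] (Ds : Fin n → σ → TT) (γ : σ → ℂ) (i : Fin n) (x : ℂ) :
    deriv (fm T (fun i => ∑ s, γ s • Ds i s) i) x = ∑ s, γ s * deriv (fun y => mx T y (Ds i s)) x := by
  have : fm T (fun i => ∑ s, γ s • Ds i s) i = fun y => ∑ s, γ s * mx T y (Ds i s) := by
    funext y; rw [fm, map_sum]; simp only [map_smul, smul_eq_mul]
  rw [this]
  exact (HasDerivAt.fun_sum fun s _ => ((mx_diff T (Ds i s) x).hasDerivAt).const_mul (γ s)).deriv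

set_option maxHeartbeats 1000000 in
theorem main (T : ℝ) (hT : 0 < T) (n k : ℕ) (hn : 1 ≤ n)
    (a : Fin n → (Fin k → ℂ) → ℝ → ℂ)
    (hrep : ∀ i, ∃ (m : ℕ) (c : Fin m → (Fin k → ℂ) → ℂ) (e : Fin m → ℝ → ℂ),
      (∀ j, Differentiable ℂ (c j)) ∧ (∀ j, Admissible T (e j)) ∧
      ∀ (w : Fin k → ℂ), ∀ x ∈ Icc (0:ℝ) T, a i w x = ∑ j, c j w * e j x) :
    ∀ K : Set (Fin k → ℂ), IsCompact K →
      ∃ N : ℕ, 1 ≤ N ∧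
        ∃ (ps : Fin N → List (Fin n × ℕ)) (idx : Fin N → Fin n)
          (f : Fin N → (Fin N → ℂ) → ℂ),
          (∀ j, ∀ q ∈ ps j, 0 < q.2) ∧ (∀ j, Continuous (f j)) ∧
          {w : Fin k → ℂ | DeterminesCenter T (fun i => a i w)} ∩ K =
            {w ∈ K | ∀ j, f j
              (fun t => moment T (fun i => a i w) (ps t) (idx t)) = 0} ∧
          {w : Fin k → ℂ | ∀ l : List (Fin n), l ≠ [] →
              iterInt T (fun i => a i w) l = 0} ∩ K =
            {w ∈ K | ∀ j, moment T (fun i => a i w) (ps j) (idx j) = 0} := by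
  classical
  intro K hK
  obtain ⟨σ, _, cw, Ds, hcw, hDs, har⟩ := rep hT a hrep
  let DD : (Fin k → ℂ) → Fin n → TT := fun w i => ∑ s, cw w s • Ds i s
  let A : (Fin k → ℂ) → CF n := fun w => dr (fm T (DD w)) (fm_diff T (DD w))
  have h0 : ∀ w i, mx T 0 (DD w i) = 0 := fun w i => by
    rw [map_sum]
    exact Finset.sum_eq_zero fun s _ => by rw [map_smul, hDs, smul_zero]
  have hA : ∀ w i x, (A w).1 i x = ∑ s, cw w s * deriv (fun y => mx T y (Ds i s)) x := fun w i x => fm_deriv Ds (cw w) i x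
  have haA : ∀ w i, ∀ x ∈ Icc (0:ℝ) T, a i w x = (A w).1 i x := fun w i x hx => by rw [hA, har i w x hx]
  have hcen : ∀ w, DeterminesCenter T (fun i => a i w) ↔ DeterminesCenter T (A w).1 := fun w =>
    ⟨center_congr (haA w), center_congr fun i x hx => (haA w i x hx).symm⟩
  let ι := {ps : List (Fin n × ℕ) // ∀ q ∈ ps, 0 < q.2} × Fin n
  choose M hM using fun t : ι => momPoly T Ds ((t.1.1.map fun q => (MvPolynomial.X q.1 : MvPolynomial (Fin n) ℂ) ^ q.2).prod) t.2
  have hMA : ∀ w (t : ι), moment T (A w).1 t.1.1 t.2 = MvPolynomial.eval (cw w) (M t) := fun w t => by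
    rw [← hM]; exact moment_mom (fm_diff T (DD w)) (h0 w) _ _
  have hMa : ∀ w (t : ι), moment T (fun i => a i w) t.1.1 t.2 = MvPolynomial.eval (cw w) (M t) := fun w t => by
    rw [← hMA]; exact moment_congr hT (haA w) _ _
  obtain ⟨S0, hS0⟩ := noeth M
  obtain ⟨S1, hS1⟩ := noeth2 M
  let t0 : ι := (⟨[], by simp⟩, ⟨0, hn⟩)
  let S : Finset ι := insert t0 (S0 ∪ S1)
  let eq := S.equivFin.symm
  have hsurj : ∀ t ∈ S, ∃ j, (eq j : ι) = t := fun t ht => ⟨S.equivFin ⟨t, ht⟩, by simp [eq]⟩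
  let mm : (Fin k → ℂ) → Fin S.card → ℂ := fun w j => MvPolynomial.eval (cw w) (M (eq j))
  have hmm : Continuous mm := continuous_pi fun j => (MvPolynomial.continuous_eval (M (eq j))).comp hcw
  have hmme : ∀ w, (fun j => moment T (fun i => a i w) (eq j : ι).1.1 (eq j : ι).2) = mm w := fun w => funext fun j => hMa w _
  have hsat : ∀ w w', mm w = mm w' → (DeterminesCenter T (fun i => a i w) ↔ DeterminesCenter T (fun i => a i w')) := by
    intro w w' h
    have h2 := hS1 (cw w) (cw w') (fun t ht => by
      obtain ⟨j, rfl⟩ := hsurj t (Finset.mem_insert_of_mem (Finset.mem_union_right _ ht))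
      exact congrFun h j)
    rw [hcen, hcen]
    refine thmP hT (DD w) (DD w') (h0 w) (h0 w') (mom_eq_of (fm_diff T (DD w)) (h0 w) (fm_diff T (DD w')) (h0 w') fun ps hps i => ?_)
    have := h2 (⟨ps, hps⟩, i)
    rw [← hMA, ← hMA] at this
    exact this
  have hclosed : IsClosed {w | DeterminesCenter T (fun i => a i w)} := by
    have hj : ∀ i, Continuous fun q : (Fin k → ℂ) × ℝ => (A q.1).1 i q.2 := by
      intro i
      simp_rw [hA]
      refine continuous_finsetSum _ fun s _ => ?_
      exact ((continuous_apply s).comp (hcw.comp continuous_fst)).mul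
        (((diff_deriv (mx_diff T (Ds i s))).continuous.comp Complex.continuous_ofReal).comp continuous_snd)
    have : {w | DeterminesCenter T (fun i => a i w)} = ⋂ (p : ℕ) (d : ℕ), {w | WW (A w).1 p (d + 1) T = 0} := by
      ext w
      simp only [mem_setOf_eq, mem_iInter]
      rw [hcen, center_iff hT (A w).2]
    rw [this]
    refine isClosed_iInter fun p => isClosed_iInter fun d => ?_
    have hc := (WW_joint (b := fun w => (A w).1) hj p (d + 1)).comp (Continuous.prodMk_left T)
    exact isClosed_eq hc continuous_const
  have hcomp : IsCompact ({w | DeterminesCenter T (fun i => a i w)} ∩ K) := hK.inter_left hclosed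
  set Z := mm '' ({w | DeterminesCenter T (fun i => a i w)} ∩ K) with hZ
  have hZc : IsClosed Z := (hcomp.image hmm).isClosed
  have hN : 1 ≤ S.card := Finset.card_pos.2 ⟨t0, Finset.mem_insert_self _ _⟩
  obtain ⟨F, hF, hFZ⟩ : ∃ F : (Fin S.card → ℂ) → ℂ, Continuous F ∧ ∀ y, F y = 0 ↔ y ∈ Z := by
    rcases Z.eq_empty_or_nonempty with h | h
    · exact ⟨fun _ => 1, continuous_const, fun y => by simp [h]⟩
    · refine ⟨fun y => (Metric.infDist y Z : ℂ), Complex.continuous_ofReal.comp (Metric.continuous_infDist_pt Z), fun y => ?_⟩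
      rw [hZc.mem_iff_infDist_zero h, Complex.ofReal_eq_zero]
  have hcenZ : ∀ w ∈ K, DeterminesCenter T (fun i => a i w) ↔ mm w ∈ Z := by
    intro w hw
    constructor
    · intro h; exact ⟨w, ⟨h, hw⟩, rfl⟩
    · rintro ⟨w', ⟨h, -⟩, h2⟩
      exact (hsat w' w h2).1 h
  refine ⟨S.card, hN, fun j => (eq j : ι).1.1, fun j => (eq j : ι).2, fun _ => F, fun j => (eq j : ι).1.2, fun _ => hF, ?_, ?_⟩
  · ext w
    simp only [mem_inter_iff, mem_setOf_eq]
    rw [and_comm]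
    refine and_congr_right fun hw => ?_
    rw [hcenZ w hw, ← hFZ, hmme w]
    exact ⟨fun h _ => h, fun h => h ⟨0, hN⟩⟩
  · have hit : ∀ w l, iterInt T (fun i => a i w) l = wd l.reverse (A w) T := by
      intro w l
      unfold iterInt
      rw [← List.map_reverse, simplex_congr (haA w) _ T ⟨hT.le, le_rfl⟩]
      rfl
    ext w
    simp only [mem_inter_iff, mem_setOf_eq]
    rw [and_comm]
    refine and_congr_right fun hw => ⟨fun h j => ?_, fun h l hl => ?_⟩
    · rw [moment_congr hT (haA w)]
      refine moment_zero_of_wd (A w) T (fun l hl => ?_) _ _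
      have := h l.reverse (by simpa using hl)
      rwa [hit, List.reverse_reverse] at this
    · rw [hit]
      refine thmS hT (DD w) (mom_zero_of (fm_diff T (DD w)) (h0 w) fun ps hps i => ?_) _ (by simpa using hl)
      have := hS0 (cw w) (fun t ht => by
        obtain ⟨j, rfl⟩ := hsurj t (Finset.mem_insert_of_mem (Finset.mem_union_left _ ht))
        rw [← hMa]; exact h j) (⟨ps, hps⟩, i)
      rw [← hMA] at this
      exact this

end Ctr
end
end

/-- **Theorem 1.**  Suppose the coefficients `a_i(w,x)` of the equation
`dv/dx = Σ a_i(w,x) v^{i+1}` are finite sums `Σ_j c_{ij}(w) e_j(x)` with `c_{ij}`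
entire on `ℂ^k` and `e_j` admissible.  Then for every compact `K ⊆ ℂ^k` there are
finitely many moments `m₁,…,m_N` and continuous functions `f₁,…,f_N : ℂ^N → ℂ` such
that the center set in `K` is `{w ∈ K : f_j(m₁(w),…,m_N(w)) = 0 ∀j}` and the
universal center set in `K` is `{w ∈ K : m_j(w) = 0 ∀j}`. -/
theorem center_set_in_compact_cut_out_by_continuous_functions_of_moments
    (T : ℝ) (hT : 0 < T) (n k : ℕ) (hn : 1 ≤ n) (hk : 1 ≤ k)
    (a : Fin n → (Fin k → ℂ) → ℝ → ℂ)
    -- each `a i` is a finite sum of products of entire functions of `w` and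
    -- admissible functions of `x`
    (hrep : ∀ i, ∃ (m : ℕ) (c : Fin m → (Fin k → ℂ) → ℂ) (e : Fin m → ℝ → ℂ),
      (∀ j, Differentiable ℂ (c j)) ∧ (∀ j, Admissible T (e j)) ∧
      ∀ (w : Fin k → ℂ), ∀ x ∈ Icc (0:ℝ) T, a i w x = ∑ j, c j w * e j x) :
    ∀ K : Set (Fin k → ℂ), IsCompact K →
      ∃ N : ℕ, 1 ≤ N ∧
        ∃ (ps : Fin N → List (Fin n × ℕ)) (idx : Fin N → Fin n)
          (f : Fin N → (Fin N → ℂ) → ℂ),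
          (∀ j, ∀ q ∈ ps j, 0 < q.2) ∧ (∀ j, Continuous (f j)) ∧
          {w : Fin k → ℂ | DeterminesCenter T (fun i => a i w)} ∩ K =
            {w ∈ K | ∀ j, f j
              (fun t => moment T (fun i => a i w) (ps t) (idx t)) = 0} ∧
          {w : Fin k → ℂ | ∀ l : List (Fin n), l ≠ [] →
              iterInt T (fun i => a i w) l = 0} ∩ K =
            {w ∈ K | ∀ j, moment T (fun i => a i w) (ps j) (idx j) = 0} := by
  exact Ctr.main T hT n k hn a hrep

end
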